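/- Let f be an E-function, let s ≥ 1, and suppose that the s+1 functions 1, f(z), f'(z), …, f^{(s−1)}(z) are linearly independent over ℚ̄(z) and that there exist polynomials u_0(z), u_1(z), …, u_{s+1}(z) ∈ ℚ̄[z] with u_0 not identically zero such that u_0(z) f^{(s)}(z) = u_1(z) + u_2(z) f(z) + u_3(z) f'(z) + … + u_{s+1}(z) f^{(s−1)}(z) identically. Then for every nonzero algebraic number α with u_0(α) ≠ 0, the complex numbers 1, f(α), f'(α), …, f^{(s−1)}(α) are linearly independent over ℚ̄; in particular, f(α) is transcendental. -/

import Mathlib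

noncomputable section

/-- `ℚ̄`: the field of algebraic numbers, i.e. the algebraic closure of `ℚ` inside `ℂ`. -/
def Qbar : IntermediateField ℚ ℂ := algebraicClosure ℚ ℂ

/-- `f : ℂ → ℂ` is the E-function with Taylor coefficients `aₙ/n!` (the `aₙ` being
algebraic numbers): `f(z) = ∑ aₙ/n! zⁿ`; the conjugates of the `aₙ` grow at most
geometrically; the `aₙ` admit denominators growing at most geometrically; and `f`
satisfies a nonzero linear differential equation with coefficients in `ℚ̄(z)`
(equivalently, after clearing denominators, with polynomial coefficients all of
whose coefficients are algebraic). -/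
def IsEFunctionWith (a : ℕ → Qbar) (f : ℂ → ℂ) : Prop :=
  (∀ z : ℂ, HasSum (fun n : ℕ => (a n : ℂ) / n.factorial * z ^ n) (f z)) ∧
  (∃ C : ℝ, 0 < C ∧ ∀ σ : Qbar →+* ℂ, ∀ n : ℕ, ‖σ (a n)‖ ≤ C ^ (n + 1)) ∧
  (∃ D : ℝ, 0 < D ∧ ∃ d : ℕ → ℕ, (∀ n : ℕ, d n ≠ 0 ∧ (d n : ℝ) ≤ D ^ (n + 1)) ∧
    ∀ n : ℕ, ∀ m ≤ n, IsIntegral ℤ ((d n : ℂ) * (a m : ℂ))) ∧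
  (∃ r : ℕ, ∃ p : Fin (r + 1) → Polynomial ℂ,
    (∀ j, ∀ i, IsAlgebraic ℚ ((p j).coeff i)) ∧ (∃ j, p j ≠ 0) ∧
    ∀ z : ℂ, ∑ j : Fin (r + 1), (p j).eval z * iteratedDeriv (j : ℕ) f z = 0)

/-- `f : ℂ → ℂ` is an E-function. -/
def IsEFunction (f : ℂ → ℂ) : Prop := ∃ a : ℕ → Qbar, IsEFunctionWith a f

namespace EFun
open PowerSeries Matrix

section MatrixODE
variable {k : Type*} [Field k] {I J L : Type*} [Fintype I] [Fintype J] [Fintype L]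

lemma map_derivative_mul (M : Matrix I J k⟦X⟧) (N : Matrix J L k⟦X⟧) :
    (M * N).map (derivative k) = M.map (derivative k) * N + M * N.map (derivative k) := by
  ext1 i j
  simp only [map_apply, mul_apply, Matrix.add_apply, map_sum, Derivation.leibniz, smul_eq_mul,
    Finset.sum_add_distrib]
  rw [add_comm]
  congr 1
  exact Finset.sum_congr rfl fun _ _ => mul_comm _ _

/-- Coefficient matrices of the solution of `Ψ' = -Ψ M`, `Ψ(0) = 1`. -/
def fundCoeff [DecidableEq I] (M : Matrix I I k⟦X⟧) : ℕ → Matrix I I k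
  | 0 => 1
  | n + 1 => -((n : k) + 1)⁻¹ • ∑ i : Fin (n + 1), fundCoeff M i * M.map (coeff (n - i))

variable [CharZero k]

/-- Existence of a fundamental matrix. -/
lemma exists_fundamental [DecidableEq I] (M : Matrix I I k⟦X⟧) :
    ∃ Ψ : Matrix I I k⟦X⟧, Ψ.map (derivative k) = -(Ψ * M) ∧
      Ψ.map (constantCoeff (R := k)) = 1 := by
  refine ⟨Matrix.of fun i j => PowerSeries.mk fun n => fundCoeff M n i j, ?_, ?_⟩
  · ext i j n
    have hn : (n : k) + 1 ≠ 0 := by exact_mod_cast n.succ_ne_zero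
    simp only [map_apply, of_apply, coeff_derivative, coeff_mk, fundCoeff,
      Matrix.smul_apply, Matrix.sum_apply, mul_apply, Matrix.neg_apply, map_neg, map_sum, smul_eq_mul,
      PowerSeries.coeff_mul, Finset.Nat.sum_antidiagonal_eq_sum_range_succ_mk]
    rw [Finset.sum_comm (s := Finset.univ) (t := Finset.range n.succ), Finset.sum_range]
    field_simp
  · ext i j
    simp [fundCoeff]

/-- Uniqueness for `X' = -X M`. -/
lemma eq_of_ode (M : Matrix I I k⟦X⟧) (A B : Matrix J I k⟦X⟧)
    (hA : A.map (derivative k) = -(A * M)) (hB : B.map (derivative k) = -(B * M))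
    (h0 : A.map (constantCoeff (R := k)) = B.map (constantCoeff (R := k))) : A = B := by
  have key : ∀ n : ℕ, ∀ j i, coeff n (A j i) = coeff n (B j i) := by
    intro n
    induction n using Nat.strong_induction_on with
    | _ n ih =>
      intro j i
      rcases n with _ | n
      · simpa using congr_fun (congr_fun h0 j) i
      · have hn : (n : k) + 1 ≠ 0 := by exact_mod_cast n.succ_ne_zero
        have e1 := congr_arg (coeff n) (congr_fun (congr_fun hA j) i)
        have e2 := congr_arg (coeff n) (congr_fun (congr_fun hB j) i)
        simp only [map_apply, coeff_derivative, Matrix.neg_apply, mul_apply, map_neg, map_sum,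
          PowerSeries.coeff_mul] at e1 e2
        apply mul_right_cancel₀ hn
        rw [e1, e2]
        congr 1
        refine Finset.sum_congr rfl fun l _ => Finset.sum_congr rfl fun p hp => ?_
        rw [ih p.1 (by have := Finset.HasAntidiagonal.mem_antidiagonal.1 hp; omega)]
  ext j i n
  exact key n j i

end MatrixODE

section Algebra
variable {k : Type*} [Field k]

/-- A polynomial, expanded at `α`, as a power series. -/
def shift (α : k) : Polynomial k →+* k⟦X⟧ :=
  Polynomial.coeToPowerSeries.ringHom.comp (Polynomial.taylorAlgHom α : Polynomial k →+* _)

lemma shift_apply (α : k) (p : Polynomial k) :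
    shift α p = ((Polynomial.taylor α p : Polynomial k) : k⟦X⟧) := rfl

lemma constantCoeff_shift (α : k) (p : Polynomial k) :
    constantCoeff (shift α p) = p.eval α := by
  rw [shift_apply, ← coeff_zero_eq_constantCoeff_apply, Polynomial.coeff_coe,
    Polynomial.taylor_coeff_zero]

lemma shift_injective (α : k) : Function.Injective (shift α) := fun p q h => by
  rw [shift_apply, shift_apply, Polynomial.coe_inj] at h
  exact Polynomial.taylor_injective α h

lemma derivative_shift (α : k) (p : Polynomial k) :
    derivative k (shift α p) = shift α (Polynomial.derivative p) := by
  rw [shift_apply, shift_apply, derivative_coe]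
  congr 1
  simp [Polynomial.taylor_apply, Polynomial.derivative_comp]

lemma X_pow_dvd_shift (α : k) (p : Polynomial k) (n : ℕ) :
    X ^ n ∣ shift α p ↔ (Polynomial.X - Polynomial.C α) ^ n ∣ p := by
  rw [Polynomial.X_sub_C_pow_dvd_iff, ← Polynomial.taylor_apply, shift_apply,
    PowerSeries.X_pow_dvd_iff, Polynomial.X_pow_dvd_iff]
  simp [Polynomial.coeff_coe]

lemma X_pow_dvd_of_dvd_mul {φ ψ : k⟦X⟧} {N b : ℕ} (h : X ^ N ∣ φ * ψ)
    (hb : ¬ X ^ (b + 1) ∣ ψ) : X ^ (N - b) ∣ φ := by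
  have hψ : ψ ≠ 0 := fun h0 => hb (h0 ▸ dvd_zero _)
  obtain ⟨u, hu⟩ : ∃ u : k⟦X⟧ˣ, (u : k⟦X⟧) = _ := isUnit_divided_by_X_pow_order hψ
  have e : ψ = X ^ ψ.order.toNat * (u : k⟦X⟧) := by rw [hu, X_pow_order_mul_divXPowOrder]
  have ho : ψ.order.toNat ≤ b := by
    by_contra hlt
    exact hb ((pow_dvd_pow _ (by omega)).trans X_pow_order_dvd)
  have h1 : X ^ N ∣ φ * X ^ ψ.order.toNat := by
    rw [e, ← mul_assoc] at h
    exact (Units.dvd_mul_right (u := u)).1 h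
  rcases le_total N ψ.order.toNat with hN | hN
  · have : N - b = 0 := by omega
    simp [this]
  · have h2 : X ^ (N - ψ.order.toNat) * X ^ ψ.order.toNat ∣ φ * X ^ ψ.order.toNat := by
      rwa [← pow_add, Nat.sub_add_cancel hN]
    have h3 := (mul_dvd_mul_iff_right (pow_ne_zero _ X_ne_zero)).1 h2
    exact (pow_dvd_pow _ (by omega)).trans h3

/-- Nonzero elements of a finite-dimensional space of power series have bounded order. -/
lemma exists_order_bound (V : Submodule k k⟦X⟧) [FiniteDimensional k V] :
    ∃ b : ℕ, ∀ ψ ∈ V, ψ ≠ 0 → ¬ X ^ b ∣ ψ := by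
  let F : ℕ → Submodule k V := fun n =>
    { carrier := {x | X ^ n ∣ (x : k⟦X⟧)}
      add_mem' := fun ha hb => dvd_add ha hb
      zero_mem' := dvd_zero _
      smul_mem' := fun c x hx => by
        change X ^ n ∣ c • (x : k⟦X⟧)
        exact dvd_smul_of_dvd c hx }
  have hF : Antitone F := fun a b hab x hx => (pow_dvd_pow _ hab).trans hx
  obtain ⟨n, hn⟩ := monotone_stabilizes_iff_artinian.2 (inferInstance : IsArtinian k V)
    ⟨fun n => OrderDual.toDual (F n), hF⟩
  refine ⟨n, fun ψ hψ h0 hd => h0 ?_⟩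
  ext l
  have hm : (⟨ψ, hψ⟩ : V) ∈ F (max n (l + 1)) := by
    have := hn (max n (l + 1)) (le_max_left _ _)
    have h' : F n = F (max n (l + 1)) := this
    rw [← h']
    exact hd
  exact X_pow_dvd_iff.1 (show X ^ (max n (l + 1)) ∣ ψ from hm) l (by omega)

/-- Some maximal minor of a matrix with independent rows over a domain is nonzero. -/
lemma exists_minor_ne_zero {R : Type*} [CommRing R] [IsDomain R] {I : Type*} :
    ∀ {r : ℕ} (A : Matrix (Fin r) I R), (∀ x : Fin r → R, x ᵥ* A = 0 → x = 0) →
      ∃ J : Fin r → I, (A.submatrix id J).det ≠ 0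
  | 0, A, _ => ⟨Fin.elim0, by simp⟩
  | r + 1, A, hA => by
    have h1 : ∀ x : Fin r → R, x ᵥ* (A.submatrix Fin.castSucc id) = 0 → x = 0 := by
      intro x hx
      have := hA (Fin.snoc x 0) (by
        ext i
        have := congr_fun hx i
        simp only [vecMul, dotProduct, submatrix_apply, id] at this ⊢
        rw [Fin.sum_univ_castSucc]
        simpa using this)
      ext j
      have h := congr_fun this j.castSucc
      simpa using h
    obtain ⟨J, hJ⟩ := exists_minor_ne_zero _ h1
    by_contra! hcon
    let x : Fin (r + 1) → R := fun i =>
      (-1) ^ (i + Fin.last r : ℕ) * ((A.submatrix id J).submatrix i.succAbove id).det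
    have hx : x ᵥ* A = 0 := by
      ext i
      have h := hcon (Fin.snoc J i)
      rw [det_succ_column _ (Fin.last r)] at h
      simp only [vecMul, dotProduct, Pi.zero_apply]
      rw [← h]
      refine Finset.sum_congr rfl fun a _ => ?_
      simp only [x, submatrix_apply, id, Fin.snoc_last, submatrix_submatrix]
      rw [mul_right_comm]
      congr 2
      ext a b
      simp
    have := congr_fun (hA x hx) (Fin.last r)
    simp only [x, Pi.zero_apply, mul_eq_zero] at this
    rcases this with h | h
    · exact pow_ne_zero _ (neg_ne_zero.2 one_ne_zero) h
    · apply hJ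
      rw [← h]
      congr 1
      ext a b
      simp

lemma natDegree_det_le {n : Type*} [Fintype n] [DecidableEq n] (A : Matrix n n (Polynomial k))
    (e : ℕ) (h : ∀ i j, (A i j).natDegree ≤ e) : A.det.natDegree ≤ Fintype.card n * e := by
  rw [det_apply]
  refine Polynomial.natDegree_sum_le_of_forall_le _ _ fun σ _ => ?_
  refine (Polynomial.natDegree_smul_le _ _).trans ?_
  refine (Polynomial.natDegree_prod_le _ _).trans ?_
  refine (Finset.sum_le_sum fun i _ => h (σ i) i).trans ?_
  simp

lemma det_mem_pow {A : Type*} [CommRing A] [Algebra k A] {n : Type*} [Fintype n] [DecidableEq n]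
    (V : Submodule k A) (M : Matrix n n A) (h : ∀ i j, M i j ∈ V) :
    M.det ∈ V ^ Fintype.card n := by
  rw [det_apply]
  refine Submodule.sum_mem _ fun σ _ => ?_
  have : ∏ i, M (σ i) i ∈ V ^ Fintype.card n := by
    have aux : ∀ s : Finset n, ∏ i ∈ s, M (σ i) i ∈ V ^ s.card := by
      classical
      intro s
      induction s using Finset.induction_on with
      | empty => simpa using ⟨(1 : k), map_one (algebraMap k A)⟩
      | insert a s ha ih =>
        rw [Finset.prod_insert ha, Finset.card_insert_of_notMem ha, pow_succ']
        exact Submodule.mul_mem_mul (h _ _) ih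
    exact aux Finset.univ
  rcases Int.units_eq_one_or (Equiv.Perm.sign σ) with h' | h' <;> rw [h']
  · simpa using this
  · simpa using this

/-- Rational ratios of elements of a finite-dimensional space have bounded degree. -/
lemma exists_ratio_degree_bound (α : k) (U : Submodule k k⟦X⟧) [FiniteDimensional k U] :
    ∃ c : ℕ, ∀ x ∈ U, ∀ y ∈ U, y ≠ 0 → ∀ p q : Polynomial k, q ≠ 0 →
      shift α q * x = shift α p * y → ∃ p' q' : Polynomial k, q' ≠ 0 ∧ p'.natDegree ≤ c ∧
        q'.natDegree ≤ c ∧ p * q' = p' * q := by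
  let : Algebra (Polynomial k) k⟦X⟧ := (shift α).toAlgebra
  have hsm : ∀ (p : Polynomial k) (x : k⟦X⟧), p • x = shift α p * x := fun p x => rfl
  have : Module.IsTorsionFree (Polynomial k) k⟦X⟧ :=
    Module.isTorsionFree_iff_algebraMap_injective.2 (shift_injective α)
  let u := Module.finBasis k U
  let N : Submodule (Polynomial k) k⟦X⟧ := Submodule.span _ (Set.range fun i => (u i : k⟦X⟧))
  have : Module.Finite (Polynomial k) N := Module.Finite.span_of_finite _ (Set.finite_range _)
  let ψ := Module.Free.chooseBasis (Polynomial k) N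
  have hu : ∀ i, (u i : k⟦X⟧) ∈ N := fun i => Submodule.subset_span ⟨i, rfl⟩
  let S : Fin (Module.finrank k U) → _ → Polynomial k := fun i l => ψ.repr ⟨u i, hu i⟩ l
  obtain ⟨c, hc⟩ : ∃ c : ℕ, ∀ i l, (S i l).natDegree ≤ c := by
    refine ⟨∑ i, ∑ l, (S i l).natDegree, fun i l => ?_⟩
    exact (Finset.single_le_sum (f := fun l => (S i l).natDegree) (fun _ _ => Nat.zero_le _)
      (Finset.mem_univ l)).trans (Finset.single_le_sum
        (f := fun i => ∑ l, (S i l).natDegree) (fun _ _ => Nat.zero_le _) (Finset.mem_univ i))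
  have hcoord : ∀ x ∈ U, ∃ x' : _ → Polynomial k, (∀ l, (x' l).natDegree ≤ c) ∧
      x = ∑ l, shift α (x' l) * ψ l := by
    intro x hx
    refine ⟨fun l => ∑ i, Polynomial.C (u.repr ⟨x, hx⟩ i) * S i l, fun l => ?_, ?_⟩
    · exact Polynomial.natDegree_sum_le_of_forall_le _ _ fun i _ =>
        (Polynomial.natDegree_C_mul_le _ _).trans (hc i l)
    · have h1 : x = ∑ i, shift α (Polynomial.C (u.repr ⟨x, hx⟩ i)) * (u i : k⟦X⟧) := by
        have := congr_arg Subtype.val (u.sum_repr ⟨x, hx⟩)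
        refine Eq.trans this.symm ?_
        simp only [Submodule.coe_sum, Submodule.coe_smul]
        refine Finset.sum_congr rfl fun i _ => ?_
        rw [shift_apply, Polynomial.taylor_C, Polynomial.coe_C, PowerSeries.smul_eq_C_mul]
      have h2 : ∀ i, (u i : k⟦X⟧) = ∑ l, shift α (S i l) * ψ l := by
        intro i
        have := congr_arg Subtype.val (ψ.sum_repr ⟨u i, hu i⟩)
        conv_lhs => rw [show (u i : k⟦X⟧) = ((⟨u i, hu i⟩ : N) : k⟦X⟧) from rfl, ← this]
        simp only [Submodule.coe_sum, Submodule.coe_smul, hsm, S]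
      refine h1.trans ?_
      simp_rw [h2, map_sum, map_mul, Finset.mul_sum, Finset.sum_mul]
      rw [Finset.sum_comm]
      simp_rw [mul_assoc]
  refine ⟨c, fun x hx y hy hy0 p q hq hpq => ?_⟩
  obtain ⟨x', hx', ex⟩ := hcoord x hx
  obtain ⟨y', hy', ey⟩ := hcoord y hy
  have hl : ∃ l, y' l ≠ 0 := by
    by_contra! h
    exact hy0 (by rw [ey]; simp [h])
  obtain ⟨l, hl⟩ := hl
  refine ⟨x' l, y' l, hl, hx' l, hy' l, ?_⟩
  have h3 : ∑ l, (q * x' l) • ψ l = ∑ l, (p * y' l) • ψ l := by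
    apply Subtype.ext
    simp only [Submodule.coe_sum, Submodule.coe_smul, hsm, map_mul, mul_assoc, ← Finset.mul_sum]
    rw [← ex, ← ey, hpq]
  have h4 := congr_arg (fun z => ψ.repr z l) h3
  simp only [Module.Basis.repr_sum_self] at h4
  rw [← h4, mul_comm]

end Algebra

section RowSeq
variable {R : Type*} [CommRing R] {I : Type*} [Fintype I]

/-- The iterates of `P ↦ T P' + P B` on row vectors of polynomials. -/
def rowSeq (T : Polynomial R) (B : Matrix I I (Polynomial R)) (P : I → Polynomial R) :
    ℕ → I → Polynomial R
  | 0 => P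
  | n + 1 => fun i => T * Polynomial.derivative (rowSeq T B P n i) +
      ∑ l, rowSeq T B P n l * B l i

lemma natDegree_rowSeq_le {T : Polynomial R} {B : Matrix I I (Polynomial R)} {P : I → Polynomial R}
    {e n : ℕ} (hT : T.natDegree ≤ e) (hB : ∀ i j, (B i j).natDegree ≤ e)
    (hP : ∀ i, (P i).natDegree ≤ n) : ∀ j i, (rowSeq T B P j i).natDegree ≤ n + j * e
  | 0, i => by simpa [rowSeq] using hP i
  | j + 1, i => by
    have ih := natDegree_rowSeq_le hT hB hP j
    rw [rowSeq]
    refine (Polynomial.natDegree_add_le _ _).trans (max_le ?_ ?_)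
    · refine Polynomial.natDegree_mul_le.trans ?_
      have h2 := (Polynomial.natDegree_derivative_le (rowSeq T B P j i)).trans
        (Nat.sub_le _ _) |>.trans (ih i)
      have : (j + 1) * e = j * e + e := by ring
      omega
    · refine Polynomial.natDegree_sum_le_of_forall_le _ _ fun l _ => ?_
      refine Polynomial.natDegree_mul_le.trans ?_
      have h2 := ih l
      have := hB l i
      have : (j + 1) * e = j * e + e := by ring
      omega

lemma rowSeq_map {S : Type*} [CommRing S] (φ : R →+* S) (T : Polynomial R)
    (B : Matrix I I (Polynomial R)) (P : I → Polynomial R) : ∀ (j : ℕ) (i : I),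
    (rowSeq T B P j i).map φ =
      rowSeq (T.map φ) (B.map (Polynomial.map φ)) (fun i => (P i).map φ) j i
  | 0, i => rfl
  | j + 1, i => by
    simp only [rowSeq, Polynomial.map_add, Polynomial.map_mul, Polynomial.map_sum,
      rowSeq_map φ T B P j, Matrix.map_apply, ← Polynomial.derivative_map]

/-- If `T v' = B v`, the forms `R_j = P_j · v` satisfy `R_{j+1} = T R_j'`. -/
lemma rowSeq_form {H : Type*} [CommRing H] (φ : Polynomial R →+* H) (D : H →+ H)
    (hD : ∀ x y, D (x * y) = D x * y + x * D y)
    (hφ : ∀ p, D (φ p) = φ (Polynomial.derivative p)) (T : Polynomial R)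
    (B : Matrix I I (Polynomial R)) (P : I → Polynomial R) (v : I → H)
    (hv : ∀ i, φ T * D (v i) = ∑ l, φ (B i l) * v l) (j : ℕ) :
    ∑ i, φ (rowSeq T B P (j + 1) i) * v i = φ T * D (∑ i, φ (rowSeq T B P j i) * v i) := by
  simp only [rowSeq, map_add, map_mul, map_sum, hD, hφ, add_mul, Finset.sum_add_distrib, mul_add,
    Finset.mul_sum]
  congr 1
  · exact Finset.sum_congr rfl fun i _ => by ring
  · simp_rw [Finset.sum_mul]
    rw [Finset.sum_comm]
    refine Finset.sum_congr rfl fun i _ => ?_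
    rw [mul_left_comm, hv, Finset.mul_sum]
    exact Finset.sum_congr rfl fun l _ => by ring

end RowSeq

section ZeroEstimate
variable {k : Type*} [Field k]

lemma X_pow_dvd_derivative {φ : k⟦X⟧} {s : ℕ} (h : X ^ s ∣ φ) : X ^ (s - 1) ∣ derivative k φ := by
  rw [X_pow_dvd_iff] at h ⊢
  intro m hm
  rw [coeff_derivative, h _ (by omega), zero_mul]

lemma X_pow_dvd_coe {p : Polynomial k} {s : ℕ} :
    (X : k⟦X⟧) ^ s ∣ (p : k⟦X⟧) ↔ Polynomial.X ^ s ∣ p := by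
  rw [X_pow_dvd_iff, Polynomial.X_pow_dvd_iff]
  simp [Polynomial.coeff_coe]

variable [CharZero k]

lemma X_pow_dvd_of_derivative {φ : k⟦X⟧} {s : ℕ} (h : X ^ s ∣ derivative k φ)
    (h0 : constantCoeff φ = 0) : X ^ (s + 1) ∣ φ := by
  rw [X_pow_dvd_iff] at h ⊢
  intro m hm
  rcases m with _ | m
  · simpa using h0
  · have := h m (by omega)
    rw [coeff_derivative] at this
    exact (mul_eq_zero.1 this).resolve_right (by exact_mod_cast m.succ_ne_zero)

/-- Two solutions of a first-order scalar equation are proportional. -/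
lemma exists_eq_C_mul_of_derivative {d c : k⟦X⟧} (hd : d ≠ 0)
    (h : d * derivative k c = derivative k d * c) : ∃ κ : k, c = C κ * d := by
  have key : ∀ e : k⟦X⟧, e ≠ 0 → d * derivative k e = derivative k d * e →
      e.order.toNat = d.order.toNat := by
    intro e he h
    have hXd : ∀ f : k⟦X⟧, X * derivative k f = X ^ f.order.toNat *
        ((f.order.toNat : k⟦X⟧) * divXPowOrder f + X * derivative k (divXPowOrder f)) := by
      intro f
      conv_lhs => rw [← X_pow_order_mul_divXPowOrder (f := f)]
      rw [Derivation.leibniz, Derivation.leibniz_pow, derivative_X]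
      rcases Nat.eq_zero_or_pos f.order.toNat with h | h
      · simp [h]
      · obtain ⟨n, hn⟩ := Nat.exists_eq_succ_of_ne_zero h.ne'
        rw [hn]
        simp only [smul_eq_mul, nsmul_eq_mul, Nat.succ_eq_add_one, Nat.add_sub_cancel]
        ring
    have h2 : d * (X * derivative k e) = (X * derivative k d) * e := by
      linear_combination X * h
    rw [hXd e, hXd d] at h2
    set a := d.order.toNat
    set b := e.order.toNat
    have hd' : d = X ^ a * divXPowOrder d := X_pow_order_mul_divXPowOrder.symm
    have he' : e = X ^ b * divXPowOrder e := X_pow_order_mul_divXPowOrder.symm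
    generalize hD : divXPowOrder d = d1 at *
    generalize hE : divXPowOrder e = e1 at *
    have h3 : X ^ (a + b) * (d1 * ((b : k⟦X⟧) * e1 + X * derivative k e1)) =
        X ^ (a + b) * (((a : k⟦X⟧) * d1 + X * derivative k d1) * e1) := by
      rw [hd', he'] at h2
      rw [pow_add]
      linear_combination h2
    have h4 := congr_arg constantCoeff (mul_left_cancel₀ (pow_ne_zero _ X_ne_zero) h3)
    have hd0 : constantCoeff d1 ≠ 0 := by
      rw [← hD]; exact constantCoeff_divXPowOrder_eq_zero_iff.not.2 hd
    have he0 : constantCoeff e1 ≠ 0 := by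
      rw [← hE]; exact constantCoeff_divXPowOrder_eq_zero_iff.not.2 he
    simp only [map_mul, map_add, constantCoeff_X, zero_mul, add_zero, map_natCast] at h4
    have h5 : ((b : k) - a) * (constantCoeff d1 * constantCoeff e1) = 0 := by
      linear_combination h4
    rcases mul_eq_zero.1 h5 with h | h
    · exact_mod_cast sub_eq_zero.1 h
    · exact absurd h (mul_ne_zero hd0 he0)
  set a := d.order.toNat with ha
  have hda : coeff a d ≠ 0 := by
    rw [ha, ← constantCoeff_divXPowOrder]
    exact constantCoeff_divXPowOrder_eq_zero_iff.not.2 hd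
  refine ⟨coeff a c / coeff a d, ?_⟩
  by_contra hne
  have he : c - C (coeff a c / coeff a d) * d ≠ 0 := sub_ne_zero.2 hne
  have h1 := key _ he (by
    rw [map_sub, Derivation.leibniz, derivative_C]
    simp only [smul_eq_mul, mul_zero, add_zero]
    linear_combination h)
  have h2 := constantCoeff_divXPowOrder_eq_zero_iff.not.2 he
  rw [constantCoeff_divXPowOrder, h1, map_sub, coeff_C_mul, div_mul_cancel₀ _ hda] at h2
  exact h2 (sub_self _)

/-- A fundamental matrix together with its inverse. -/
lemma exists_fundamental_pair {I : Type*} [Fintype I] [DecidableEq I] (M : Matrix I I k⟦X⟧) :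
    ∃ Φ Ψ : Matrix I I k⟦X⟧, Φ.map (derivative k) = M * Φ ∧
      Φ.map (constantCoeff (R := k)) = 1 ∧ Ψ * Φ = 1 ∧ Φ * Ψ = 1 := by
  obtain ⟨Φ', h1, h2⟩ := exists_fundamental (-Mᵀ)
  obtain ⟨Ψ, h3, h4⟩ := exists_fundamental M
  have h5 : Φ'ᵀ.map (derivative k) = M * Φ'ᵀ := by
    rw [transpose_map, h1]
    simp
  have h6 : Φ'ᵀ.map (constantCoeff (R := k)) = 1 := by
    rw [transpose_map, h2, transpose_one]
  have h7 : Ψ * Φ'ᵀ = 1 := by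
    refine eq_of_ode 0 _ _ ?_ ?_ ?_
    · rw [map_derivative_mul, h3, h5]
      simp [Matrix.mul_assoc]
    · ext i j
      by_cases h : i = j <;> simp [h]
    · rw [Matrix.map_mul, h4, h6]
      ext i j
      by_cases h : i = j <;> simp [h]
  exact ⟨Φ'ᵀ, Ψ, h5, h6, h7, mul_eq_one_comm.1 h7⟩

end ZeroEstimate

section ZeroEstimate
variable {k : Type*} [Field k] {I : Type*} [Fintype I]

lemma X_pow_dvd_form {T : Polynomial k} {B : Matrix I I (Polynomial k)} {v : I → k⟦X⟧}
    (hode : ∀ i, (T : k⟦X⟧) * derivative k (v i) = ∑ l, (B i l : k⟦X⟧) * v l)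
    {P : I → Polynomial k} {N : ℕ} (h : X ^ N ∣ ∑ i, (P i : k⟦X⟧) * v i) (j : ℕ) :
    X ^ (N - j) ∣ ∑ i, (rowSeq T B P j i : k⟦X⟧) * v i := by
  induction j with
  | zero => simpa [rowSeq] using h
  | succ j ih =>
    have := rowSeq_form (Polynomial.coeToPowerSeries.ringHom (R := k))
      (derivative k : k⟦X⟧ →+ k⟦X⟧)
      (fun x y => by
        change derivative k (x * y) = _
        rw [Derivation.leibniz, smul_eq_mul, smul_eq_mul]
        change _ = derivative k x * y + x * derivative k y
        ring)
      (fun p => derivative_coe p) T B P v hode j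
    simp only [Polynomial.coeToPowerSeries.ringHom_apply] at this
    rw [this, ← Nat.sub_sub]
    exact Dvd.dvd.mul_left (X_pow_dvd_derivative ih) _

variable [CharZero k] [DecidableEq I]

/-- The rows expanded at `α` and multiplied by a fundamental matrix. -/
lemma exists_flat_frame (T : Polynomial k) (B : Matrix I I (Polynomial k)) {α : k}
    (hT : T.eval α ≠ 0) : ∃ Φ Ψ : Matrix I I k⟦X⟧, Φ.map (constantCoeff (R := k)) = 1 ∧
      Ψ * Φ = 1 ∧ Φ * Ψ = 1 ∧ ∀ P : I → Polynomial k, ∀ j i,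
        ∑ l, shift α (rowSeq T B P (j + 1) l) * Φ l i =
          shift α T * derivative k (∑ l, shift α (rowSeq T B P j l) * Φ l i) := by
  have hT' : constantCoeff (shift α T) ≠ 0 := by rwa [constantCoeff_shift]
  obtain ⟨Φ, Ψ, h1, h2, h3, h4⟩ := exists_fundamental_pair
    ((B.map (shift α)).map fun x => (shift α T)⁻¹ * x)
  refine ⟨Φ, Ψ, h2, h3, h4, fun P j i => ?_⟩
  refine rowSeq_form (shift α) (derivative k : k⟦X⟧ →+ k⟦X⟧) (fun x y => by
        change derivative k (x * y) = _
        rw [Derivation.leibniz, smul_eq_mul, smul_eq_mul]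
        change _ = derivative k x * y + x * derivative k y
        ring) (fun p => derivative_shift α p) T B P (fun l => Φ l i) (fun l => ?_) j
  have := congr_fun (congr_fun h1 l) i
  change derivative k (Φ l i) = _ at this
  change shift α T * derivative k (Φ l i) = _
  rw [this, mul_apply, Finset.mul_sum]
  refine Finset.sum_congr rfl fun a _ => ?_
  simp only [map_apply]
  rw [← mul_assoc, ← mul_assoc, PowerSeries.mul_inv_cancel _ hT', one_mul]

/-- A lower rank stable family of rows bounds the vanishing order. -/
lemma vanishing_le_of_stable {T : Polynomial k} {B : Matrix I I (Polynomial k)} {v : I → k⟦X⟧}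
    {α : k} (hT : T.eval α ≠ 0)
    (hv : ∀ q : I → Polynomial k, ∑ i, (q i : k⟦X⟧) * v i = 0 → q = 0)
    (hode : ∀ i, (T : k⟦X⟧) * derivative k (v i) = ∑ l, (B i l : k⟦X⟧) * v l) :
    ∃ c : ℕ, ∀ (n : ℕ) (P : I → Polynomial k) (N r : ℕ) (J : Fin r → I)
      (x : Fin r → Polynomial k) (y : Polynomial k), 1 ≤ r → r ≤ Fintype.card I →
      (∀ i, (P i).natDegree ≤ n) → X ^ N ∣ ∑ i, (P i : k⟦X⟧) * v i →
      ((Matrix.of fun (j : Fin r) i => rowSeq T B P j i).submatrix id J).det ≠ 0 → y ≠ 0 →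
      (∀ i, y * rowSeq T B P r i = ∑ j : Fin r, x j * rowSeq T B P j i) →
      N ≤ r * n + c := by
  classical
  set m := Fintype.card I
  obtain ⟨Φ, Ψ, hΦ0, hΨΦ, hΦΨ, hflat⟩ := exists_flat_frame T B hT
  let V : Submodule k k⟦X⟧ := Submodule.span k (insert 1 (Set.range fun p : I × I => Ψ p.1 p.2))
  have hVfin : (V ^ (m + 1)).FG :=
    Submodule.FG.pow (Submodule.fg_span ((Set.finite_range _).insert _)) _
  have : FiniteDimensional k (V ^ (m + 1) : Submodule k k⟦X⟧) :=
    Module.Finite.iff_fg.2 hVfin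
  have hV1 : (1 : k⟦X⟧) ∈ V := Submodule.subset_span (Set.mem_insert _ _)
  have hVΨ : ∀ a b, Ψ a b ∈ V := fun a b =>
    Submodule.subset_span (Set.mem_insert_of_mem _ ⟨(a, b), rfl⟩)
  have hmono : ∀ {a b : ℕ}, a ≤ b → V ^ a ≤ V ^ b := fun h =>
    pow_le_pow_right₀ (Submodule.one_le.2 hV1) h
  obtain ⟨c0, hc0⟩ := exists_ratio_degree_bound α (V ^ (m + 1))
  let W : Submodule k k⟦X⟧ := Submodule.span k
    (Set.range fun p : Fin (m * c0 + 1) × I => X ^ (p.1 : ℕ) * v p.2)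
  have : FiniteDimensional k W := FiniteDimensional.span_of_finite k (Set.finite_range _)
  obtain ⟨b, hb⟩ := exists_order_bound W
  obtain ⟨e, heT, heB⟩ : ∃ e : ℕ, T.natDegree ≤ e ∧ ∀ i j, (B i j).natDegree ≤ e := by
    refine ⟨T.natDegree + ∑ i, ∑ j, (B i j).natDegree, by omega, fun i j => ?_⟩
    have h1 := (Finset.single_le_sum (f := fun j => (B i j).natDegree) (fun _ _ => Nat.zero_le _)
      (Finset.mem_univ j)).trans (Finset.single_le_sum
        (f := fun i => ∑ l, (B i l).natDegree) (fun _ _ => Nat.zero_le _) (Finset.mem_univ i))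
    exact le_add_left h1
  refine ⟨m + b + m * (m * e), fun n P N r J x y hr hrm hPn hord hdet hy hrel => ?_⟩
  set A : Matrix (Fin r) I (Polynomial k) := Matrix.of fun j i => rowSeq T B P j i with hA
  set D := (A.submatrix id J).det with hD
  let Aθ : Matrix (Fin r) I k⟦X⟧ := A.map (shift α)
  let G : Matrix (Fin r) I k⟦X⟧ := Aθ * Φ
  have hDθ : (Aθ.submatrix id J).det = shift α D := by
    rw [hD, RingHom.map_det]
    rfl
  have hDθ0 : shift α D ≠ 0 := by
    rw [Ne, map_eq_zero_iff _ (shift_injective α)]; exact hdet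
  have hGΨ : G * Ψ = Aθ := by
    simp only [G]; rw [Matrix.mul_assoc, hΦΨ, Matrix.mul_one]
  obtain ⟨J', hJ'⟩ := exists_minor_ne_zero G (by
    intro z hz
    have h1 : z ᵥ* Aθ = 0 := by rw [← hGΨ, ← Matrix.vecMul_vecMul, hz, Matrix.zero_vecMul]
    have h2 : z ᵥ* (Aθ.submatrix id J) = 0 := by
      ext i
      exact congrArg _ (congr_fun h1 (J i))
    exact Matrix.eq_zero_of_vecMul_eq_zero (by rw [hDθ]; exact hDθ0) h2)
  set Nm := G.submatrix id J' with hNm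
  set d := Nm.det with hd
  -- the differential system satisfied by `G`
  obtain ⟨A', lam, hlam, hsys⟩ : ∃ (A' : Matrix (Fin r) (Fin r) k⟦X⟧) (lam : k⟦X⟧), lam ≠ 0 ∧
      ∀ j i, lam * derivative k (G j i) = (A' * G) j i := by
    refine ⟨Matrix.of fun j l => if h : (j : ℕ) + 1 < r then
      (if (l : ℕ) = j + 1 then shift α y else 0) else shift α (x l), shift α T * shift α y,
      mul_ne_zero ?_ ?_, fun j i => ?_⟩
    · intro h0
      have := constantCoeff_shift α T
      rw [h0, map_zero] at this
      exact hT this.symm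
    · rwa [Ne, map_eq_zero_iff _ (shift_injective α)]
    · have h1 := hflat P j i
      have hGj : ∀ j : Fin r, G j i = ∑ l, shift α (rowSeq T B P j l) * Φ l i := fun j => rfl
      rw [mul_right_comm, hGj, ← h1]
      refine Eq.trans ?_ (Matrix.mul_apply ..).symm
      simp only [of_apply]
      by_cases h : (j : ℕ) + 1 < r
      · simp only [h, dif_pos]
        refine Eq.trans ?_ (Finset.sum_eq_single (⟨(j : ℕ) + 1, h⟩ : Fin r) ?_ ?_).symm
        · simp only [if_true, hGj]
          ring
        · intro l _ hl
          rw [if_neg (fun h' => hl (Fin.ext h')), zero_mul]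
        · intro h; exact absurd (Finset.mem_univ _) h
      · simp only [h, dif_neg, not_false_eq_true]
        have hjr : (j : ℕ) + 1 = r := by have := j.2; omega
        rw [hjr, Finset.sum_mul]
        simp_rw [hGj, Finset.mul_sum]
        rw [Finset.sum_comm]
        refine Finset.sum_congr rfl fun l _ => ?_
        have h2 := congr_arg (shift α) (hrel l)
        simp only [map_mul, map_sum] at h2
        calc _ = (shift α y * shift α (rowSeq T B P r l)) * Φ l i := by ring
          _ = _ := by
            rw [h2, Finset.sum_mul]
            exact Finset.sum_congr rfl fun a _ => by ring
  set Cm := Nm.adjugate * G with hCm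
  have hNC : Nm * Cm = d • G := by
    rw [hCm, ← Matrix.mul_assoc, mul_adjugate, Matrix.smul_mul, Matrix.one_mul]
  have hκ : ∀ a i, ∃ κ : k, Cm a i = C κ * d := by
    intro a i
    refine exists_eq_C_mul_of_derivative hJ' ?_
    have h1 : (Nm * Cm).map (derivative k) = (d • G).map (derivative k) := by rw [hNC]
    rw [map_derivative_mul] at h1
    have h2 : lam • Nm.map (derivative k) = A' * Nm := by
      ext1 j l
      exact hsys j (J' l)
    have h3 : lam • G.map (derivative k) = A' * G := by
      ext1 j l
      exact hsys j l
    have h4 : (d • G).map (derivative k) = derivative k d • G + d • G.map (derivative k) := by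
      ext1 j l
      simp only [map_apply, Matrix.smul_apply, Matrix.add_apply, smul_eq_mul, Derivation.leibniz]
      ring
    have h5 : lam • (Nm * Cm.map (derivative k)) = lam • (derivative k d • G) := by
      have h6 := congrArg (fun M => lam • M) (h1.trans h4)
      simp only [smul_add] at h6
      rw [← Matrix.smul_mul, h2, Matrix.mul_assoc, hNC, smul_comm lam d, h3, Matrix.mul_smul] at h6
      rw [add_comm (lam • _)] at h6
      exact add_left_cancel h6
    have h7 : Nm * Cm.map (derivative k) = derivative k d • G := by
      ext1 j l
      have := congr_fun (congr_fun h5 j) l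
      simp only [Matrix.smul_apply, smul_eq_mul] at this ⊢
      exact mul_left_cancel₀ hlam this
    have h8 := congrArg (fun M => Nm.adjugate * M) h7
    simp only [← Matrix.mul_assoc, adjugate_mul, Matrix.smul_mul, Matrix.one_mul,
      Matrix.mul_smul] at h8
    exact congr_fun (congr_fun h8 a) i
  choose κ hκ using hκ
  let K : Matrix (Fin r) I k⟦X⟧ := Matrix.of fun a i => C (κ a i)
  have hCK : Cm = d • K := by
    ext1 a i
    rw [hκ a i, mul_comm]
    rfl
  have hGN : G = Nm * K := by
    have : d • G = d • (Nm * K) := by rw [← hNC, hCK, Matrix.mul_smul]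
    ext1 a i
    have h := congr_fun (congr_fun this a) i
    simp only [Matrix.smul_apply, smul_eq_mul] at h
    exact mul_left_cancel₀ hJ' h
  have hAN : Aθ = Nm * (K * Ψ) := by rw [← Matrix.mul_assoc, ← hGN, hGΨ]
  set Y := (K * Ψ).submatrix id J with hY
  have hANJ : Aθ.submatrix id J = Nm * Y := by
    rw [hAN, hY]
    ext1 a i
    rfl
  have hKV : ∀ a i, (K * Ψ) a i ∈ V := by
    intro a i
    rw [mul_apply]
    refine Submodule.sum_mem _ fun l _ => ?_
    have : K a l * Ψ l i = κ a l • Ψ l i := by rw [PowerSeries.smul_eq_C_mul]; rfl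
    rw [this]
    exact Submodule.smul_mem _ _ (hVΨ _ _)
  have hYV : ∀ a b, Y a b ∈ V := fun a b => hKV a (J b)
  let a0 : Fin r := ⟨0, hr⟩
  let Dv : I → Polynomial k := fun i => ((A.submatrix id J).adjugate * A) a0 i
  have hDvθ : ∀ i, shift α (Dv i) = d * (Y.adjugate * (K * Ψ)) a0 i := by
    intro i
    have h1 : shift α (Dv i) = ((Aθ.submatrix id J).adjugate * Aθ) a0 i := by
      simp only [Dv, mul_apply, map_sum, map_mul]
      refine Finset.sum_congr rfl fun l _ => ?_
      congr 1
      have := RingHom.map_adjugate (shift α) (A.submatrix id J)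
      exact congr_fun (congr_fun this a0) l
    rw [h1, hANJ, hAN, adjugate_mul_distrib, Matrix.mul_assoc, ← Matrix.mul_assoc Nm.adjugate,
      adjugate_mul, Matrix.smul_mul, Matrix.one_mul, Matrix.mul_smul]
    rfl
  have hDd : shift α D = d * Y.det := by rw [← hDθ, hANJ, det_mul]
  have hYdet : Y.det ≠ 0 := by
    intro h; rw [hDd, h, mul_zero] at hDθ0; exact hDθ0 rfl
  have hYmem : Y.det ∈ V ^ (m + 1) := by
    have := det_mem_pow V Y hYV
    rw [Fintype.card_fin] at this
    exact hmono (by omega) this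
  have hadj : ∀ a b, Y.adjugate a b ∈ V ^ r := by
    intro a b
    rw [adjugate_apply]
    have := det_mem_pow V (Y.updateRow b (Pi.single a 1)) (by
      intro i j
      rw [updateRow_apply]
      split_ifs
      · by_cases h : j = a
        · subst h; simpa using hV1
        · simp [h]
      · exact hYV _ _)
    rwa [Fintype.card_fin] at this
  have hxmem : ∀ i, (Y.adjugate * (K * Ψ)) a0 i ∈ V ^ (m + 1) := by
    intro i
    refine hmono (show r + 1 ≤ m + 1 by omega) ?_
    rw [mul_apply, pow_succ]
    exact Submodule.sum_mem _ fun l _ => Submodule.mul_mem_mul (hadj _ _) (hKV _ _)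
  have hrat : ∀ i, ∃ p' q' : Polynomial k, q' ≠ 0 ∧ p'.natDegree ≤ c0 ∧ q'.natDegree ≤ c0 ∧
      Dv i * q' = p' * D := fun i =>
    hc0 _ (hxmem i) _ hYmem hYdet (Dv i) D hdet (by rw [hDd, hDvθ]; ring)
  choose p' q' hq0 hpdeg hqdeg hpq using hrat
  let Q : Polynomial k := ∏ i, q' i
  have hQ0 : Q ≠ 0 := Finset.prod_ne_zero_iff.2 fun i _ => hq0 i
  let w : I → Polynomial k := fun i => p' i * ∏ l ∈ Finset.univ.erase i, q' l
  have hw : ∀ i, D * w i = Q * Dv i := by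
    intro i
    simp only [w, Q, ← Finset.mul_prod_erase Finset.univ q' (Finset.mem_univ i)]
    linear_combination (-(∏ l ∈ Finset.univ.erase i, q' l)) * hpq i
  have hwdeg : ∀ i, (w i).natDegree ≤ m * c0 := by
    intro i
    refine Polynomial.natDegree_mul_le.trans ?_
    have h1 := (Polynomial.natDegree_prod_le (Finset.univ.erase i) q').trans
      (Finset.sum_le_sum fun l _ => hqdeg l)
    rw [Finset.sum_const, Finset.card_erase_of_mem (Finset.mem_univ i), Finset.card_univ,
      smul_eq_mul] at h1
    have h2 := hpdeg i
    have h3 : 1 ≤ m := hr.trans hrm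
    have h4 : m * c0 = (m - 1) * c0 + c0 := by
      obtain ⟨m', hm'⟩ := Nat.exists_eq_add_of_le' h3
      rw [hm', Nat.add_sub_cancel]; ring
    change _ ≤ (m - 1) * c0 at h1
    omega
  have hDvJ : Dv (J a0) = D := by
    have : ((A.submatrix id J).adjugate * (A.submatrix id J)) a0 a0 = D := by
      rw [adjugate_mul]; simp [hD]
    exact this
  have hw0 : w ≠ 0 := by
    intro h
    have := hw (J a0)
    rw [h, hDvJ, Pi.zero_apply, mul_zero] at this
    exact mul_ne_zero hQ0 hdet this.symm
  set S : k⟦X⟧ := ∑ i, (w i : k⟦X⟧) * v i with hS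
  have hS0 : S ≠ 0 := fun h => hw0 (hv w h)
  have hSW : S ∈ W := by
    refine Submodule.sum_mem _ fun i _ => ?_
    rw [(w i).as_sum_range' (m * c0 + 1) (by have := hwdeg i; omega), Finset.sum_range]
    rw [← Polynomial.coeToPowerSeries.ringHom_apply, map_sum, Finset.sum_mul]
    refine Submodule.sum_mem _ fun l _ => ?_
    rw [Polynomial.coeToPowerSeries.ringHom_apply, ← Polynomial.C_mul_X_pow_eq_monomial,
      Polynomial.coe_mul, Polynomial.coe_pow, Polynomial.coe_C, Polynomial.coe_X, mul_assoc, ← PowerSeries.smul_eq_C_mul]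
    exact Submodule.smul_mem _ _ (Submodule.subset_span ⟨(l, i), rfl⟩)
  have hDS : X ^ (N - r) ∣ (D : k⟦X⟧) * S := by
    have h1 : (D : k⟦X⟧) * S = (Q : k⟦X⟧) * ∑ j : Fin r,
        ((A.submatrix id J).adjugate a0 j : k⟦X⟧) *
          ∑ i, (rowSeq T B P j i : k⟦X⟧) * v i := by
      have h2 : ∀ i, (D : k⟦X⟧) * (w i : k⟦X⟧) = Q * (∑ j : Fin r,
          ((A.submatrix id J).adjugate a0 j : k⟦X⟧) * (rowSeq T B P j i : k⟦X⟧)) := by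
        intro i
        have := congr_arg (Polynomial.coeToPowerSeries.ringHom (R := k)) (hw i)
        simpa only [Dv, mul_apply, map_mul, map_sum, Polynomial.coeToPowerSeries.ringHom_apply,
          hA, of_apply] using this
      rw [hS, Finset.mul_sum]
      simp_rw [← mul_assoc, h2, Finset.mul_sum, Finset.sum_mul]
      rw [Finset.sum_comm]
      simp_rw [mul_assoc]
    rw [h1]
    refine Dvd.dvd.mul_left (Finset.dvd_sum fun j _ => Dvd.dvd.mul_left ?_ _) _
    exact (pow_dvd_pow _ (by have := j.2; omega)).trans (X_pow_dvd_form hode hord j)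
  have h1 : X ^ (N - r - b) ∣ (D : k⟦X⟧) := X_pow_dvd_of_dvd_mul hDS fun h =>
    hb S hSW hS0 ((pow_dvd_pow _ (Nat.le_succ b)).trans h)
  rw [X_pow_dvd_coe] at h1
  have h2 := Polynomial.natDegree_le_of_dvd h1 hdet
  rw [Polynomial.natDegree_X_pow] at h2
  have h3 := natDegree_det_le (A.submatrix id J) (n + m * e) (by
    intro i j
    refine (natDegree_rowSeq_le heT heB hPn i (J j)).trans ?_
    have : (i : ℕ) * e ≤ m * e := Nat.mul_le_mul_right _ (by have := i.2; omega)
    omega)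
  rw [Fintype.card_fin, mul_add] at h3
  have h4 : r * (m * e) ≤ m * (m * e) := Nat.mul_le_mul_right _ hrm
  have h5 : D.natDegree = (A.submatrix id J).det.natDegree := rfl
  omega

end ZeroEstimate

lemma dvd_map_det_mul {R S n : Type*} [CommRing R] [CommRing S] [Fintype n] [DecidableEq n]
    (φ : R →+* S) (M : Matrix n n R) (w : n → S) {d : S}
    (h : ∀ j, d ∣ ∑ i, φ (M j i) * w i) (i : n) : d ∣ φ M.det * w i := by
  have h1 : (M.map φ).adjugate *ᵥ (M.map φ *ᵥ w) = φ M.det • w := by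
    rw [mulVec_mulVec, adjugate_mul, smul_mulVec, one_mulVec, RingHom.map_det]
    rfl
  have h2 := congr_fun h1 i
  rw [Pi.smul_apply, smul_eq_mul] at h2
  rw [← h2]
  exact Finset.dvd_sum fun j _ => Dvd.dvd.mul_left (h j) _

section ZeroEstimate
variable {k : Type*} [Field k] [CharZero k] {I : Type*} [Fintype I] [DecidableEq I]

/-- If the first `J` iterated rows at `α` annihilate `x ≠ 0`, then the determinant of the
first rows vanishes to high order at `α`. -/
lemma pow_dvd_det_of_annihilates {T : Polynomial k} {B : Matrix I I (Polynomial k)} {α : k}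
    (hT : T.eval α ≠ 0) {P : I → Polynomial k} {m J : ℕ} (e : Fin m ≃ I) {x : I → k} (hx : x ≠ 0)
    (h : ∀ j < J, ∑ i, (rowSeq T B P j i).eval α * x i = 0) :
    (Polynomial.X - Polynomial.C α) ^ (J - m) ∣
      (Matrix.of fun i' i => rowSeq T B P (e.symm i') i).det := by
  obtain ⟨Φ, Ψ, hΦ0, -, -, hflat⟩ := exists_flat_frame T B hT
  let y : I → k⟦X⟧ := fun l => ∑ i, Φ l i * C (x i)
  let H : ℕ → k⟦X⟧ := fun j => ∑ l, shift α (rowSeq T B P j l) * y l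
  have hH : ∀ j, H j = ∑ i, (∑ l, shift α (rowSeq T B P j l) * Φ l i) * C (x i) := by
    intro j
    simp only [H, y, Finset.mul_sum, Finset.sum_mul, mul_assoc]
    exact Finset.sum_comm
  have hy0 : ∀ l, constantCoeff (y l) = x l := by
    intro l
    simp only [y, map_sum, map_mul, constantCoeff_C]
    have : ∀ i, constantCoeff (Φ l i) = (1 : Matrix I I k) l i := fun i =>
      congr_fun (congr_fun hΦ0 l) i
    simp [this, Matrix.one_apply]
  have hH' : ∀ j, H (j + 1) = shift α T * derivative k (H j) := by
    intro j
    rw [hH, hH, map_sum, Finset.mul_sum]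
    refine Finset.sum_congr rfl fun i _ => ?_
    rw [hflat, Derivation.leibniz, derivative_C, smul_zero, zero_add, smul_eq_mul]
    ring
  have hH0 : ∀ j < J, constantCoeff (H j) = 0 := by
    intro j hj
    rw [← h j hj]
    simp only [H, map_sum, map_mul, constantCoeff_shift, hy0]
  have hdvd : ∀ t j, j + t ≤ J → X ^ t ∣ H j := by
    intro t
    induction t with
    | zero => intro j _; simp
    | succ t ih =>
      intro j hj
      refine X_pow_dvd_of_derivative ?_ (hH0 j (by omega))
      have h1 := ih (j + 1) (by omega)
      rw [hH', mul_comm] at h1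
      have h2 := X_pow_dvd_of_dvd_mul (b := 0) h1 (by
        rw [zero_add, pow_one, X_dvd_iff, constantCoeff_shift]; exact hT)
      simpa using h2
  obtain ⟨i0, hi0⟩ := Function.ne_iff.1 hx
  have h3 := dvd_map_det_mul (shift α) (Matrix.of fun i' i => rowSeq T B P (e.symm i') i) y
    (d := X ^ (J - m)) (fun j => by
      by_cases hm : J < m
      · rw [Nat.sub_eq_zero_of_le hm.le, pow_zero]; exact one_dvd _
      · have := (e.symm j).2
        exact (pow_dvd_pow _ (by omega)).trans (hdvd (J - (e.symm j : ℕ)) (e.symm j) (by omega))) i0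
  have h4 := X_pow_dvd_of_dvd_mul (b := 0) h3 (by
    rw [zero_add, pow_one, X_dvd_iff, hy0]; exact hi0)
  rwa [Nat.sub_zero, X_pow_dvd_shift] at h4

theorem zero_estimate {T : Polynomial k} {B : Matrix I I (Polynomial k)} {v : I → k⟦X⟧}
    {α : k} (hα : α ≠ 0) (hT : T.eval α ≠ 0)
    (hv : ∀ q : I → Polynomial k, ∑ i, (q i : k⟦X⟧) * v i = 0 → q = 0)
    (hode : ∀ i, (T : k⟦X⟧) * derivative k (v i) = ∑ l, (B i l : k⟦X⟧) * v l) :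
    ∃ c : ℕ, ∀ (n : ℕ) (P : I → Polynomial k) (N : ℕ), P ≠ 0 →
      (∀ i, (P i).natDegree ≤ n) → X ^ N ∣ ∑ i, (P i : k⟦X⟧) * v i →
      (Fintype.card I - 1) * n + c ≤ N → ∀ x : I → k,
      (∀ j, j + N ≤ Fintype.card I * n + c → ∑ i, (rowSeq T B P j i).eval α * x i = 0) →
      x = 0 := by
  classical
  rcases isEmpty_or_nonempty I with hI | ⟨⟨i0⟩⟩
  · exact ⟨0, fun n P N hP => absurd (Subsingleton.elim P 0) hP⟩
  set m := Fintype.card I with hm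
  obtain ⟨c', hc'⟩ := vanishing_le_of_stable hT hv hode
  have hv0 : v i0 ≠ 0 := by
    intro h0
    have h1 := hv (Pi.single i0 1) (by
      rw [Finset.sum_eq_single i0] <;> simp +contextual [h0])
    simpa using congr_fun h1 i0
  obtain ⟨c1, hc1⟩ := exists_order_bound (Submodule.span k {v i0})
  obtain ⟨e, heT, heB⟩ : ∃ e : ℕ, T.natDegree ≤ e ∧ ∀ i j, (B i j).natDegree ≤ e := by
    refine ⟨T.natDegree + ∑ i, ∑ j, (B i j).natDegree, by omega, fun i j => ?_⟩
    have h1 := (Finset.single_le_sum (f := fun j => (B i j).natDegree) (fun _ _ => Nat.zero_le _)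
      (Finset.mem_univ j)).trans (Finset.single_le_sum
        (f := fun i => ∑ l, (B i l).natDegree) (fun _ _ => Nat.zero_le _) (Finset.mem_univ i))
    exact le_add_left h1
  refine ⟨c' + 2 * m + c1 + m * (m * e) + 1, fun n P N hP hPn hord hN x hx => ?_⟩
  let Ind : ℕ → Prop := fun r => ∀ z : Fin r → Polynomial k,
    (∀ i, ∑ j : Fin r, z j * rowSeq T B P j i = 0) → z = 0
  by_cases hind : Ind m
  · by_contra hx0
    let ee : Fin m ≃ I := (Fintype.equivFin I).symm
    have hdet : (Matrix.of fun i' i => rowSeq T B P (ee.symm i') i).det ≠ 0 := by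
      intro h0
      obtain ⟨z, hz0, hz⟩ := Matrix.exists_vecMul_eq_zero_iff.2 h0
      refine hz0 ?_
      have h1 := hind (z ∘ ee) (fun i => by
        have h2 := congr_fun hz i
        simp only [vecMul, dotProduct, of_apply, Pi.zero_apply] at h2
        rw [← h2, ← ee.sum_comp]
        simp)
      ext1 i
      simpa using congr_fun h1 (ee.symm i)
    have h1 := pow_dvd_det_of_annihilates hT ee hx0
      (J := m * n + (c' + 2 * m + c1 + m * (m * e) + 1) + 1 - N) (fun j hj => hx j (by omega))
    have h2 := dvd_map_det_mul (Polynomial.coeToPowerSeries.ringHom (R := k))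
      (Matrix.of fun i' i => rowSeq T B P (ee.symm i') i) v (d := X ^ (N - m)) (fun j => by
        have := (ee.symm j).2
        exact (pow_dvd_pow _ (by omega)).trans (X_pow_dvd_form hode hord (ee.symm j : ℕ))) i0
    have h3 := X_pow_dvd_of_dvd_mul h2 (fun h => hc1 _ (Submodule.mem_span_singleton_self _) hv0
      ((pow_dvd_pow _ (Nat.le_succ c1)).trans h))
    rw [Polynomial.coeToPowerSeries.ringHom_apply, X_pow_dvd_coe] at h3
    have hcop : IsCoprime (Polynomial.X : Polynomial k) (Polynomial.X - Polynomial.C α) := by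
      have := Polynomial.isCoprime_X_sub_C_of_isUnit_sub (a := (0 : k)) (b := α)
        (by simpa using hα)
      simpa using this
    have h4 := Polynomial.natDegree_le_of_dvd ((hcop.pow).mul_dvd h3 h1) hdet
    rw [Polynomial.natDegree_mul (pow_ne_zero _ Polynomial.X_ne_zero)
      (pow_ne_zero _ (Polynomial.X_sub_C_ne_zero _)), Polynomial.natDegree_X_pow,
      Polynomial.natDegree_pow, Polynomial.natDegree_X_sub_C, mul_one] at h4
    have h5 := natDegree_det_le (Matrix.of fun i' i => rowSeq T B P (ee.symm i') i) (n + m * e) (by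
      intro i j
      refine (natDegree_rowSeq_le heT heB hPn (ee.symm i) j).trans ?_
      have : (ee.symm i : ℕ) * e ≤ m * e := Nat.mul_le_mul_right _ (ee.symm i).2.le
      omega)
    rw [mul_add, ← hm] at h5
    omega
  · exfalso
    have hex : ∃ r, ¬ Ind r := ⟨m, hind⟩
    obtain ⟨r, hr⟩ : ∃ r, Nat.find hex = r + 1 := Nat.exists_eq_succ_of_ne_zero (by
      intro h0
      have := Nat.find_spec hex
      rw [h0] at this
      exact this fun z _ => Subsingleton.elim _ _)
    have hspec := Nat.find_spec hex
    have hle : Nat.find hex ≤ m := Nat.find_min' hex hind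
    have hmin : Ind r := not_not.1 (Nat.find_min hex (by omega))
    rw [hr] at hspec hle
    simp only [Ind, not_forall] at hspec
    obtain ⟨z, hz, hz0⟩ := hspec
    simp only [Fin.sum_univ_castSucc, Fin.val_castSucc, Fin.val_last] at hz
    have hzl : z (Fin.last r) ≠ 0 := by
      intro h0
      have h1 := hmin (fun j => z j.castSucc) (fun i => by simpa [h0] using hz i)
      refine hz0 (funext fun j => ?_)
      refine Fin.lastCases h0 (fun j => congr_fun h1 j) j
    have hr1 : 1 ≤ r := by
      by_contra h
      obtain rfl : r = 0 := by omega
      refine hP (funext fun i => ?_)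
      have := hz i
      simp only [Finset.univ_eq_empty, Finset.sum_empty, zero_add] at this
      exact (mul_eq_zero.1 this).resolve_left hzl
    obtain ⟨J, hJ⟩ := exists_minor_ne_zero (Matrix.of fun (j : Fin r) i => rowSeq T B P j i)
      (fun z hz => hmin z fun i => congr_fun hz i)
    have h1 := hc' n P N r J (fun j => - z j.castSucc) (z (Fin.last r)) hr1 (by omega) hPn hord hJ
      hzl (fun i => by
        have := hz i
        simp only [neg_mul, Finset.sum_neg_distrib]
        linear_combination this)
    have h2 : r * n ≤ (m - 1) * n := Nat.mul_le_mul_right _ (by omega)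
    omega

end ZeroEstimate

end EFun

namespace EFun
open PowerSeries Matrix
open scoped Nat ENNReal NNReal

section EBound
variable {K : Type*} [Field K]

/-- The arithmetic conditions on the Taylor coefficients of an E-function over `K`. -/
def EBound (f : K⟦X⟧) : Prop :=
  (∃ C : ℝ, 1 ≤ C ∧ ∀ (σ : K →+* ℂ) (n : ℕ), ‖σ (n ! * coeff n f)‖ ≤ C ^ (n + 1)) ∧
  ∃ (D : ℕ) (d : ℕ → ℕ), ∀ n, d n ≠ 0 ∧ d n ≤ D ^ (n + 1) ∧
    ∀ m ≤ n, IsIntegral ℤ ((d n : K) * (m ! * coeff m f))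

lemma isIntegral_natCast {R : Type*} [CommRing R] (n : ℕ) : IsIntegral ℤ (n : R) := by
  simpa using (isIntegral_algebraMap (R := ℤ) (A := R) (x := (n : ℤ)))

lemma EBound.add {f g : K⟦X⟧} (hf : EBound f) (hg : EBound g) : EBound (f + g) := by
  obtain ⟨⟨C1, hC1, h1⟩, D1, d1, hd1⟩ := hf
  obtain ⟨⟨C2, hC2, h2⟩, D2, d2, hd2⟩ := hg
  refine ⟨⟨C1 + C2, by linarith, fun σ n => ?_⟩, D1 * D2, fun n => d1 n * d2 n, fun n =>
    ⟨mul_ne_zero (hd1 n).1 (hd2 n).1, ?_, fun m hm => ?_⟩⟩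
  · rw [map_add, mul_add, map_add]
    refine (norm_add_le _ _).trans ((add_le_add (h1 σ n) (h2 σ n)).trans ?_)
    exact pow_add_pow_le (by linarith) (by linarith) (Nat.succ_ne_zero n)
  · rw [mul_pow]; exact Nat.mul_le_mul (hd1 n).2.1 (hd2 n).2.1
  · have : ((d1 n * d2 n : ℕ) : K) * (m ! * coeff m (f + g)) =
        (d2 n : K) * ((d1 n : K) * (m ! * coeff m f)) +
          (d1 n : K) * ((d2 n : K) * (m ! * coeff m g)) := by
      rw [map_add]; push_cast; ring
    rw [this]
    exact ((isIntegral_natCast _).mul ((hd1 n).2.2 m hm)).add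
      ((isIntegral_natCast _).mul ((hd2 n).2.2 m hm))

lemma factorial_mul_coeff_mul [CharZero K] (f g : K⟦X⟧) (n : ℕ) :
    (n ! : K) * coeff n (f * g) = ∑ p ∈ Finset.HasAntidiagonal.antidiagonal n,
      (n.choose p.1 : K) * ((p.1 ! * coeff p.1 f) * (p.2 ! * coeff p.2 g)) := by
  rw [coeff_mul, Finset.mul_sum]
  refine Finset.sum_congr rfl fun p hp => ?_
  obtain rfl := Finset.HasAntidiagonal.mem_antidiagonal.1 hp
  have : ((p.1 + p.2) ! : K) = (p.1 + p.2).choose p.1 * p.1 ! * p.2 ! := by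
    rw [← Nat.add_choose_mul_factorial_mul_factorial, Nat.choose_symm_add]; push_cast; ring
  rw [this]; ring

lemma EBound.mul [CharZero K] {f g : K⟦X⟧} (hf : EBound f) (hg : EBound g) : EBound (f * g) := by
  obtain ⟨⟨C1, hC1, h1⟩, D1, d1, hd1⟩ := hf
  obtain ⟨⟨C2, hC2, h2⟩, D2, d2, hd2⟩ := hg
  refine ⟨⟨C1 * C2 + (C1 + C2), by nlinarith, fun σ n => ?_⟩, D1 * D2, fun n => d1 n * d2 n,
    fun n => ⟨mul_ne_zero (hd1 n).1 (hd2 n).1, ?_, fun m hm => ?_⟩⟩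
  · rw [factorial_mul_coeff_mul, map_sum]
    have h3 : ∀ p ∈ Finset.HasAntidiagonal.antidiagonal n,
        ‖σ ((n.choose p.1 : K) * ((p.1 ! * coeff p.1 f) * (p.2 ! * coeff p.2 g)))‖ ≤
        C1 * C2 * (n.choose p.1 • (C1 ^ p.1 * C2 ^ p.2)) := by
      intro p _
      rw [map_mul, map_mul, norm_mul, norm_mul, map_natCast, Complex.norm_natCast, nsmul_eq_mul]
      calc _ ≤ (n.choose p.1 : ℝ) * (C1 ^ (p.1 + 1) * C2 ^ (p.2 + 1)) := by
            gcongr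
            · exact h1 σ _
            · exact h2 σ _
        _ = _ := by ring
    refine (norm_sum_le _ _).trans ((Finset.sum_le_sum h3).trans ?_)
    rw [← Finset.mul_sum, ← (Commute.all C1 C2).add_pow', pow_succ']
    gcongr
    · linarith
    · nlinarith
    · linarith
  · rw [mul_pow]; exact Nat.mul_le_mul (hd1 n).2.1 (hd2 n).2.1
  · rw [factorial_mul_coeff_mul, Finset.mul_sum]
    refine IsIntegral.sum _ fun p hp => ?_
    have hp := Finset.HasAntidiagonal.mem_antidiagonal.1 hp
    have : ((d1 n * d2 n : ℕ) : K) * ((m.choose p.1 : K) *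
        ((p.1 ! * coeff p.1 f) * (p.2 ! * coeff p.2 g))) = (m.choose p.1 : K) *
        (((d1 n : K) * (p.1 ! * coeff p.1 f)) * ((d2 n : K) * (p.2 ! * coeff p.2 g))) := by
      push_cast; ring
    rw [this]
    exact (isIntegral_natCast _).mul (((hd1 n).2.2 _ (by omega)).mul ((hd2 n).2.2 _ (by omega)))

lemma EBound.derivative {f : K⟦X⟧} (hf : EBound f) : EBound (derivative K f) := by
  obtain ⟨⟨C1, hC1, h1⟩, D1, d1, hd1⟩ := hf
  have key : ∀ n : ℕ, (n ! : K) * coeff n (PowerSeries.derivative K f) =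
      (n + 1) ! * coeff (n + 1) f := by
    intro n; rw [coeff_derivative, Nat.factorial_succ]; push_cast; ring
  refine ⟨⟨C1 ^ 2, by nlinarith, fun σ n => ?_⟩, D1 ^ 2, fun n => d1 (n + 1), fun n =>
    ⟨(hd1 _).1, ?_, fun m hm => ?_⟩⟩
  · rw [key, ← pow_mul]
    exact (h1 σ (n + 1)).trans (pow_le_pow_right₀ hC1 (by omega))
  · rw [← pow_mul]
    refine (hd1 (n + 1)).2.1.trans (Nat.pow_le_pow_right ?_ (by omega))
    rcases Nat.eq_zero_or_pos D1 with h | h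
    · have h3 := hd1 0
      rw [h] at h3; simp at h3; omega
    · exact h
  · rw [key]; exact (hd1 (n + 1)).2.2 _ (by omega)

lemma eBound_X : EBound (X : K⟦X⟧) := by
  refine ⟨⟨1, le_rfl, fun σ n => ?_⟩, 1, fun _ => 1, fun n => ⟨one_ne_zero, by simp, fun m _ => ?_⟩⟩
  · rw [coeff_X]; split_ifs with h <;> simp [h]
  · rw [coeff_X]; split_ifs with h
    · simpa using isIntegral_natCast m !
    · simpa using isIntegral_zero

variable [NumberField K]

lemma exists_norm_embedding_le (c : K) : ∃ C : ℝ, 1 ≤ C ∧ ∀ σ : K →+* ℂ, ‖σ c‖ ≤ C :=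
  ⟨max 1 (NumberField.house c), le_max_left _ _, fun σ =>
    (NumberField.norm_embedding_le_house c σ).trans (le_max_right _ _)⟩

lemma exists_natCast_mul_isIntegral (c : K) : ∃ y : ℕ, y ≠ 0 ∧ IsIntegral ℤ ((y : K) * c) := by
  obtain ⟨y, hy, h⟩ := ((IsFractionRing.isAlgebraic_iff ℤ ℚ K).2
    (Algebra.IsAlgebraic.isAlgebraic (R := ℚ) c)).exists_integral_multiple
  refine ⟨y.natAbs, by simpa using hy, ?_⟩
  rw [Algebra.smul_def, eq_intCast] at h
  rcases Int.natAbs_eq y with h1 | h1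
  · rw [h1] at h; simpa using h
  · rw [h1] at h; simpa using h.neg

lemma eBound_C (c : K) : EBound (C c : K⟦X⟧) := by
  obtain ⟨C1, hC1, h1⟩ := exists_norm_embedding_le c
  obtain ⟨y, hy, h2⟩ := exists_natCast_mul_isIntegral c
  refine ⟨⟨C1, hC1, fun σ n => ?_⟩, y, fun _ => y, fun n => ⟨hy, ?_, fun m _ => ?_⟩⟩
  · rw [coeff_C]; split_ifs with h
    · simp only [h, Nat.factorial_zero, Nat.cast_one, one_mul, zero_add, pow_one]; exact h1 σ
    · simp only [mul_zero, map_zero, norm_zero]; positivity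
  · exact Nat.le_self_pow (Nat.succ_ne_zero _) _
  · rw [coeff_C]; split_ifs with h
    · simpa [h] using h2
    · simpa using isIntegral_zero

variable (K) in
/-- The algebra of power series satisfying the E-function conditions. -/
def eAlg : Subalgebra K K⟦X⟧ where
  carrier := {f | EBound f}
  mul_mem' := EBound.mul
  add_mem' := EBound.add
  algebraMap_mem' := eBound_C

lemma coe_polynomial_mem_eAlg (p : Polynomial K) : (p : K⟦X⟧) ∈ eAlg K := by
  induction p using Polynomial.induction_on' with
  | add p q hp hq => rw [Polynomial.coe_add]; exact add_mem hp hq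
  | monomial n c =>
    rw [← Polynomial.C_mul_X_pow_eq_monomial, Polynomial.coe_mul, Polynomial.coe_pow,
      Polynomial.coe_C, Polynomial.coe_X]
    exact mul_mem (eBound_C c) (pow_mem (eBound_X : EBound (X : K⟦X⟧)) n)

end EBound

section WeightedNorm
variable {K : Type*} [Field K]

/-- The weighted `ℓ¹` norm of the image of a power series under an embedding. -/
def wn (σ : K →+* ℂ) (r : ℝ≥0) (f : K⟦X⟧) : ℝ≥0∞ := ∑' n, ‖σ (coeff n f)‖ₑ * (r : ℝ≥0∞) ^ n

variable (σ : K →+* ℂ)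

lemma wn_zero (r : ℝ≥0) : wn σ r 0 = 0 := by simp [wn]

lemma wn_add_le (r : ℝ≥0) (f g : K⟦X⟧) : wn σ r (f + g) ≤ wn σ r f + wn σ r g := by
  rw [wn, wn, wn, ← ENNReal.tsum_add]
  refine ENNReal.tsum_le_tsum fun n => ?_
  rw [← add_mul, map_add, map_add]
  gcongr
  exact enorm_add_le _ _

lemma wn_sum_le {ι : Type*} (s : Finset ι) (r : ℝ≥0) (f : ι → K⟦X⟧) :
    wn σ r (∑ i ∈ s, f i) ≤ ∑ i ∈ s, wn σ r (f i) := by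
  classical
  induction s using Finset.induction_on with
  | empty => simp [wn_zero]
  | insert a s ha ih =>
    rw [Finset.sum_insert ha, Finset.sum_insert ha]
    exact (wn_add_le _ _ _ _).trans (add_le_add le_rfl ih)

lemma wn_mul_le (r : ℝ≥0) (f g : K⟦X⟧) : wn σ r (f * g) ≤ wn σ r f * wn σ r g := by
  let F : ℕ × ℕ → ℝ≥0∞ := fun p =>
    (‖σ (coeff p.1 f)‖ₑ * (r : ℝ≥0∞) ^ p.1) * (‖σ (coeff p.2 g)‖ₑ * (r : ℝ≥0∞) ^ p.2)
  have h1 : wn σ r f * wn σ r g = ∑' p : ℕ × ℕ, F p := by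
    rw [ENNReal.tsum_prod', wn, wn, ← ENNReal.tsum_mul_right]
    simp_rw [← ENNReal.tsum_mul_left]
    rfl
  have h2 : ∑' p : ℕ × ℕ, F p = ∑' n, ∑ p ∈ Finset.HasAntidiagonal.antidiagonal n, F p := by
    rw [← (Finset.HasAntidiagonal.sigmaAntidiagonalEquivProd (A := ℕ)).tsum_eq, ENNReal.tsum_sigma']
    refine tsum_congr fun n => ?_
    rw [tsum_fintype]
    exact Finset.sum_coe_sort _ F
  rw [h1, h2, wn]
  refine ENNReal.tsum_le_tsum fun n => ?_
  rw [coeff_mul, map_sum]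
  calc _ ≤ (∑ p ∈ Finset.HasAntidiagonal.antidiagonal n, ‖σ (coeff p.1 f * coeff p.2 g)‖ₑ) *
        (r : ℝ≥0∞) ^ n := by gcongr; exact enorm_sum_le _ _
    _ = _ := by
      rw [Finset.sum_mul]
      refine Finset.sum_congr rfl fun p hp => ?_
      rw [map_mul, enorm_mul, ← Finset.HasAntidiagonal.mem_antidiagonal.1 hp, pow_add]
      ring

lemma wn_mono {r r' : ℝ≥0} (h : r ≤ r') (f : K⟦X⟧) : wn σ r f ≤ wn σ r' f :=
  ENNReal.tsum_le_tsum fun n => by gcongr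

lemma wn_derivative_le (r : ℝ≥0) {t : ℕ} (ht : t ≠ 0) (f : K⟦X⟧) :
    wn σ r (derivative K f) ≤ t * wn σ (r + (t : ℝ≥0)⁻¹) f := by
  have ht' : (t : ℝ≥0) ≠ 0 := by exact_mod_cast ht
  have hb : ∀ n : ℕ, ((n + 1 : ℕ) : ℝ≥0) * r ^ n ≤ t * (r + (t : ℝ≥0)⁻¹) ^ (n + 1) := by
    intro n
    have h1 : r ^ n * (t : ℝ≥0)⁻¹ * (n + 1 : ℕ) ≤ (r + (t : ℝ≥0)⁻¹) ^ (n + 1) := by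
      rw [add_pow]
      have := Finset.single_le_sum (f := fun m => r ^ m * (t : ℝ≥0)⁻¹ ^ (n + 1 - m) *
        ((n + 1).choose m : ℝ≥0)) (fun _ _ => zero_le) (Finset.mem_range.2
          (show n < n + 1 + 1 by omega))
      simpa using this
    calc _ = t * (r ^ n * (t : ℝ≥0)⁻¹ * (n + 1 : ℕ)) := by field_simp
      _ ≤ _ := by gcongr
  rw [wn, wn, ← ENNReal.tsum_mul_left]
  refine le_trans (ENNReal.tsum_le_tsum fun n => ?_)
    (ENNReal.tsum_comp_le_tsum_of_injective (Nat.succ_injective) _)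
  have hb' : (((n + 1 : ℕ) : ℝ≥0∞)) * (r : ℝ≥0∞) ^ n ≤
      t * (((r + (t : ℝ≥0)⁻¹ : ℝ≥0)) : ℝ≥0∞) ^ (n + 1) := by exact_mod_cast hb n
  have hn : ‖(n : ℂ) + 1‖ₑ = ((n + 1 : ℕ) : ℝ≥0∞) := by
    rw [← Nat.cast_succ, enorm_eq_nnnorm, Complex.nnnorm_natCast]; simp
  rw [coeff_derivative, map_mul, enorm_mul, map_add, map_natCast, map_one, hn, mul_assoc]
  calc _ ≤ ‖σ (coeff (n + 1) f)‖ₑ * (t * (((r + (t : ℝ≥0)⁻¹ : ℝ≥0)) : ℝ≥0∞) ^ (n + 1)) := by gcongr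
    _ = _ := by simp only [Nat.succ_eq_add_one]; ring

lemma wn_coe_lt_top (r : ℝ≥0) (p : Polynomial K) : wn σ r (p : K⟦X⟧) < ⊤ := by
  rw [wn, tsum_eq_sum (s := p.support)]
  · exact ENNReal.sum_lt_top.2 fun i _ => ENNReal.mul_lt_top enorm_lt_top (by finiteness)
  · intro b hb
    simp [Polynomial.coeff_coe, Polynomial.notMem_support_iff.1 hb]

lemma enorm_eval_le {r : ℝ≥0} {α : K} (hr : ‖σ α‖₊ ≤ r) (p : Polynomial K) :
    ‖σ (p.eval α)‖ₑ ≤ wn σ r (p : K⟦X⟧) := by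
  rw [Polynomial.eval_eq_sum, Polynomial.sum_def, map_sum]
  refine (enorm_sum_le _ _).trans (le_trans (Finset.sum_le_sum fun i _ => ?_)
    (ENNReal.sum_le_tsum p.support))
  rw [map_mul, map_pow, enorm_mul, enorm_pow, Polynomial.coeff_coe]
  gcongr
  exact_mod_cast hr

lemma enorm_le_wn {z s : ℂ} {f : K⟦X⟧} (h : HasSum (fun n => σ (coeff n f) * z ^ n) s) :
    ‖s‖ₑ ≤ wn σ ‖z‖₊ f := by
  rw [← h.tsum_eq]
  refine (enorm_tsum_le_tsum_enorm).trans (le_of_eq (tsum_congr fun n => ?_))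
  rw [enorm_mul, enorm_pow]
  rfl

lemma wn_iterate_le {I : Type*} [Fintype I] {T : K⟦X⟧} {B : I → I → K⟦X⟧} {G : ℕ → I → K⟦X⟧}
    (hG : ∀ j i, G (j + 1) i = T * derivative K (G j i) + ∑ l, G j l * B l i)
    {r1 : ℝ≥0} {L M : ℝ≥0∞} (hL : ∀ i, wn σ r1 T + ∑ l, wn σ r1 (B l i) ≤ L)
    (hM : ∀ i, wn σ r1 (G 0 i) ≤ M) {t : ℕ} (ht : t ≠ 0) (j : ℕ) :
    ∀ r : ℝ≥0, r + j * (t : ℝ≥0)⁻¹ ≤ r1 → ∀ i, wn σ r (G j i) ≤ (L * t) ^ j * M := by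
  induction j with
  | zero =>
    intro r hr i
    rw [pow_zero, one_mul]
    exact (wn_mono σ (by simpa using hr) _).trans (hM i)
  | succ j ih =>
    intro r hr i
    have h1 : r + (t : ℝ≥0)⁻¹ + j * (t : ℝ≥0)⁻¹ ≤ r1 := by
      refine le_of_eq_of_le ?_ hr; push_cast; ring
    have h2 : r ≤ r + (t : ℝ≥0)⁻¹ := le_self_add
    have h3 : r ≤ r1 := le_trans le_self_add hr
    have ih' := ih _ h1
    have ht1 : (1 : ℝ≥0∞) ≤ t := by exact_mod_cast Nat.one_le_iff_ne_zero.2 ht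
    rw [hG]
    calc _ ≤ wn σ r T * wn σ r (derivative K (G j i)) + ∑ l, wn σ r (G j l) * wn σ r (B l i) :=
          (wn_add_le _ _ _ _).trans (add_le_add (wn_mul_le _ _ _ _)
            ((wn_sum_le _ _ _ _).trans (Finset.sum_le_sum fun l _ => wn_mul_le _ _ _ _)))
      _ ≤ wn σ r1 T * (t * ((L * t) ^ j * M)) +
          ∑ l, (t * ((L * t) ^ j * M)) * wn σ r1 (B l i) := by
        gcongr with l _
        · exact wn_mono σ h3 _
        · exact (wn_derivative_le σ r ht _).trans (mul_le_mul_right (ih' i) _)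
        · refine (wn_mono σ h2 _).trans ((ih' l).trans ?_)
          exact le_mul_of_one_le_left (zero_le) ht1
        · exact wn_mono σ h3 _
      _ = (wn σ r1 T + ∑ l, wn σ r1 (B l i)) * (t * ((L * t) ^ j * M)) := by
        rw [← Finset.mul_sum, add_mul]; ring
      _ ≤ L * (t * ((L * t) ^ j * M)) := by gcongr; exact hL i
      _ = _ := by ring

lemma hasSum_coe_mul {α : K} {f : K⟦X⟧} {s : ℂ}
    (h : HasSum (fun n => σ (coeff n f) * (σ α) ^ n) s) (p : Polynomial K) :
    HasSum (fun n => σ (coeff n ((p : K⟦X⟧) * f)) * (σ α) ^ n) (σ (p.eval α) * s) := by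
  have hX : ∀ n : ℕ, HasSum (fun l => σ (coeff l (X ^ n * f)) * (σ α) ^ l) (σ α ^ n * s) := by
    intro n
    rw [← hasSum_nat_add_iff' n]
    have h0 : ∑ i ∈ Finset.range n, σ (coeff i (X ^ n * f)) * (σ α) ^ i = 0 :=
      Finset.sum_eq_zero fun i hi => by
        rw [coeff_X_pow_mul', if_neg (by simpa using hi), map_zero, zero_mul]
    rw [h0, sub_zero]
    refine (h.mul_left (σ α ^ n)).congr_fun fun l => ?_
    rw [coeff_X_pow_mul', if_pos (by omega), Nat.add_sub_cancel, pow_add]; ring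
  induction p using Polynomial.induction_on' with
  | add p q hp hq =>
    rw [Polynomial.eval_add, map_add, add_mul]
    refine (hp.add hq).congr_fun fun n => ?_
    rw [Polynomial.coe_add, add_mul, map_add, map_add]; ring
  | monomial n c =>
    rw [Polynomial.eval_monomial, map_mul, map_pow, mul_assoc]
    refine ((hX n).mul_left (σ c)).congr_fun fun l => ?_
    rw [← Polynomial.C_mul_X_pow_eq_monomial, Polynomial.coe_mul, Polynomial.coe_pow,
      Polynomial.coe_C, Polynomial.coe_X, mul_assoc, coeff_C_mul, map_mul]; ring

end WeightedNorm

section Siegel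
universe u
variable {K : Type*} [Field K]

lemma EBound.family {I : Type*} [Fintype I] {v : I → K⟦X⟧} (hv : ∀ i, EBound (v i)) :
    (∃ C : ℝ, 1 ≤ C ∧ ∀ (σ : K →+* ℂ) (i : I) (n : ℕ), ‖σ (n ! * coeff n (v i))‖ ≤ C ^ (n + 1)) ∧
    ∃ (D : ℕ) (d : ℕ → ℕ), ∀ n, d n ≠ 0 ∧ d n ≤ D ^ (n + 1) ∧
      ∀ i, ∀ m ≤ n, IsIntegral ℤ ((d n : K) * (m ! * coeff m (v i))) := by
  classical
  choose C hC h1 using fun i => (hv i).1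
  choose D d hd using fun i => (hv i).2
  refine ⟨⟨∏ i, C i, Finset.one_le_prod fun i _ => hC i, fun σ i n => (h1 i σ n).trans ?_⟩,
    ∏ i, D i, fun n => ∏ i, d i n, fun n => ⟨Finset.prod_ne_zero_iff.2 fun i _ => (hd i n).1, ?_,
      fun i m hm => ?_⟩⟩
  · refine pow_le_pow_left₀ (zero_le_one.trans (hC i)) ?_ _
    rw [← Finset.mul_prod_erase _ _ (Finset.mem_univ i)]
    exact le_mul_of_one_le_right (zero_le_one.trans (hC i)) (Finset.one_le_prod fun i _ => hC i)
  · dsimp only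
    rw [← Finset.prod_pow]
    exact Finset.prod_le_prod' fun i _ => (hd i n).2.1
  · dsimp only
    rw [← Finset.mul_prod_erase _ _ (Finset.mem_univ i), Nat.cast_mul, mul_right_comm]
    exact ((hd i n).2.2 m hm).mul (isIntegral_natCast _)

variable [NumberField K]

lemma house_le_iff {x : K} {M : ℝ} :
    NumberField.house x ≤ M ↔ ∀ σ : K →+* ℂ, ‖σ x‖ ≤ M := by
  refine ⟨fun h σ => (NumberField.norm_embedding_le_house x σ).trans h, fun h => ?_⟩
  have h0 : 0 ≤ M := (norm_nonneg _).trans (h (Classical.arbitrary _))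
  rw [NumberField.house]
  exact (pi_norm_le_iff_of_nonneg h0).2 fun σ => h σ

variable (K) in
lemma exists_siegel_bound : ∃ c : ℝ, 1 ≤ c ∧ ∀ {β : Type u} [Fintype β] (p : ℕ)
    (a : Matrix (Fin p) β (NumberField.RingOfIntegers K)) (A : ℝ), 1 ≤ A →
    (∀ (σ : K →+* ℂ) k l, ‖σ (a k l : K)‖ ≤ A) → p < Fintype.card β → ∀ s : ℕ,
    p ≤ s * (Fintype.card β - p) → ∃ ξ : β → NumberField.RingOfIntegers K, ξ ≠ 0 ∧ a *ᵥ ξ = 0 ∧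
      ∀ (σ : K →+* ℂ) l, ‖σ (ξ l : K)‖ ≤ c * (c * Fintype.card β * A) ^ s := by
  classical
  have key : ∃ c0 : ℝ, ∀ {β : Type u} [Fintype β] (p : ℕ)
      (a : Matrix (Fin p) β (NumberField.RingOfIntegers K)) (A : ℝ), a ≠ 0 → 0 < p →
      p < Fintype.card β →
      (∀ k l, NumberField.house (a k l : K) ≤ A) →
      ∃ ξ : β → NumberField.RingOfIntegers K, ξ ≠ 0 ∧ a *ᵥ ξ = 0 ∧
      ∀ l, NumberField.house (ξ l : K) ≤
        c0 * ((c0 * Fintype.card β * A) ^ ((p : ℝ) / (Fintype.card β - p))) :=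
    ⟨_, fun p a A ha h0 hp hA => NumberField.house.exists_ne_zero_int_vec_house_le K a ha h0 hp
      rfl hA (Fintype.card_fin p)⟩
  obtain ⟨c0, hc0⟩ := key
  refine ⟨max 1 |c0|, le_max_left _ _, fun {β} _ p a A hA1 hA hp s hs => ?_⟩
  set c := max 1 |c0|
  have hc1 : 1 ≤ c := le_max_left _ _
  have hβ : (1 : ℝ) ≤ Fintype.card β := by exact_mod_cast (by omega : 1 ≤ Fintype.card β)
  have hbase : 1 ≤ c * Fintype.card β * A :=
    one_le_mul_of_one_le_of_one_le (one_le_mul_of_one_le_of_one_le hc1 hβ) hA1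
  by_cases ha : a = 0
  · have : Nonempty β := Fintype.card_pos_iff.1 (by omega)
    refine ⟨1, one_ne_zero, by rw [ha, zero_mulVec], fun σ l => ?_⟩
    have : ‖σ ((1 : β → NumberField.RingOfIntegers K) l : K)‖ = 1 := by simp
    rw [this]
    exact one_le_mul_of_one_le_of_one_le hc1 (one_le_pow₀ hbase)
  · have hp0 : 0 < p := by
      by_contra h
      obtain rfl : p = 0 := by omega
      exact ha (Subsingleton.elim _ _)
    obtain ⟨ξ, h1, h2, h3⟩ := hc0 p a A ha hp0 hp (fun k l => house_le_iff.2 fun σ => hA σ k l)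
    refine ⟨ξ, h1, h2, fun σ l => (NumberField.norm_embedding_le_house _ σ).trans
      ((h3 l).trans ?_)⟩
    have hqp : (0 : ℝ) < (Fintype.card β : ℝ) - p := by
      rw [sub_pos]; exact_mod_cast hp
    have hexp : (p : ℝ) / (Fintype.card β - p) ≤ s := by
      rw [div_le_iff₀ hqp]
      have : ((p : ℕ) : ℝ) ≤ ((s * (Fintype.card β - p) : ℕ) : ℝ) := by exact_mod_cast hs
      rwa [Nat.cast_mul, Nat.cast_sub hp.le] at this
    calc _ ≤ |c0| * |c0 * Fintype.card β * A| ^ ((p : ℝ) / (Fintype.card β - p)) := by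
          refine (le_abs_self _).trans ?_
          rw [abs_mul]
          gcongr
          exact Real.abs_rpow_le_abs_rpow _ _
      _ ≤ c * (c * Fintype.card β * A) ^ ((p : ℝ) / (Fintype.card β - p)) := by
          gcongr
          · exact le_max_right _ _
          · rw [abs_mul, abs_mul, abs_of_nonneg (by linarith : 0 ≤ A), Nat.abs_cast]
            gcongr
            exact le_max_right _ _
      _ ≤ c * (c * Fintype.card β * A) ^ (s : ℝ) := by
          gcongr
      _ = _ := by rw [Real.rpow_natCast]

/-- Padé approximation data of type I for a family of E-functions. -/
lemma exists_pade {I : Type u} [Fintype I] [Nonempty I] {v : I → K⟦X⟧} (hv : ∀ i, EBound (v i))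
    {q : ℕ} (hq : 1 ≤ q) : ∃ A : ℝ, 1 ≤ A ∧ ∀ t : ℕ, 1 ≤ t → ∃ p : I → ℕ → K,
      (∃ i, ∃ k ≤ q * t, p i k ≠ 0) ∧ (∀ i k, IsIntegral ℤ (p i k)) ∧
      (∀ (σ : K →+* ℂ) i k, ‖σ (p i k)‖ ≤ A ^ t) ∧
      ∀ l < Fintype.card I * (q * t) - t, ∑ i, ∑ k ∈ Finset.range (q * t + 1),
        (l.choose k : K) * (p i k * ((l - k) ! * coeff (l - k) (v i))) = 0 := by
  classical
  obtain ⟨⟨C, hC, h1⟩, D, d, hd⟩ := EBound.family hv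
  obtain ⟨c, hc, hS⟩ := exists_siegel_bound.{u} K
  set m := Fintype.card I with hm
  have hm1 : 1 ≤ m := Fintype.card_pos
  have hD : 1 ≤ D := by
    rcases Nat.eq_zero_or_pos D with h | h
    · have h3 := hd 0
      rw [h] at h3; simp at h3; omega
    · exact h
  have hD' : (1 : ℝ) ≤ D := by exact_mod_cast hD
  have hbase : (1 : ℝ) ≤ 2 * D * C := by nlinarith
  set A0 : ℝ := (2 * D * C) ^ (m * q + 1) with hA0
  have hA01 : 1 ≤ A0 := one_le_pow₀ hbase
  have hmq : 1 ≤ m * q := Nat.one_le_iff_ne_zero.2 (by positivity)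
  have hmqR : (1 : ℝ) ≤ ((2 * (m * q) : ℕ) : ℝ) := by exact_mod_cast (by omega)
  refine ⟨c * (c * (2 * (m * q) : ℕ) * (2 * A0)) ^ (m * q), ?_, fun t ht => ?_⟩
  · refine one_le_mul_of_one_le_of_one_le hc (one_le_pow₀ ?_)
    exact one_le_mul_of_one_le_of_one_le (one_le_mul_of_one_le_of_one_le hc hmqR) (by linarith)
  set N := m * (q * t) - t with hN
  have hmqt : t ≤ m * (q * t) := by rw [← mul_assoc]; exact Nat.le_mul_of_pos_left _ hmq
  have hNt : N + 1 ≤ (m * q + 1) * t := by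
    have : (m * q + 1) * t = m * (q * t) + t := by ring
    omega
  have hint : ∀ (l : Fin N) (x : I × Fin (q * t + 1)), IsIntegral ℤ (((l : ℕ).choose x.2 : K) *
      ((d N : K) * (((l : ℕ) - x.2) ! * coeff ((l : ℕ) - x.2) (v x.1)))) := fun l x =>
    (isIntegral_natCast _).mul ((hd N).2.2 _ _ (by have := l.2; omega))
  let a : Matrix (Fin N) (I × Fin (q * t + 1)) (NumberField.RingOfIntegers K) :=
    Matrix.of fun l x => ⟨_, hint l x⟩
  have hcard : Fintype.card (I × Fin (q * t + 1)) = N + (m + t) := by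
    rw [Fintype.card_prod, Fintype.card_fin, ← hm, mul_add]; omega
  obtain ⟨ξ, hξ0, hξ, hξb⟩ := hS N a (A0 ^ t) (one_le_pow₀ hA01) (by
    intro σ l x
    change ‖σ (((l : ℕ).choose x.2 : K) *
      ((d N : K) * (((l : ℕ) - x.2) ! * coeff ((l : ℕ) - x.2) (v x.1))))‖ ≤ _
    rw [map_mul, map_mul, norm_mul, norm_mul, map_natCast, map_natCast, Complex.norm_natCast,
      Complex.norm_natCast]
    have e1 : ((l : ℕ).choose x.2 : ℝ) ≤ 2 ^ (N + 1) := by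
      have h2 : (l : ℕ).choose x.2 ≤ 2 ^ (N + 1) :=
        (Nat.choose_le_two_pow _ _).trans (Nat.pow_le_pow_right (by omega) (by have := l.2; omega))
      exact_mod_cast h2
    have e2 : (d N : ℝ) ≤ D ^ (N + 1) := by exact_mod_cast (hd N).2.1
    have e3 := (h1 σ x.1 ((l : ℕ) - x.2)).trans
      (pow_le_pow_right₀ hC (show (l : ℕ) - x.2 + 1 ≤ N + 1 by have := l.2; omega))
    calc _ ≤ (2 : ℝ) ^ (N + 1) * (D ^ (N + 1) * C ^ (N + 1)) := by gcongr
      _ = (2 * D * C) ^ (N + 1) := by rw [mul_pow, mul_pow, mul_assoc]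
      _ ≤ (2 * D * C) ^ ((m * q + 1) * t) := pow_le_pow_right₀ hbase hNt
      _ = _ := by rw [hA0, ← pow_mul]) (by omega) (m * q) (by
    rw [hcard, Nat.add_sub_cancel_left]
    have : m * q * (m + t) = m * q * m + m * (q * t) := by ring
    omega)
  refine ⟨fun i k => if h : k < q * t + 1 then (ξ (i, ⟨k, h⟩) : K) else 0, ?_, ?_, ?_, ?_⟩
  · obtain ⟨⟨i, k⟩, hx⟩ := Function.ne_iff.1 hξ0
    refine ⟨i, k, by have := k.2; omega, ?_⟩
    dsimp only
    rw [dif_pos k.2]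
    simpa using hx
  · intro i k
    dsimp only
    split_ifs
    · exact NumberField.RingOfIntegers.isIntegral_coe _
    · exact isIntegral_zero
  · intro σ i k
    have hfin : c * (c * (Fintype.card (I × Fin (q * t + 1)) : ℕ) * A0 ^ t) ^ (m * q) ≤
        (c * (c * (2 * (m * q) : ℕ) * (2 * A0)) ^ (m * q)) ^ t := by
      have ht0 : t ≠ 0 := by omega
      have e1 : ((Fintype.card (I × Fin (q * t + 1)) : ℕ) : ℝ) ≤ (2 * (m * q) : ℕ) ^ t * 2 ^ t := by
        have e2 : Fintype.card (I × Fin (q * t + 1)) ≤ (2 * (m * q)) * t := by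
          rw [Fintype.card_prod, Fintype.card_fin, ← hm]
          have : m * 1 ≤ m * (q * t) := Nat.mul_le_mul_left _ (Nat.mul_pos hq ht)
          calc m * (q * t + 1) = m * (q * t) + m * 1 := by ring
            _ ≤ m * (q * t) + m * (q * t) := by omega
            _ = _ := by ring
        have e3 : (2 * (m * q)) * t ≤ (2 * (m * q)) ^ t * 2 ^ t :=
          Nat.mul_le_mul (Nat.le_self_pow ht0 _) (Nat.lt_two_pow_self).le
        exact_mod_cast e2.trans e3
      have e4 : c ≤ c ^ t := le_self_pow₀ hc ht0
      calc _ ≤ c ^ t * (c ^ t * ((2 * (m * q) : ℕ) ^ t * 2 ^ t) * A0 ^ t) ^ (m * q) := by gcongr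
        _ = _ := by rw [mul_pow c, ← pow_mul _ (m * q), mul_comm (m * q) t, pow_mul _ t]; congr 2
                    simp only [mul_pow]; ring
    refine le_trans ?_ hfin
    dsimp only
    split_ifs with h
    · exact hξb σ _
    · rw [map_zero, norm_zero]; positivity
  · intro l hl
    have h2 := congr_arg (algebraMap (NumberField.RingOfIntegers K) K) (congr_fun hξ ⟨l, hl⟩)
    simp only [mulVec, dotProduct, map_sum, map_mul, Pi.zero_apply, map_zero,
      Fintype.sum_prod_type] at h2
    have h3 : (d N : K) ≠ 0 := by exact_mod_cast (hd N).1
    refine (mul_eq_zero.1 (Eq.trans ?_ h2)).resolve_left h3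
    rw [Finset.mul_sum]
    refine Finset.sum_congr rfl fun i _ => ?_
    rw [Finset.mul_sum, Finset.sum_range]
    refine Finset.sum_congr rfl fun k _ => ?_
    dsimp only
    rw [dif_pos k.2]
    change _ = ((l.choose k : K) * ((d N : K) * ((l - k) ! * coeff (l - k) (v i)))) * (ξ (i, k) : K)
    ring

end Siegel

section Forms
universe u
variable {K : Type*} [Field K]

lemma factorial_qt_le (q t : ℕ) : ((q * t)! : ℝ) ≤ ((q : ℝ) ^ q) ^ t * ((t : ℝ) ^ t) ^ q := by
  have : (q * t)! ≤ (q * t) ^ (q * t) := Nat.factorial_le_pow _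
  calc ((q * t)! : ℝ) ≤ ((q * t : ℕ) : ℝ) ^ (q * t) := by exact_mod_cast this
    _ = _ := by rw [Nat.cast_mul, mul_pow, ← pow_mul, ← pow_mul, mul_comm t q]

/-- The polynomial with coefficients `n! / k! * p k`. -/
def padePoly (n : ℕ) (p : ℕ → K) : Polynomial K :=
  ∑ k ∈ Finset.range (n + 1), Polynomial.C ((n.descFactorial (n - k) : K) * p k) * Polynomial.X ^ k


lemma coeff_padePoly (n : ℕ) (p : ℕ → K) (k : ℕ) : (padePoly n p).coeff k =
    if k ≤ n then (n.descFactorial (n - k) : K) * p k else 0 := by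
  simp only [padePoly, Polynomial.finsetSum_coeff, Polynomial.coeff_C_mul_X_pow,
    Finset.sum_ite_eq, Finset.mem_range, Nat.lt_succ_iff]

lemma coeff_padePoly_mul (n : ℕ) (p : ℕ → K) (f : K⟦X⟧) (l : ℕ) :
    (l ! : K) * coeff l ((padePoly n p : K⟦X⟧) * f) = n ! * ∑ k ∈ Finset.range (n + 1),
      (l.choose k : K) * (p k * ((l - k)! * coeff (l - k) f)) := by
  rw [padePoly, ← Polynomial.coeToPowerSeries.ringHom_apply, map_sum, Finset.sum_mul, map_sum,
    Finset.mul_sum, Finset.mul_sum]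
  refine Finset.sum_congr rfl fun k hk => ?_
  have hk' : k ≤ n := Nat.lt_succ_iff.1 (Finset.mem_range.1 hk)
  rw [Polynomial.coeToPowerSeries.ringHom_apply, Polynomial.coe_mul, Polynomial.coe_pow,
    Polynomial.coe_C, Polynomial.coe_X, mul_assoc, coeff_C_mul, coeff_X_pow_mul']
  split_ifs with h
  · have e1 : (n ! : K) = k ! * n.descFactorial (n - k) := by
      have := Nat.factorial_mul_descFactorial (Nat.sub_le n k)
      rw [Nat.sub_sub_self hk'] at this
      rw [← Nat.cast_mul, this]
    have e2 : (l ! : K) = l.choose k * k ! * (l - k)! := by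
      rw [← Nat.cast_mul, ← Nat.cast_mul, Nat.choose_mul_factorial_mul_factorial h]
    rw [e1, e2]; ring
  · rw [Nat.choose_eq_zero_of_lt (not_le.1 h)]; simp

lemma wn_padePoly_le {t q : ℕ} {A : ℝ} (hA : 1 ≤ A) {p : ℕ → K} (σ : K →+* ℂ) {r : ℝ≥0} (hr : 1 ≤ r)
    (hp : ∀ k, ‖σ (p k)‖ ≤ A ^ t) : wn σ r (padePoly (q * t) p : K⟦X⟧) ≤
      ENNReal.ofReal ((A * (2 * r * q) ^ q) ^ t * ((t : ℝ) ^ t) ^ q) := by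
  set n := q * t with hn
  have h1 : ∀ k ∈ Finset.range (n + 1),
      ‖σ (coeff k (padePoly n p : K⟦X⟧))‖ₑ * r ^ k ≤ ENNReal.ofReal (n ! * A ^ t * r ^ n) := by
    intro k hk
    have hk' : k ≤ n := Nat.lt_succ_iff.1 (Finset.mem_range.1 hk)
    rw [Polynomial.coeff_coe, coeff_padePoly, if_pos hk', ← ofReal_norm,
      ← ENNReal.ofReal_coe_nnreal, ← ENNReal.ofReal_pow r.coe_nonneg, ← ENNReal.ofReal_mul (norm_nonneg _)]
    refine ENNReal.ofReal_le_ofReal ?_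
    rw [map_mul, norm_mul, map_natCast, Complex.norm_natCast]
    have e1 : (n.descFactorial (n - k) : ℝ) ≤ n ! := by
      exact_mod_cast Nat.le_of_dvd (Nat.factorial_pos _)
        ⟨_, by rw [mul_comm]; exact (Nat.factorial_mul_descFactorial (Nat.sub_le n k)).symm⟩
    have e2 : (r : ℝ) ^ k ≤ r ^ n := pow_le_pow_right₀ (by exact_mod_cast hr) hk'
    gcongr
    exact hp k
  rw [wn, tsum_eq_sum (s := Finset.range (n + 1)) (fun k hk => by
    rw [Polynomial.coeff_coe, coeff_padePoly, if_neg (by simpa using hk)]; simp)]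
  refine (Finset.sum_le_sum h1).trans ?_
  rw [Finset.sum_const, Finset.card_range, nsmul_eq_mul, ← ENNReal.ofReal_natCast,
    ← ENNReal.ofReal_mul (by positivity)]
  refine ENNReal.ofReal_le_ofReal ?_
  have e3 : ((n + 1 : ℕ) : ℝ) ≤ 2 ^ n := by exact_mod_cast Nat.lt_two_pow_self
  calc ((n + 1 : ℕ) : ℝ) * (n ! * A ^ t * r ^ n)
      ≤ 2 ^ n * ((((q : ℝ) ^ q) ^ t * ((t : ℝ) ^ t) ^ q) * A ^ t * r ^ n) := by
        gcongr
        exact factorial_qt_le q t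
    _ = _ := by rw [hn]; simp only [mul_pow, ← pow_mul]; ring

lemma wn_tail_le (σ : K →+* ℂ) (r : ℝ≥0) {f : K⟦X⟧} {N t : ℕ} (ht : 1 ≤ t) {x M : ℝ} (hx : 0 ≤ x)
    (hM : 0 ≤ M)
    (h0 : ∀ l < N, coeff l f = 0) (h1 : ∀ l, ‖σ (coeff l f)‖ * r ^ l ≤ M * (x ^ l / l !)) :
    wn σ r f * (t : ℝ≥0∞) ^ N ≤ ENNReal.ofReal (M * Real.exp x ^ t) := by
  have hs : HasSum (fun l : ℕ => M * ((t * x) ^ l / l !)) (M * Real.exp (t * x)) := by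
    refine HasSum.mul_left _ ?_
    rw [Real.exp_eq_exp_ℝ]
    exact NormedSpace.expSeries_div_hasSum_exp _
  rw [← Real.exp_nat_mul, ← hs.tsum_eq, ENNReal.ofReal_tsum_of_nonneg (fun l => by positivity)
    hs.summable, wn, ← ENNReal.tsum_mul_right]
  refine ENNReal.tsum_le_tsum fun l => ?_
  by_cases hl : l < N
  · rw [h0 l hl]; simp
  · rw [← ofReal_norm, ← ENNReal.ofReal_coe_nnreal, ← ENNReal.ofReal_pow r.coe_nonneg,
      ← ENNReal.ofReal_mul (norm_nonneg _), ← ENNReal.ofReal_natCast, ← ENNReal.ofReal_pow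
      (by positivity), ← ENNReal.ofReal_mul (by positivity)]
    refine ENNReal.ofReal_le_ofReal ?_
    have ht' : (1 : ℝ) ≤ t := by exact_mod_cast ht
    calc ‖σ (coeff l f)‖ * r ^ l * (t : ℝ) ^ N ≤ M * (x ^ l / l !) * (t : ℝ) ^ l := by
          exact mul_le_mul (h1 l) (pow_le_pow_right₀ ht' (not_lt.1 hl)) (by positivity)
            (by positivity)
      _ = _ := by rw [mul_pow]; ring

end Forms

section Forms
universe u
variable {K : Type*} [Field K] [NumberField K]

lemma exists_pade_forms {I : Type u} [Fintype I] [Nonempty I] {v : I → K⟦X⟧}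
    (hv : ∀ i, EBound (v i)) {q : ℕ} (hq : 1 ≤ q) {r : ℝ≥0} (hr : 1 ≤ r) :
    ∃ A : ℝ≥0∞, 1 ≤ A ∧ A ≠ ⊤ ∧ ∀ t : ℕ, 1 ≤ t → ∃ P : I → Polynomial K, P ≠ 0 ∧
      (∀ i, (P i).natDegree ≤ q * t) ∧ (∀ i k, IsIntegral ℤ ((P i).coeff k)) ∧
      X ^ (Fintype.card I * (q * t) - t) ∣ ∑ i, (P i : K⟦X⟧) * v i ∧
      ∀ σ : K →+* ℂ, (∀ i, wn σ r (P i : K⟦X⟧) ≤ A ^ t * ((t : ℝ≥0∞) ^ t) ^ q) ∧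
        wn σ r (∑ i, (P i : K⟦X⟧) * v i) * (t : ℝ≥0∞) ^ (Fintype.card I * (q * t) - t) ≤
          A ^ t * ((t : ℝ≥0∞) ^ t) ^ q := by
  obtain ⟨A, hA, hP⟩ := exists_pade hv hq
  obtain ⟨⟨C, hC, hCv⟩, -⟩ := EBound.family hv
  set m := Fintype.card I with hm
  have hm1 : (1 : ℝ) ≤ m := by exact_mod_cast Fintype.card_pos (α := I)
  have hr' : (1 : ℝ) ≤ r := by exact_mod_cast hr
  set A1 : ℝ := A * (2 * r * q) ^ q with hA1
  set A2 : ℝ := (q : ℝ) ^ q * m * 2 ^ q * A * C * Real.exp (2 * C * r) with hA2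
  have hA1p : 0 ≤ A1 := by positivity
  have hA2p : 0 ≤ A2 := by positivity
  have hofr : ∀ (a : ℝ) (t : ℕ), 0 ≤ a → ENNReal.ofReal (a ^ t * ((t : ℝ) ^ t) ^ q) ≤
      ENNReal.ofReal a ^ t * ((t : ℝ≥0∞) ^ t) ^ q := fun a t ha => by
    rw [ENNReal.ofReal_mul (by positivity), ENNReal.ofReal_pow ha, ENNReal.ofReal_pow
      (by positivity), ENNReal.ofReal_pow (by positivity), ENNReal.ofReal_natCast]
  refine ⟨1 + ENNReal.ofReal A1 + ENNReal.ofReal A2, ?_, by finiteness, fun t ht => ?_⟩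
  · rw [add_assoc]; exact le_self_add
  obtain ⟨p, ⟨i0, k0, hk0, hpne⟩, hint, hb, hE⟩ := hP t ht
  have hA' : ENNReal.ofReal A1 ≤ 1 + ENNReal.ofReal A1 + ENNReal.ofReal A2 :=
    le_add_self.trans le_self_add
  have hA'' : ENNReal.ofReal A2 ≤ 1 + ENNReal.ofReal A1 + ENNReal.ofReal A2 := le_add_self
  have hR : ∀ l, (l ! : K) * coeff l (∑ i, (padePoly (q * t) (p i) : K⟦X⟧) * v i) =
      (q * t)! * ∑ i, ∑ k ∈ Finset.range (q * t + 1),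
        (l.choose k : K) * (p i k * ((l - k) ! * coeff (l - k) (v i))) := fun l => by
    rw [map_sum, Finset.mul_sum, Finset.mul_sum]
    exact Finset.sum_congr rfl fun i _ => coeff_padePoly_mul _ _ _ _
  have hR0 : ∀ l < m * (q * t) - t,
      coeff l (∑ i, (padePoly (q * t) (p i) : K⟦X⟧) * v i) = 0 := fun l hl => by
    have := hR l
    rw [hE l hl, mul_zero] at this
    exact (mul_eq_zero.1 this).resolve_left (by exact_mod_cast (Nat.factorial_ne_zero l))
  refine ⟨fun i => padePoly (q * t) (p i), ?_, fun i => ?_, fun i k => ?_, ?_, fun σ =>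
    ⟨fun i => ?_, ?_⟩⟩
  · intro h
    have h1 := congr_arg (fun a => Polynomial.coeff a k0) (congr_fun h i0)
    simp only [coeff_padePoly, if_pos hk0, Pi.zero_apply, Polynomial.coeff_zero] at h1
    refine (mul_ne_zero ?_ hpne) h1
    have : (q * t).descFactorial (q * t - k0) ≠ 0 := by
      rw [Ne, Nat.descFactorial_eq_zero_iff_lt]; omega
    exact_mod_cast this
  · refine Polynomial.natDegree_le_iff_coeff_eq_zero.2 fun k hk => ?_
    rw [coeff_padePoly, if_neg (by omega)]
  · rw [coeff_padePoly]
    split_ifs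
    · exact (isIntegral_natCast _).mul (hint i k)
    · exact isIntegral_zero
  · exact X_pow_dvd_iff.2 hR0
  · refine (wn_padePoly_le hA σ hr fun k => hb σ i k).trans ((hofr _ _ hA1p).trans ?_)
    gcongr
  · refine (wn_tail_le σ r ht (x := 2 * C * r) (M := (q * t)! * (m * (q * t + 1 : ℕ) * (A ^ t * C)))
      (by positivity) (by positivity) hR0 fun l => ?_).trans ?_
    · have h1 := congr_arg (fun a => ‖σ a‖) (hR l)
      simp only [map_mul, norm_mul, map_natCast, Complex.norm_natCast] at h1
      have h2 : ‖σ (∑ i, ∑ k ∈ Finset.range (q * t + 1),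
          (l.choose k : K) * (p i k * ((l - k) ! * coeff (l - k) (v i))))‖ ≤
          m * (q * t + 1 : ℕ) * (2 ^ l * (A ^ t * C ^ (l + 1))) := by
        rw [map_sum]
        refine (norm_sum_le _ _).trans ((Finset.sum_le_card_nsmul _ _
          ((q * t + 1 : ℕ) * (2 ^ l * (A ^ t * C ^ (l + 1)))) fun i _ => ?_).trans ?_)
        · rw [map_sum]
          refine (norm_sum_le _ _).trans ((Finset.sum_le_card_nsmul _ _
            (2 ^ l * (A ^ t * C ^ (l + 1))) fun k _ => ?_).trans ?_)
          · rw [map_mul, map_mul, norm_mul, norm_mul, map_natCast, Complex.norm_natCast]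
            have e1 : (l.choose k : ℝ) ≤ 2 ^ l := by exact_mod_cast Nat.choose_le_two_pow _ _
            have e2 := (hCv σ i (l - k)).trans
              (pow_le_pow_right₀ hC (show l - k + 1 ≤ l + 1 by omega))
            have e3 := hb σ i k
            gcongr
          · rw [Finset.card_range, nsmul_eq_mul]
        · rw [Finset.card_univ, nsmul_eq_mul, mul_assoc]
      have h3 : (0 : ℝ) < l ! := by exact_mod_cast Nat.factorial_pos l
      rw [mul_div_assoc', le_div_iff₀ h3]
      calc _ = (l ! * ‖σ (coeff l (∑ i, (padePoly (q * t) (p i) : K⟦X⟧) * v i))‖) * r ^ l := by ring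
        _ ≤ ((q * t)! * (m * (q * t + 1 : ℕ) * (2 ^ l * (A ^ t * C ^ (l + 1))))) * r ^ l := by
            rw [h1]; gcongr
        _ = _ := by rw [mul_pow, mul_pow]; ring
    · refine le_trans (ENNReal.ofReal_le_ofReal ?_) ((hofr A2 t hA2p).trans (by gcongr))
      have ht0 : t ≠ 0 := by omega
      have e3 : ((q * t + 1 : ℕ) : ℝ) ≤ (2 ^ q) ^ t := by
        rw [← pow_mul]; exact_mod_cast Nat.lt_two_pow_self
      calc _ ≤ ((((q : ℝ) ^ q) ^ t * ((t : ℝ) ^ t) ^ q) * (m ^ t * (2 ^ q) ^ t * (A ^ t * C ^ t))) *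
            Real.exp (2 * C * r) ^ t := by
            gcongr
            · exact factorial_qt_le q t
            · exact le_self_pow₀ hm1 ht0
            · exact le_self_pow₀ hC ht0
        _ = _ := by rw [hA2]; simp only [mul_pow]; ring

end Forms

section Forms
universe u
variable {K : Type*} [Field K] [NumberField K]

lemma iterate_const_le {L : ℝ≥0∞} (hL : 1 ≤ L) {t j c : ℕ} (ht : 1 ≤ t) (hj : j ≤ t + c) :
    (L * t) ^ j ≤ (L ^ (1 + c) * 2 ^ c) ^ t * (t : ℝ≥0∞) ^ t := by
  have ht' : (1 : ℝ≥0∞) ≤ t := by exact_mod_cast ht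
  have h2 : (t : ℝ≥0∞) ≤ 2 ^ t := by exact_mod_cast (Nat.lt_two_pow_self (n := t)).le
  calc (L * t) ^ j ≤ (L * t) ^ (t + c) :=
        pow_le_pow_right₀ (one_le_mul_of_one_le_of_one_le hL ht') hj
    _ = L ^ (t + c) * (t ^ c * t ^ t) := by rw [mul_pow]; congr 1; rw [add_comm, pow_add]
    _ ≤ L ^ ((1 + c) * t) * ((2 ^ t) ^ c * t ^ t) := by
        gcongr
        · have : c * 1 ≤ c * t := Nat.mul_le_mul_left _ ht
          linarith
    _ = _ := by rw [mul_pow, ← pow_mul, ← pow_mul, ← pow_mul, mul_comm t c, mul_assoc]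

lemma exists_iterated_forms {I : Type u} [Fintype I] [Nonempty I] {v : I → K⟦X⟧}
    (hv : ∀ i, EBound (v i)) (T : Polynomial K) (B : Matrix I I (Polynomial K))
    (hode : ∀ i, (T : K⟦X⟧) * derivative K (v i) = ∑ l, (B i l : K⟦X⟧) * v l)
    {q : ℕ} (hq : 1 ≤ q) {r : ℝ≥0} (hr : 1 ≤ r) (c : ℕ) :
    ∃ A : ℝ≥0∞, 1 ≤ A ∧ A ≠ ⊤ ∧ ∀ t : ℕ, 1 ≤ t → ∃ P : I → Polynomial K, P ≠ 0 ∧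
      (∀ i, (P i).natDegree ≤ q * t) ∧ (∀ i k, IsIntegral ℤ ((P i).coeff k)) ∧
      X ^ (Fintype.card I * (q * t) - t) ∣ ∑ i, (P i : K⟦X⟧) * v i ∧
      ∀ (σ : K →+* ℂ) (j : ℕ), j ≤ t + c →
        (∀ i, wn σ r (rowSeq T B P j i : K⟦X⟧) ≤ A ^ t * ((t : ℝ≥0∞) ^ t) ^ (q + 1)) ∧
        wn σ r (∑ i, (rowSeq T B P j i : K⟦X⟧) * v i) *
          ((t : ℝ≥0∞) ^ t) ^ (Fintype.card I * q) ≤ A ^ t * ((t : ℝ≥0∞) ^ t) ^ (q + 2) := by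
  classical
  set r1 : ℝ≥0 := r + 1 + c with hr1
  obtain ⟨A, hA, hAt, hP⟩ := exists_pade_forms hv hq (r := r1)
    (by rw [hr1, add_assoc]; exact hr.trans le_self_add)
  set L : ℝ≥0∞ := 1 + ∑ σ : K →+* ℂ, ∑ i, (wn σ r1 (T : K⟦X⟧) + ∑ l, wn σ r1 (B l i : K⟦X⟧)) with hL
  have hL1 : 1 ≤ L := le_self_add
  have hLt : L ≠ ⊤ := by
    refine ENNReal.add_ne_top.2 ⟨by finiteness, (ENNReal.sum_lt_top.2 fun σ _ =>
      ENNReal.sum_lt_top.2 fun i _ => ENNReal.add_lt_top.2 ⟨wn_coe_lt_top _ _ _,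
        ENNReal.sum_lt_top.2 fun l _ => wn_coe_lt_top _ _ _⟩).ne⟩
  have hLi : ∀ (σ : K →+* ℂ) i, wn σ r1 (T : K⟦X⟧) + ∑ l, wn σ r1 (B l i : K⟦X⟧) ≤ L := by
    intro σ i
    refine le_trans ?_ le_add_self
    exact (Finset.single_le_sum (f := fun i => wn σ r1 (T : K⟦X⟧) + ∑ l, wn σ r1 (B l i : K⟦X⟧))
      (fun _ _ => zero_le) (Finset.mem_univ i)).trans (Finset.single_le_sum
      (f := fun σ : K →+* ℂ => ∑ i, (wn σ r1 (T : K⟦X⟧) + ∑ l, wn σ r1 (B l i : K⟦X⟧)))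
      (fun _ _ => zero_le) (Finset.mem_univ σ))
  refine ⟨(L ^ (1 + c) * 2 ^ c) * A, ?_, by finiteness, fun t ht => ?_⟩
  · exact one_le_mul_of_one_le_of_one_le (one_le_mul_of_one_le_of_one_le (one_le_pow₀ hL1)
      (one_le_pow₀ (by norm_num))) hA
  obtain ⟨P, hP0, hdeg, hint, hdvd, hb⟩ := hP t ht
  refine ⟨P, hP0, hdeg, hint, hdvd, fun σ j hj => ?_⟩
  have ht0 : t ≠ 0 := by omega
  have hrj : r + j * (t : ℝ≥0)⁻¹ ≤ r1 := by
    have htp : (0 : ℝ≥0) < t := by exact_mod_cast ht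
    rw [hr1, add_assoc]
    gcongr
    rw [← div_eq_mul_inv, div_le_iff₀ htp]
    have h1 : (j : ℝ≥0) ≤ t + c := by exact_mod_cast hj
    have h2 : (c : ℝ≥0) * 1 ≤ c * t := by gcongr; exact_mod_cast ht
    calc (j : ℝ≥0) ≤ t + c * 1 := by rw [mul_one]; exact h1
      _ ≤ t + c * t := by gcongr
      _ = _ := by ring
  constructor
  · intro i
    refine (wn_iterate_le σ (T := (T : K⟦X⟧)) (B := fun l i => (B l i : K⟦X⟧))
      (G := fun j i => (rowSeq T B P j i : K⟦X⟧)) (fun j i => ?_) (hLi σ) (hb σ).1 ht0 j r hrj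
      i).trans ?_
    · simp only [rowSeq, derivative_coe, ← Polynomial.coe_mul, Polynomial.coe_add]
      congr 1
      rw [← Polynomial.coeToPowerSeries.ringHom_apply, map_sum]
      rfl
    · calc _ ≤ ((L ^ (1 + c) * 2 ^ c) ^ t * (t : ℝ≥0∞) ^ t) *
            (A ^ t * ((t : ℝ≥0∞) ^ t) ^ q) := by
            gcongr
            exact iterate_const_le hL1 ht hj
        _ = _ := by rw [mul_pow _ A, pow_succ]; ring
  · have h1 := wn_iterate_le (I := Unit) σ (T := (T : K⟦X⟧)) (B := fun _ _ => 0) (L := L)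
      (M := wn σ r1 (∑ i, (P i : K⟦X⟧) * v i))
      (G := fun j _ => ∑ i, (rowSeq T B P j i : K⟦X⟧) * v i) (fun j _ => by
        have := rowSeq_form (Polynomial.coeToPowerSeries.ringHom (R := K))
          ((derivative K : Derivation K K⟦X⟧ K⟦X⟧) : K⟦X⟧ →+ K⟦X⟧)
          (fun x y => by
            change derivative K (x * y) = derivative K x * y + x * derivative K y
            rw [Derivation.leibniz, smul_eq_mul, smul_eq_mul]; ring)
          (fun p => derivative_coe p) T B P v hode j
        simp only [mul_zero, Finset.sum_const_zero, add_zero]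
        exact this) (fun i => by
          obtain ⟨i0⟩ := ‹Nonempty I›
          simp only [wn_zero, Finset.sum_const_zero, add_zero]
          exact le_self_add.trans (hLi σ i0)) (fun _ => le_rfl) ht0 j r hrj ()
    have hm : t ≤ Fintype.card I * (q * t) := by
      rw [← mul_assoc]
      exact Nat.le_mul_of_pos_left _ (Nat.mul_pos Fintype.card_pos hq)
    have hpow : ((t : ℝ≥0∞) ^ t) ^ (Fintype.card I * q) =
        (t : ℝ≥0∞) ^ (Fintype.card I * (q * t) - t) * (t : ℝ≥0∞) ^ t := by
      rw [← pow_add, Nat.sub_add_cancel hm, ← pow_mul]; congr 1; ring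
    rw [hpow]
    calc _ ≤ ((L * t) ^ j * wn σ r1 (∑ i, (P i : K⟦X⟧) * v i)) *
          ((t : ℝ≥0∞) ^ (Fintype.card I * (q * t) - t) * (t : ℝ≥0∞) ^ t) := by gcongr
      _ = (L * t) ^ j * (wn σ r1 (∑ i, (P i : K⟦X⟧) * v i) *
          (t : ℝ≥0∞) ^ (Fintype.card I * (q * t) - t)) * (t : ℝ≥0∞) ^ t := by ring
      _ ≤ ((L ^ (1 + c) * 2 ^ c) ^ t * (t : ℝ≥0∞) ^ t) * (A ^ t * ((t : ℝ≥0∞) ^ t) ^ q) *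
          (t : ℝ≥0∞) ^ t := by
          exact mul_le_mul' (mul_le_mul' (iterate_const_le hL1 ht hj) (hb σ).2) le_rfl
      _ = _ := by rw [mul_pow _ A]; ring

end Forms

section Forms
universe u
variable {K : Type*} [Field K]

lemma isIntegral_coeff_rowSeq {I : Type*} [Fintype I] {T : Polynomial K}
    {B : Matrix I I (Polynomial K)} {P : I → Polynomial K} (hT : ∀ k, IsIntegral ℤ (T.coeff k))
    (hB : ∀ i l k, IsIntegral ℤ ((B i l).coeff k)) (hP : ∀ i k, IsIntegral ℤ ((P i).coeff k))
    (j : ℕ) (i : I) (k : ℕ) : IsIntegral ℤ ((rowSeq T B P j i).coeff k) := by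
  have hl : ∀ p : Polynomial K, (∀ k, IsIntegral ℤ (p.coeff k)) →
      ∃ p' : Polynomial (integralClosure ℤ K), p'.map (algebraMap _ K) = p := fun p hp =>
    (Polynomial.mem_lifts p).1 ((Polynomial.lifts_iff_coeff_lifts p).2 fun k =>
      ⟨⟨p.coeff k, hp k⟩, rfl⟩)
  obtain ⟨T', rfl⟩ := hl T hT
  choose B' hB' using fun i l => hl (B i l) (hB i l)
  choose P' hP' using fun i => hl (P i) (hP i)
  obtain rfl : (Matrix.of B').map (Polynomial.map (algebraMap _ K)) = B := by
    ext1 i l; exact hB' i l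
  obtain rfl : (fun i => (P' i).map (algebraMap _ K)) = P := funext hP'
  rw [← rowSeq_map, Polynomial.coeff_map]
  exact (rowSeq T' (Matrix.of B') P' j i |>.coeff k).2

lemma isIntegral_pow_mul_eval {p : Polynomial K} (hp : ∀ k, IsIntegral ℤ (p.coeff k)) {n : ℕ}
    (hn : p.natDegree ≤ n) {δ : ℕ} {α : K} (hα : IsIntegral ℤ ((δ : K) * α)) :
    IsIntegral ℤ ((δ : K) ^ n * p.eval α) := by
  rw [Polynomial.eval_eq_sum_range' (Nat.lt_succ_iff.2 hn), Finset.mul_sum]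
  refine IsIntegral.sum _ fun k hk => ?_
  have hk : k ≤ n := Nat.lt_succ_iff.1 (Finset.mem_range.1 hk)
  have : (δ : K) ^ n * (p.coeff k * α ^ k) = (δ : K) ^ (n - k) * p.coeff k * (δ * α) ^ k := by
    rw [mul_pow, ← Nat.sub_add_cancel hk, pow_add]; simp; ring
  rw [this]
  exact (((isIntegral_natCast δ).pow _).mul (hp k)).mul (hα.pow k)

variable [NumberField K]

lemma exists_natCast_mul_isIntegral_family {J : Type*} [Finite J] (c : J → K) :
    ∃ y : ℕ, y ≠ 0 ∧ ∀ j, IsIntegral ℤ ((y : K) * c j) := by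
  classical
  have := Fintype.ofFinite J
  choose y hy h using fun j => exists_natCast_mul_isIntegral (c j)
  refine ⟨∏ j, y j, Finset.prod_ne_zero_iff.2 fun j _ => hy j, fun j => ?_⟩
  rw [← Finset.mul_prod_erase _ _ (Finset.mem_univ j), Nat.cast_mul, mul_right_comm]
  exact (h j).mul (isIntegral_natCast _)

lemma exists_natCast_mul_coeff_isIntegral {J : Type*} [Finite J] (p : J → Polynomial K) :
    ∃ y : ℕ, y ≠ 0 ∧ ∀ j k, IsIntegral ℤ ((Polynomial.C (y : K) * p j).coeff k) := by
  have := Fintype.ofFinite J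
  obtain ⟨y, hy, h⟩ := exists_natCast_mul_isIntegral_family
    (fun x : Σ j, {k // k ∈ (p j).support} => (p x.1).coeff x.2)
  refine ⟨y, hy, fun j k => ?_⟩
  rw [Polynomial.coeff_C_mul]
  by_cases hk : k ∈ (p j).support
  · exact h ⟨j, k, hk⟩
  · rw [Polynomial.notMem_support_iff.1 hk, mul_zero]; exact isIntegral_zero

lemma toReal_bound {z : ℂ} {A : ℝ≥0∞} (hA : A ≠ ⊤) {t p : ℕ}
    (h : ‖z‖ₑ ≤ A ^ t * ((t : ℝ≥0∞) ^ t) ^ p) : ‖z‖ ≤ A.toReal ^ t * ((t : ℝ) ^ t) ^ p := by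
  have := ENNReal.toReal_mono (by finiteness) h
  simpa using this

/-- Evaluating the iterated Padé forms at a nonsingular point. -/
lemma exists_small_values {I : Type u} [Fintype I] [DecidableEq I] [Nonempty I] {v : I → K⟦X⟧}
    (hv : ∀ i, EBound (v i)) {T : Polynomial K} {B : Matrix I I (Polynomial K)}
    (hode : ∀ i, (T : K⟦X⟧) * derivative K (v i) = ∑ l, (B i l : K⟦X⟧) * v l)
    (hind : ∀ q : I → Polynomial K, ∑ i, (q i : K⟦X⟧) * v i = 0 → q = 0)
    {α : K} (hα : α ≠ 0) (hT : T.eval α ≠ 0) (ι : K →+* ℂ) {w : I → ℂ}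
    (hw : ∀ i, HasSum (fun n => ι (coeff n (v i)) * (ι α) ^ n) (w i)) {q : ℕ} (hq : 2 ≤ q) :
    ∃ (a : ℝ) (c : ℕ), 1 ≤ a ∧ ∀ t : ℕ, 1 ≤ t → c ≤ t → ∃ M : ℕ → I → K,
      (∃ D : ℕ, D ≠ 0 ∧ (D : ℝ) ≤ a ^ t ∧ ∀ j ≤ t + c, ∀ i, IsIntegral ℤ ((D : K) * M j i)) ∧
      (∀ (σ : K →+* ℂ), ∀ j ≤ t + c, ∀ i, ‖σ (M j i)‖ ≤ a ^ t * ((t : ℝ) ^ t) ^ (q + 1)) ∧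
      (∀ j ≤ t + c, ‖∑ i, ι (M j i) * w i‖ * ((t : ℝ) ^ t) ^ (Fintype.card I * q) ≤
        a ^ t * ((t : ℝ) ^ t) ^ (q + 2)) ∧
      ∀ x : I → K, (∀ j ≤ t + c, ∑ i, M j i * x i = 0) → x = 0 := by
  classical
  obtain ⟨y, hy, hyT⟩ := exists_natCast_mul_coeff_isIntegral
    (fun x : Option (I × I) => x.elim T fun x => B x.1 x.2)
  have hyK : (y : K) ≠ 0 := by exact_mod_cast hy
  set T' := Polynomial.C (y : K) * T with hT'
  set B' : Matrix I I (Polynomial K) := Matrix.of fun i l => Polynomial.C (y : K) * B i l with hB'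
  have hode' : ∀ i, (T' : K⟦X⟧) * derivative K (v i) = ∑ l, (B' i l : K⟦X⟧) * v l := fun i => by
    simp only [hT', hB', Matrix.of_apply, Polynomial.coe_mul, mul_assoc, hode i, Finset.mul_sum]
  have hTα : T'.eval α ≠ 0 := by
    rw [hT', Polynomial.eval_mul, Polynomial.eval_C]; exact mul_ne_zero hyK hT
  obtain ⟨c, hc⟩ := zero_estimate hα hTα hind hode'
  obtain ⟨C, hC, hCα⟩ := exists_norm_embedding_le α
  obtain ⟨δ, hδ, hδα⟩ := exists_natCast_mul_isIntegral α
  set r : ℝ≥0 := ⟨C, by linarith⟩ with hr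
  obtain ⟨A, hA, hAt, hP⟩ := exists_iterated_forms hv T' B' hode' (q := q) (by omega) (r := r)
    (by exact_mod_cast hC) c
  set e := ∑ x : Option (I × I), (x.elim T' fun x => B' x.1 x.2).natDegree with he
  have heT : T'.natDegree ≤ e := Finset.single_le_sum
    (f := fun x : Option (I × I) => (x.elim T' fun x => B' x.1 x.2).natDegree)
    (fun _ _ => zero_le) (Finset.mem_univ none)
  have heB : ∀ i l, (B' i l).natDegree ≤ e := fun i l => Finset.single_le_sum
    (f := fun x : Option (I × I) => (x.elim T' fun x => B' x.1 x.2).natDegree)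
    (fun _ _ => zero_le) (Finset.mem_univ (some (i, l)))
  have hA1 : 1 ≤ A.toReal := by
    have := ENNReal.toReal_mono hAt hA
    simpa using this
  have hδ1 : (1 : ℝ) ≤ δ := by exact_mod_cast Nat.one_le_iff_ne_zero.2 hδ
  set κ := q + (1 + c) * e
  have hδκ : (1 : ℝ) ≤ (δ : ℝ) ^ κ := one_le_pow₀ hδ1
  have hAa : A.toReal ≤ A.toReal * δ ^ κ := le_mul_of_one_le_right (by linarith) hδκ
  refine ⟨A.toReal * δ ^ κ, c, one_le_mul_of_one_le_of_one_le hA1 hδκ, fun t ht hct => ?_⟩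
  obtain ⟨P, hP0, hdeg, hint, hdvd, hb⟩ := hP t ht
  have hle : ∀ p, A.toReal ^ t * ((t : ℝ) ^ t) ^ p ≤ (A.toReal * δ ^ κ) ^ t * ((t : ℝ) ^ t) ^ p :=
    fun p => by gcongr
  have hev : ∀ (σ : K →+* ℂ) j, j ≤ t + c → ∀ i,
      ‖σ ((rowSeq T' B' P j i).eval α)‖ ≤ A.toReal ^ t * ((t : ℝ) ^ t) ^ (q + 1) :=
    fun σ j hj i => toReal_bound hAt ((enorm_eval_le (r := r) σ (hCα σ) _).trans ((hb σ j hj).1 i))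
  refine ⟨fun j i => (rowSeq T' B' P j i).eval α, ⟨δ ^ (κ * t), pow_ne_zero _ hδ, ?_, ?_⟩,
    fun σ j hj i => (hev σ j hj i).trans (hle _), fun j hj => ?_, fun x hx => ?_⟩
  · rw [Nat.cast_pow, pow_mul, mul_pow]
    exact le_mul_of_one_le_left (by positivity) (one_le_pow₀ hA1)
  · intro j hj i
    rw [Nat.cast_pow]
    refine isIntegral_pow_mul_eval (isIntegral_coeff_rowSeq (fun k => hyT none k)
      (fun i l k => hyT (some (i, l)) k) hint j i)
      ((natDegree_rowSeq_le heT heB hdeg j i).trans ?_) hδα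
    have h1 : j ≤ (1 + c) * t := by
      have : c * 1 ≤ c * t := Nat.mul_le_mul_left _ ht
      linarith
    calc q * t + j * e ≤ q * t + ((1 + c) * t) * e := by gcongr
      _ = _ := by ring
  · have hs : HasSum (fun n => ι (coeff n (∑ i, (rowSeq T' B' P j i : K⟦X⟧) * v i)) * (ι α) ^ n)
        (∑ i, ι ((rowSeq T' B' P j i).eval α) * w i) := by
      have := hasSum_sum (s := Finset.univ)
        fun i (_ : i ∈ Finset.univ) => hasSum_coe_mul ι (hw i) (rowSeq T' B' P j i)
      refine this.congr_fun ?_ 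
      intro n
      rw [map_sum, map_sum, Finset.sum_mul]
    have h1 := (enorm_le_wn ι hs).trans (wn_mono ι (r' := r) (hCα ι) _)
    have h2 := (mul_le_mul_left h1 _).trans (hb ι j hj).2
    have h3 := toReal_bound (z := (∑ i, ι ((rowSeq T' B' P j i).eval α) * w i) *
      (((t : ℂ) ^ t) ^ (Fintype.card I * q))) hAt (by
        refine le_of_eq_of_le ?_ h2
        rw [enorm_mul, enorm_pow, enorm_pow]
        congr 3
        rw [← ofReal_norm, Complex.norm_natCast, ENNReal.ofReal_natCast])
    rw [norm_mul, norm_pow, norm_pow, Complex.norm_natCast] at h3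
    exact h3.trans (hle _)
  · have hmqt : t ≤ Fintype.card I * (q * t) := by
      rw [← mul_assoc]
      exact Nat.le_mul_of_pos_left _ (Nat.mul_pos Fintype.card_pos (by omega))
    refine hc (q * t) P _ hP0 hdeg hdvd ?_ x fun j hj => hx j (by omega)
    obtain ⟨m', hm'⟩ := Nat.exists_eq_succ_of_ne_zero (Fintype.card_pos (α := I)).ne'
    rw [hm', Nat.succ_sub_one, Nat.succ_mul]
    have : 2 * t ≤ q * t := Nat.mul_le_mul_right _ hq
    omega

end Forms

section Forms
universe u

lemma norm_det_le {J : Type*} [Fintype J] [DecidableEq J] {N : Matrix J J ℂ} {β : J → ℝ}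
    (h : ∀ a b, ‖N a b‖ ≤ β b) : ‖N.det‖ ≤ (Fintype.card J)! * ∏ b, β b := by
  rw [Matrix.det_apply]
  refine (norm_sum_le _ _).trans ((Finset.sum_le_card_nsmul _ _ (∏ b, β b) fun σ _ => ?_).trans ?_)
  · have : ‖Equiv.Perm.sign σ • ∏ i, N (σ i) i‖ = ∏ i, ‖N (σ i) i‖ := by
      rcases Int.units_eq_one_or (Equiv.Perm.sign σ) with h | h <;> rw [h] <;> simp
    rw [this]
    exact Finset.prod_le_prod (fun _ _ => norm_nonneg _) fun i _ => h _ _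
  · rw [Finset.card_univ, Fintype.card_perm, nsmul_eq_mul]

variable {K : Type*} [Field K]

lemma exists_coordinates [Algebra K ℂ] {I : Type*} [Fintype I] (w : I → ℂ) (hw : w ≠ 0) :
    ∃ (ρ : ℕ) (ω : Fin ρ → ℂ) (g : I → Fin ρ → K) (b : Fin ρ),
      ρ = Module.finrank K (Submodule.span K (Set.range w)) ∧ ω b ≠ 0 ∧ (∀ i, w i = ∑ b, algebraMap K ℂ (g i b) * ω b) ∧
      ∀ x : Fin ρ → K, (∀ i, ∑ b, g i b * x b = 0) → x = 0 := by
  have : Module.Finite K (Submodule.span K (Set.range w)) :=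
    Module.Finite.span_of_finite K (Set.finite_range w)
  let ω := Module.finBasis K (Submodule.span K (Set.range w))
  let w' : I → Submodule.span K (Set.range w) := fun i => ⟨w i, Submodule.subset_span ⟨i, rfl⟩⟩
  have hwω : ∀ i, w i = ∑ b, algebraMap K ℂ (ω.repr (w' i) b) * (ω b : ℂ) := fun i => by
    have h := congr_arg Subtype.val (ω.sum_repr (w' i))
    simp only [AddSubmonoidClass.coe_finsetSum, SetLike.val_smul, Algebra.smul_def] at h
    exact h.symm
  obtain ⟨i0, hi0⟩ := Function.ne_iff.1 hw
  have hb : ∃ b, (ω b : ℂ) ≠ 0 := by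
    by_contra! h
    exact hi0 (by rw [hwω i0]; simp [h])
  obtain ⟨b, hb⟩ := hb
  refine ⟨_, fun b => ω b, fun i b => ω.repr (w' i) b, b, rfl, hb, hwω, fun x hx => ?_⟩
  let F : Submodule.span K (Set.range w) →ₗ[K] K := ω.constr K x
  have hF : ∀ y, F y = ∑ b, ω.repr y b * x b := fun y => by
    rw [Module.Basis.constr_apply_fintype]; rfl
  have h0 : F = 0 := by
    refine LinearMap.ext_on_range (v := w') ?_ fun i => by rw [hF, hx i]; rfl
    have := Submodule.span_span_coe_preimage (R := K) (s := Set.range w)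
    rw [← this]
    congr 1
    ext y
    simp [w', Subtype.ext_iff]
  funext b
  rw [← ω.constr_basis K x b]
  change F (ω b) = 0
  rw [h0]; rfl

lemma not_forall_pow_self_le {C : ℝ} (hC : 0 ≤ C) (N : ℕ) :
    ¬ ∀ t : ℕ, N ≤ t → (t : ℝ) ^ t ≤ C ^ t := by
  intro h
  obtain ⟨t, ht⟩ := exists_nat_gt (max C N)
  have h1 := (le_max_right C (N : ℝ)).trans_lt ht
  have h2 := (le_max_left C (N : ℝ)).trans_lt ht
  have h3 : N < t := by exact_mod_cast h1
  exact (pow_lt_pow_left₀ h2 hC (by omega)).not_ge (h t h3.le)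

variable [NumberField K]

lemma one_le_norm_mul_pow {x : K} (hx : IsIntegral ℤ x) (hx0 : x ≠ 0) (ι : K →+* ℂ) {H : ℝ}
    (hH : ∀ σ : K →+* ℂ, ‖σ x‖ ≤ H) : 1 ≤ ‖ι x‖ * H ^ (Module.finrank ℚ K - 1) := by
  have h1 : IsIntegral ℤ (Algebra.norm ℚ x) := Algebra.isIntegral_norm ℚ hx
  obtain ⟨z, hz⟩ := IsIntegrallyClosed.isIntegral_iff.1 h1
  have hz0 : z ≠ 0 := by
    rintro rfl
    rw [map_zero] at hz
    exact hx0 (Algebra.norm_eq_zero_iff.1 hz.symm)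
  have h2 : (1 : ℝ) ≤ ‖Algebra.norm ℚ x‖ := by
    rw [← hz]
    have : (1 : ℝ) ≤ |(z : ℝ)| := by exact_mod_cast Int.one_le_abs hz0
    rwa [eq_intCast, Int.norm_cast_rat, Int.norm_eq_abs]
  refine h2.trans ((NumberField.norm_norm_le_norm_mul_house_pow x ι).trans ?_)
  gcongr
  · exact (norm_nonneg _).trans (NumberField.norm_embedding_le_house x ι)
  · exact house_le_iff.2 hH

/-- Siegel–Shidlovskii type lower bound for the rank of the values of E-functions. -/
theorem card_le_finrank_span_values [Algebra K ℂ] {I : Type u} [Fintype I] [DecidableEq I]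
    {v : I → K⟦X⟧} (hv : ∀ i, EBound (v i)) {T : Polynomial K} {B : Matrix I I (Polynomial K)}
    (hode : ∀ i, (T : K⟦X⟧) * derivative K (v i) = ∑ l, (B i l : K⟦X⟧) * v l)
    (hind : ∀ q : I → Polynomial K, ∑ i, (q i : K⟦X⟧) * v i = 0 → q = 0)
    {α : K} (hα : α ≠ 0) (hT : T.eval α ≠ 0) {w : I → ℂ}
    (hw : ∀ i, HasSum (fun n => algebraMap K ℂ (coeff n (v i)) * (algebraMap K ℂ α) ^ n) (w i))
    (hw0 : w ≠ 0) : Fintype.card I ≤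
      Module.finrank ℚ K * Module.finrank K (Submodule.span K (Set.range w)) := by
  classical
  by_contra! hlt
  set ι := algebraMap K ℂ with hι
  have : Nonempty I := ⟨(Function.ne_iff.1 hw0).choose⟩
  obtain ⟨ρ, ω, g, b0, hρ, hb0, hwg, hg⟩ := exists_coordinates (K := K) w hw0
  rw [← hρ] at hlt
  set d := Module.finrank ℚ K with hd
  set m := Fintype.card I with hm
  have hm1 : 1 ≤ m := Fintype.card_pos
  have hd1 : 1 ≤ d := Module.finrank_pos
  have hρ1 : 1 ≤ ρ := by have := b0.2; omega
  set q := m + 1 with hq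
  obtain ⟨a, c, ha, hS⟩ := exists_small_values hv hode hind hα hT ι hw (q := q) (by omega)
  obtain ⟨δ, hδ, hδg⟩ := exists_natCast_mul_isIntegral_family fun x : I × Fin ρ => g x.1 x.2
  choose G hG1 hG using fun x : I × Fin ρ => exists_norm_embedding_le (g x.1 x.2)
  set G0 : ℝ := 1 + ∑ x, G x with hG0
  have hG01 : 1 ≤ G0 := by
    have : 0 ≤ ∑ x, G x := Finset.sum_nonneg fun x _ => zero_le_one.trans (hG1 x)
    linarith
  have hgb : ∀ (σ : K →+* ℂ) i b, ‖σ (g i b)‖ ≤ G0 := fun σ i b => by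
    have := Finset.single_le_sum (f := G) (fun x _ => zero_le_one.trans (hG1 x))
      (Finset.mem_univ (i, b))
    have := hG (i, b) σ
    simp only at this
    linarith
  have hmR : (1 : ℝ) ≤ m := by exact_mod_cast hm1
  have hδR : (1 : ℝ) ≤ δ := by exact_mod_cast Nat.one_le_iff_ne_zero.2 hδ
  have hfR : (1 : ℝ) ≤ ρ ! := by exact_mod_cast Nat.one_le_iff_ne_zero.2 (Nat.factorial_ne_zero ρ)
  set a' : ℝ := m * G0 * a with ha'
  have haa' : a ≤ a' := le_mul_of_one_le_left (by linarith)
    (one_le_mul_of_one_le_of_one_le hmR hG01)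
  have ha'1 : 1 ≤ a' := ha.trans haa'
  set h : ℝ := (a * δ) ^ ρ * ρ ! * a' ^ ρ with hh
  have hh1 : 1 ≤ h := one_le_mul_of_one_le_of_one_le (one_le_mul_of_one_le_of_one_le
    (one_le_pow₀ (one_le_mul_of_one_le_of_one_le ha hδR)) hfR) (one_le_pow₀ ha'1)
  have hω0 : 0 < ‖ω b0‖ := norm_pos_iff.2 hb0
  refine not_forall_pow_self_le (C := h ^ d * (1 + ‖ω b0‖⁻¹)) (by positivity) (max 1 c)
    fun t ht => ?_
  have ht1 : 1 ≤ t := (le_max_left _ _).trans ht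
  have ht0 : t ≠ 0 := by omega
  obtain ⟨M, ⟨D, hD0, hDa, hDM⟩, hMb, hMs, hMi⟩ := hS t ht1 ((le_max_right _ _).trans ht)
  set y : ℝ := (t : ℝ) ^ t with hy
  have hy1 : 1 ≤ y := one_le_pow₀ (by exact_mod_cast ht1)
  obtain ⟨J, hJ⟩ := exists_minor_ne_zero
    (Matrix.of fun (b : Fin ρ) (j : Fin (t + c + 1)) => ∑ i, M j i * g i b) (fun x hx => by
      refine hg x fun i => ?_
      refine congr_fun (hMi (fun i => ∑ b, g i b * x b) fun j hj => ?_) i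
      have := congr_fun hx ⟨j, by omega⟩
      simp only [vecMul, dotProduct, Matrix.of_apply, Pi.zero_apply, Finset.mul_sum] at this
      rw [Finset.sum_comm] at this
      simp only [Finset.mul_sum]
      rw [← this]
      exact Finset.sum_congr rfl fun i _ => Finset.sum_congr rfl fun b _ => by ring)
  set N : Matrix (Fin ρ) (Fin ρ) K := Matrix.of fun a b => ∑ i, M (J a) i * g i b with hN
  have hNdet : N.det ≠ 0 := by rw [← Matrix.det_transpose]; exact hJ
  have hJle : ∀ a, (J a : ℕ) ≤ t + c := fun a => by have := (J a).2; omega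
  set μ : ℝ := a' ^ t * y ^ (q + 1) with hμ
  have hμN : ∀ (σ : K →+* ℂ) a b, ‖σ (N a b)‖ ≤ μ := fun σ x b => by
    rw [hN, Matrix.of_apply, map_sum]
    refine (norm_sum_le _ _).trans ((Finset.sum_le_card_nsmul _ _ (a ^ t * y ^ (q + 1) * G0)
      fun i _ => ?_).trans ?_)
    · rw [map_mul, norm_mul]
      exact mul_le_mul (hMb σ _ (hJle x) i) (hgb σ i b) (norm_nonneg _) (by positivity)
    · rw [Finset.card_univ, nsmul_eq_mul, ← hm, hμ, ha', mul_pow]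
      have : (m : ℝ) * G0 ≤ (m * G0) ^ t :=
        le_self_pow₀ (one_le_mul_of_one_le_of_one_le hmR hG01) ht0
      calc _ = (m * G0) * a ^ t * y ^ (q + 1) := by ring
        _ ≤ _ := by gcongr
  have hdetσ : ∀ σ : K →+* ℂ, ‖σ N.det‖ ≤ ρ ! * μ ^ ρ := fun σ => by
    rw [RingHom.map_det]
    refine (norm_det_le (β := fun _ => μ) fun a b => hμN σ a b).trans ?_
    simp
  have hωs : (N.map ι) *ᵥ ω = fun a => ∑ i, ι (M (J a) i) * w i := by
    funext a
    simp only [mulVec, dotProduct, Matrix.map_apply, hN, Matrix.of_apply, map_sum, map_mul, hwg,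
      Finset.mul_sum, Finset.sum_mul]
    rw [Finset.sum_comm]
    exact Finset.sum_congr rfl fun i _ => Finset.sum_congr rfl fun b _ => by ring
  have hcr : ι N.det * ω b0 = ((N.map ι).updateCol b0 fun a => ∑ i, ι (M (J a) i) * w i).det := by
    rw [← Matrix.cramer_apply, Matrix.cramer_eq_adjugate_mulVec, ← hωs, Matrix.mulVec_mulVec,
      Matrix.adjugate_mul, RingHom.map_det, Matrix.smul_mulVec, Matrix.one_mulVec]
    rfl
  set ε : ℝ := a ^ t * y ^ (q + 2) / y ^ (m * q) with hε
  have hιb : ‖ι N.det‖ * ‖ω b0‖ ≤ ρ ! * (ε * μ ^ (ρ - 1)) := by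
    rw [← norm_mul, hcr]
    refine (norm_det_le (β := Function.update (fun _ => μ) b0 ε) fun a b => ?_).trans ?_
    · by_cases hb : b = b0
      · subst hb
        rw [Matrix.updateCol_self, Function.update_self, hε, le_div_iff₀ (by positivity)]
        exact hMs _ (hJle a)
      · rw [Matrix.updateCol_ne hb, Function.update_of_ne hb]
        exact hμN ι a b
    · rw [Finset.prod_update_of_mem (Finset.mem_univ _), Finset.prod_const, Fintype.card_fin,
        ← Finset.compl_eq_univ_sdiff, Finset.card_compl, Fintype.card_fin, Finset.card_singleton]
  have hint : IsIntegral ℤ (((D * δ : ℕ) : K) ^ ρ * N.det) := by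
    have h1 : ((D * δ : ℕ) : K) ^ ρ * N.det = (((D * δ : ℕ) : K) • N).det := by
      rw [Matrix.det_smul, Fintype.card_fin]
    rw [h1]
    refine IsIntegral.det fun a b => ?_
    rw [Matrix.smul_apply, smul_eq_mul, hN, Matrix.of_apply, Finset.mul_sum]
    refine IsIntegral.sum _ fun i _ => ?_
    have h2 : ((D * δ : ℕ) : K) * (M (J a) i * g i b) = (D * M (J a) i) * (δ * g i b) := by
      push_cast; ring
    rw [h2]
    exact (hDM _ (hJle a) i).mul (hδg (i, b))
  have hDδ : (((D * δ : ℕ) : ℝ)) ≤ (a * δ) ^ t := by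
    rw [Nat.cast_mul, mul_pow]
    gcongr
    exact le_self_pow₀ hδR ht0
  have hDδ0 : ((D * δ : ℕ) : K) ≠ 0 := by exact_mod_cast Nat.mul_ne_zero hD0 hδ
  have hfin := one_le_norm_mul_pow hint (mul_ne_zero (pow_ne_zero _ hDδ0) hNdet) ι
    (H := ((a * δ) ^ t) ^ ρ * (ρ ! * μ ^ ρ)) (fun σ => by
      rw [map_mul, map_pow, map_natCast, norm_mul, norm_pow, Complex.norm_natCast]
      gcongr
      exact hdetσ σ)
  rw [map_mul, map_pow, map_natCast, norm_mul, norm_pow, Complex.norm_natCast] at hfin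
  have hH : ((a * δ) ^ t) ^ ρ * (ρ ! * μ ^ ρ) ≤ h ^ t * y ^ ((q + 1) * ρ) := by
    have : (ρ ! : ℝ) ≤ (ρ ! : ℝ) ^ t := le_self_pow₀ hfR ht0
    calc ((a * δ) ^ t) ^ ρ * (ρ ! * μ ^ ρ) ≤ ((a * δ) ^ t) ^ ρ * ((ρ ! : ℝ) ^ t * μ ^ ρ) := by
          gcongr
      _ = _ := by
          rw [hμ, hh]; simp only [mul_pow, ← pow_mul]; rw [mul_comm t ρ]; ring
  have hι2 : ((D * δ : ℕ) : ℝ) ^ ρ * ‖ι N.det‖ * ‖ω b0‖ * y ^ (m * q) ≤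
      h ^ t * y ^ ((q + 1) * ρ) * y := by
    calc ((D * δ : ℕ) : ℝ) ^ ρ * ‖ι N.det‖ * ‖ω b0‖ * y ^ (m * q)
        = ((D * δ : ℕ) : ℝ) ^ ρ * (‖ι N.det‖ * ‖ω b0‖) * y ^ (m * q) := by ring
      _ ≤ ((a * δ) ^ t) ^ ρ * (ρ ! * (ε * μ ^ (ρ - 1))) * y ^ (m * q) := by gcongr
      _ = ((a * δ) ^ t) ^ ρ * (ρ ! * ((a ^ t * y ^ (q + 2)) * μ ^ (ρ - 1))) := by
          rw [hε]; field_simp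
      _ ≤ ((a * δ) ^ t) ^ ρ * (ρ ! * ((a' ^ t * y ^ (q + 2)) * μ ^ (ρ - 1))) := by gcongr
      _ = ((a * δ) ^ t) ^ ρ * (ρ ! * (μ ^ (ρ - 1) * μ)) * y := by rw [hμ]; ring
      _ = ((a * δ) ^ t) ^ ρ * (ρ ! * μ ^ ρ) * y := by
          rw [← pow_succ, Nat.sub_add_cancel hρ1]
      _ ≤ _ := by gcongr
  have hall : ‖ω b0‖ * y ^ (m * q) ≤ (h ^ t) ^ d * y ^ ((q + 1) * (d * ρ) + 1) := by
    calc ‖ω b0‖ * y ^ (m * q) = 1 * (‖ω b0‖ * y ^ (m * q)) := by ring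
      _ ≤ (((D * δ : ℕ) : ℝ) ^ ρ * ‖ι N.det‖ * (((a * δ) ^ t) ^ ρ * (ρ ! * μ ^ ρ)) ^ (d - 1)) *
          (‖ω b0‖ * y ^ (m * q)) := by gcongr
      _ = (((D * δ : ℕ) : ℝ) ^ ρ * ‖ι N.det‖ * ‖ω b0‖ * y ^ (m * q)) *
          (((a * δ) ^ t) ^ ρ * (ρ ! * μ ^ ρ)) ^ (d - 1) := by ring
      _ ≤ (h ^ t * y ^ ((q + 1) * ρ) * y) * (h ^ t * y ^ ((q + 1) * ρ)) ^ (d - 1) := by gcongr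
      _ = ((h ^ t * y ^ ((q + 1) * ρ)) ^ (d - 1) * (h ^ t * y ^ ((q + 1) * ρ))) * y := by ring
      _ = (h ^ t * y ^ ((q + 1) * ρ)) ^ d * y := by rw [← pow_succ, Nat.sub_add_cancel hd1]
      _ = _ := by rw [mul_pow, ← pow_mul y, pow_succ y]; ring_nf
  have hexp : (q + 1) * (d * ρ) + 1 + 1 ≤ m * q := by
    have : (q + 1) * (d * ρ) ≤ (q + 1) * (m - 1) := Nat.mul_le_mul_left _ (by omega)
    obtain ⟨m', hm'⟩ := Nat.exists_eq_add_of_le hm1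
    rw [hq, hm'] at this ⊢
    rw [Nat.add_sub_cancel_left] at this
    nlinarith
  have hlast : ‖ω b0‖ * y ≤ (h ^ t) ^ d := by
    have h1 : y ^ ((q + 1) * (d * ρ) + 1) * (‖ω b0‖ * y) ≤
        y ^ ((q + 1) * (d * ρ) + 1) * (h ^ t) ^ d := by
      calc _ = ‖ω b0‖ * y ^ ((q + 1) * (d * ρ) + 1 + 1) := by rw [pow_succ y (_ + 1)]; ring
        _ ≤ ‖ω b0‖ * y ^ (m * q) := by gcongr
        _ ≤ _ := hall
        _ = _ := mul_comm _ _
    exact le_of_mul_le_mul_left h1 (by positivity)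
  have h3 : 1 ≤ 1 + ‖ω b0‖⁻¹ := by have := inv_pos.2 hω0; linarith
  calc y = (‖ω b0‖ * y) * ‖ω b0‖⁻¹ := by field_simp
    _ ≤ (h ^ t) ^ d * (1 + ‖ω b0‖⁻¹) ^ t := by
        gcongr
        have := le_self_pow₀ h3 ht0
        linarith
    _ = _ := by rw [mul_pow (h ^ d), ← pow_mul h, ← pow_mul h, mul_comm t d]

end Forms

section Expansion

/-- `G` is the entire function with Taylor series `g` at the origin. -/
def HasExpansion (g : ℂ⟦X⟧) (G : ℂ → ℂ) : Prop :=
  ∀ z : ℂ, HasSum (fun n => coeff n g * z ^ n) (G z)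

/-- The Taylor series at the origin. -/
def taylorAtZero (G : ℂ → ℂ) : ℂ⟦X⟧ := mk fun n => iteratedDeriv n G 0 / n !

variable {g h : ℂ⟦X⟧} {G H : ℂ → ℂ}

lemma hasExpansion_taylorAtZero (hG : Differentiable ℂ G) :
    HasExpansion (taylorAtZero G) G := fun z => by
  have := Complex.hasSum_taylorSeries_of_entire hG 0 z
  convert! this using 2 with n
  simp only [taylorAtZero, coeff_mk, sub_zero, smul_eq_mul]
  ring

lemma HasExpansion.summable_norm (hg : HasExpansion g G) (z : ℂ) :
    Summable fun n => ‖coeff n g * z ^ n‖ := (hg z).summable.norm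

lemma HasExpansion.hasFPowerSeriesOnBall (hg : HasExpansion g G) :
    HasFPowerSeriesOnBall G (FormalMultilinearSeries.ofScalars ℂ fun n => coeff n g) 0 ⊤ where
  r_le := by
    rw [FormalMultilinearSeries.radius_eq_top_of_summable_norm]
    intro r
    have := hg.summable_norm (r : ℂ)
    simpa [FormalMultilinearSeries.ofScalars_norm] using this
  r_pos := by simp
  hasSum := fun {y} _ => by
    simpa [FormalMultilinearSeries.ofScalars_apply_eq, mul_comm] using hg y

lemma HasExpansion.differentiable (hg : HasExpansion g G) : Differentiable ℂ G := by
  have := hg.hasFPowerSeriesOnBall.differentiableOn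
  simpa [differentiableOn_univ] using this

lemma HasExpansion.eq_taylorAtZero (hg : HasExpansion g G) : g = taylorAtZero G := by
  have h1 := hg.hasFPowerSeriesOnBall.hasFPowerSeriesAt
  have h2 := (hg.differentiable.analyticAt 0).hasFPowerSeriesAt
  have := h1.eq_formalMultilinearSeries h2
  rw [FormalMultilinearSeries.ofScalars_series_eq_iff] at this
  ext n
  simpa [taylorAtZero] using congr_fun this n

lemma HasExpansion.unique (hg : HasExpansion g G) (hh : HasExpansion h G) : g = h :=
  hg.eq_taylorAtZero.trans hh.eq_taylorAtZero.symm

lemma HasExpansion.unique_fun (hg : HasExpansion g G) (hh : HasExpansion g H) : G = H :=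
  funext fun z => (hg z).unique (hh z)

lemma HasExpansion.add (hg : HasExpansion g G) (hh : HasExpansion h H) :
    HasExpansion (g + h) (G + H) := fun z => by
  simpa [add_mul] using (hg z).add (hh z)

lemma HasExpansion.mul (hg : HasExpansion g G) (hh : HasExpansion h H) :
    HasExpansion (g * h) (G * H) := fun z => by
  have h1 := hg.summable_norm z
  have h2 := hh.summable_norm z
  have h3 := tsum_mul_tsum_eq_tsum_sum_antidiagonal_of_summable_norm h1 h2
  have h4 := (summable_norm_sum_mul_antidiagonal_of_summable_norm h1 h2).of_norm.hasSum
  rw [← h3, (hg z).tsum_eq, (hh z).tsum_eq] at h4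
  have h5 : (fun n => coeff n (g * h) * z ^ n) = fun n => ∑ p ∈ Finset.HasAntidiagonal.antidiagonal n,
      coeff p.1 g * z ^ p.1 * (coeff p.2 h * z ^ p.2) := by
    ext n
    rw [PowerSeries.coeff_mul, Finset.sum_mul]
    refine Finset.sum_congr rfl fun p hp => ?_
    rw [← Finset.HasAntidiagonal.mem_antidiagonal.1 hp, pow_add]
    ring
  rw [h5]
  exact h4

lemma hasExpansion_C (c : ℂ) : HasExpansion (C c) fun _ => c := fun z => by
  have : (fun n => coeff n (C c) * z ^ n) = fun n => if n = 0 then c else 0 := by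
    ext n
    rw [coeff_C]
    split_ifs with h <;> simp [h]
  rw [this]
  exact hasSum_ite_eq 0 c

lemma hasExpansion_X : HasExpansion X id := fun z => by
  have : (fun n => coeff n (X : ℂ⟦X⟧) * z ^ n) = fun n => if n = 1 then z else 0 := by
    ext n
    rw [coeff_X]
    split_ifs with h <;> simp [h]
  rw [this]
  exact hasSum_ite_eq 1 z

lemma hasExpansion_one : HasExpansion 1 1 := by simpa using! hasExpansion_C 1

lemma hasExpansion_pow (hg : HasExpansion g G) (n : ℕ) : HasExpansion (g ^ n) (G ^ n) := by
  induction n with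
  | zero => simpa using hasExpansion_one
  | succ n ih => simpa [pow_succ] using ih.mul hg

lemma hasExpansion_coe (p : Polynomial ℂ) : HasExpansion (p : ℂ⟦X⟧) fun z => p.eval z := by
  induction p using Polynomial.induction_on' with
  | add p q hp hq => simpa [Polynomial.coe_add] using! hp.add hq
  | monomial n a =>
    have := (hasExpansion_C a).mul (hasExpansion_pow hasExpansion_X n)
    rw [← Polynomial.C_mul_X_pow_eq_monomial, Polynomial.coe_mul, Polynomial.coe_pow,
      Polynomial.coe_C, Polynomial.coe_X]
    convert! this using 1
    ext z
    simp

lemma HasExpansion.derivative (hg : HasExpansion g G) :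
    HasExpansion (derivative ℂ g) (deriv G) := by
  have h1 : Differentiable ℂ (deriv G) := by
    have := hg.differentiable.contDiff (n := 2)
    exact ((contDiff_succ_iff_deriv (n := 1)).1 this).2.2.differentiable (by simp)
  convert! hasExpansion_taylorAtZero h1 using 1
  rw [hg.eq_taylorAtZero]
  ext n
  simp only [taylorAtZero, coeff_derivative, coeff_mk, ← iteratedDeriv_succ',
    Nat.factorial_succ, Nat.cast_mul]
  have : (n ! : ℂ) ≠ 0 := by exact_mod_cast n.factorial_ne_zero
  have : (n : ℂ) + 1 ≠ 0 := by exact_mod_cast n.succ_ne_zero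
  push_cast
  field_simp

lemma HasExpansion.constantCoeff (hg : HasExpansion g G) : constantCoeff g = G 0 := by
  rw [← coeff_zero_eq_constantCoeff_apply]
  simp [hg.eq_taylorAtZero, taylorAtZero]

end Expansion

section EFunctions
variable {K : Type*} [Field K] [Algebra K ℂ]

/-- The function on `ℂ` defined by a power series over `K`. -/
def toFun (f : K⟦X⟧) (z : ℂ) : ℂ := ∑' n, coeff n (map (algebraMap K ℂ) f) * z ^ n

lemma EBound.hasExpansion {f : K⟦X⟧} (hf : EBound f) :
    HasExpansion (map (algebraMap K ℂ) f) (toFun f) := fun z => by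
  obtain ⟨⟨C, hC, h⟩, -⟩ := hf
  refine Summable.hasSum (Summable.of_norm_bounded
    (g := fun n => C * ((C * ‖z‖) ^ n / n !)) ((Real.summable_pow_div_factorial _).mul_left C)
    fun n => ?_)
  have h1 := h (algebraMap K ℂ) n
  have hn : (0 : ℝ) < n ! := by exact_mod_cast n.factorial_pos
  rw [map_mul, map_natCast, norm_mul, Complex.norm_natCast] at h1
  rw [coeff_map, norm_mul, norm_pow, ← mul_div_assoc, le_div_iff₀ hn]
  calc ‖algebraMap K ℂ (coeff n f)‖ * ‖z‖ ^ n * n !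
      = (n ! * ‖algebraMap K ℂ (coeff n f)‖) * ‖z‖ ^ n := by ring
    _ ≤ C ^ (n + 1) * ‖z‖ ^ n := by gcongr
    _ = C * (C * ‖z‖) ^ n := by rw [mul_pow, pow_succ]; ring

lemma HasExpansion.toFun_eq {f : K⟦X⟧} {G : ℂ → ℂ}
    (h : HasExpansion (map (algebraMap K ℂ) f) G) : toFun f = G :=
  funext fun z => (h z).tsum_eq

lemma toFun_add {f g : K⟦X⟧} (hf : EBound f) (hg : EBound g) :
    toFun (f + g) = toFun f + toFun g :=
  HasExpansion.toFun_eq (by simpa using hf.hasExpansion.add hg.hasExpansion)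

lemma toFun_mul {f g : K⟦X⟧} (hf : EBound f) (hg : EBound g) :
    toFun (f * g) = toFun f * toFun g :=
  HasExpansion.toFun_eq (by simpa using hf.hasExpansion.mul hg.hasExpansion)

lemma map_coe_polynomial (p : Polynomial K) : map (algebraMap K ℂ) (p : K⟦X⟧) =
    ((p.map (algebraMap K ℂ) : Polynomial ℂ) : ℂ⟦X⟧) := by
  ext n
  simp

lemma toFun_coe (p : Polynomial K) :
    toFun (p : K⟦X⟧) = fun z => (p.map (algebraMap K ℂ)).eval z :=
  HasExpansion.toFun_eq (by rw [map_coe_polynomial]; exact hasExpansion_coe _)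

lemma toFun_derivative {f : K⟦X⟧} (hf : EBound f) :
    toFun (derivative K f) = deriv (toFun f) :=
  HasExpansion.toFun_eq (by
    convert! hf.hasExpansion.derivative using 1
    ext n
    simp [coeff_derivative])

lemma toFun_injective {f g : K⟦X⟧} (hf : EBound f) (hg : EBound g) (h : toFun f = toFun g) :
    f = g := by
  have := hf.hasExpansion.unique (h ▸ hg.hasExpansion)
  exact PowerSeries.map_injective _ (algebraMap K ℂ).injective this

lemma hasExpansion_expand {f : K⟦X⟧} (hf : EBound f) (α : ℂ) :
    HasExpansion (taylorAtZero fun z => toFun f (α + z)) fun z => toFun f (α + z) :=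
  hasExpansion_taylorAtZero (hf.hasExpansion.differentiable.comp (differentiable_id.const_add α))

variable [NumberField K]

/-- The expansion of an E-function at `α`. -/
def expand (α : ℂ) : eAlg K →+* ℂ⟦X⟧ where
  toFun f := taylorAtZero fun z => EFun.toFun (f : K⟦X⟧) (α + z)
  map_one' := by
    refine HasExpansion.unique (hasExpansion_expand (one_mem (eAlg K)) α) ?_
    have := toFun_coe (1 : Polynomial K)
    simp only [Polynomial.coe_one, Polynomial.map_one, Polynomial.eval_one] at this
    simp only [this]
    exact hasExpansion_one
  map_mul' f g := by
    refine HasExpansion.unique (hasExpansion_expand (mul_mem f.2 g.2) α) ?_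
    have := toFun_mul (K := K) f.2 g.2
    convert! (hasExpansion_expand f.2 α).mul (hasExpansion_expand g.2 α) using 1
    ext z
    exact congr_fun this _
  map_zero' := by
    refine HasExpansion.unique (hasExpansion_expand (zero_mem (eAlg K)) α) ?_
    have := toFun_coe (0 : Polynomial K)
    simp only [Polynomial.coe_zero, Polynomial.map_zero, Polynomial.eval_zero] at this
    simp only [this]
    simpa using hasExpansion_C 0
  map_add' f g := by
    refine HasExpansion.unique (hasExpansion_expand (add_mem f.2 g.2) α) ?_
    have := toFun_add (K := K) f.2 g.2
    convert! (hasExpansion_expand f.2 α).add (hasExpansion_expand g.2 α) using 1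
    ext z
    exact congr_fun this _

lemma hasExpansion_expand' (α : ℂ) (f : eAlg K) :
    HasExpansion (expand α f) fun z => toFun (f : K⟦X⟧) (α + z) := hasExpansion_expand f.2 α

lemma constantCoeff_expand (α : ℂ) (f : eAlg K) :
    constantCoeff (expand α f) = toFun (f : K⟦X⟧) α := by
  simpa using (hasExpansion_expand' α f).constantCoeff

lemma expand_injective (α : ℂ) : Function.Injective (expand α : eAlg K →+* ℂ⟦X⟧) := fun f g h => by
  have h1 := hasExpansion_expand' α f
  rw [h] at h1
  have h2 := h1.unique_fun (hasExpansion_expand' α g)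
  refine Subtype.ext (toFun_injective f.2 g.2 (funext fun z => ?_))
  simpa using congr_fun h2 (z - α)

lemma expand_derivative (α : ℂ) (f : eAlg K) :
    expand α ⟨derivative K (f : K⟦X⟧), f.2.derivative⟩ = derivative ℂ (expand α f) := by
  refine (hasExpansion_expand' α _).unique ?_
  convert! (hasExpansion_expand' α f).derivative using 1
  ext z
  dsimp only
  rw [toFun_derivative f.2, deriv_comp_const_add]

/-- Polynomials as E-functions. -/
def polyE : Polynomial K →+* eAlg K where
  toFun p := ⟨p, coe_polynomial_mem_eAlg p⟩
  map_one' := Subtype.ext Polynomial.coe_one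
  map_mul' p q := Subtype.ext (Polynomial.coe_mul p q)
  map_zero' := Subtype.ext Polynomial.coe_zero
  map_add' p q := Subtype.ext (Polynomial.coe_add p q)

lemma coe_polyE (p : Polynomial K) : (polyE p : K⟦X⟧) = p := rfl

lemma expand_polyE (α : ℂ) (p : Polynomial K) :
    expand α (polyE p) = shift α (p.map (algebraMap K ℂ)) := by
  refine (hasExpansion_expand' α _).unique ?_
  rw [shift_apply]
  convert! hasExpansion_coe _ using 1
  ext z
  rw [coe_polyE, toFun_coe, Polynomial.taylor_eval, add_comm]

end EFunctions

section PolynomialGrowth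
open Filter Topology

/-- An entire function of polynomial growth is a polynomial. -/
lemma exists_polynomial_of_growth {R : ℂ → ℂ} (hR : Differentiable ℂ R) {C : ℝ} {k : ℕ}
    (hb : ∀ z, ‖R z‖ ≤ C * (1 + ‖z‖) ^ k) : ∃ r : Polynomial ℂ, ∀ z, R z = r.eval z := by
  have hC : 0 ≤ C := by simpa using (norm_nonneg _).trans (hb 0)
  have h0 : ∀ n, k < n → iteratedDeriv n R 0 = 0 := by
    intro n hn
    rw [← norm_le_zero_iff]
    have hlim : Tendsto (fun ρ : ℝ => n ! * C * 2 ^ k / ρ) atTop (𝓝 0) :=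
      tendsto_const_nhds.div_atTop tendsto_id
    refine ge_of_tendsto hlim ?_
    filter_upwards [eventually_ge_atTop 1] with ρ hρ
    have hρ0 : 0 < ρ := by linarith
    refine (Complex.norm_iteratedDeriv_le_of_forall_mem_sphere_norm_le n hρ0 hR.diffContOnCl
      (C := C * (2 * ρ) ^ k) fun z hz => (hb z).trans ?_).trans ?_
    · rw [mem_sphere_zero_iff_norm.1 hz]
      gcongr
      linarith
    · rw [div_le_div_iff₀ (by positivity) hρ0, mul_pow]
      have : ρ ^ k * ρ ≤ ρ ^ n := by
        rw [← pow_succ]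
        exact pow_le_pow_right₀ hρ hn
      calc (n ! : ℝ) * (C * (2 ^ k * ρ ^ k)) * ρ = n ! * C * 2 ^ k * (ρ ^ k * ρ) := by ring
        _ ≤ n ! * C * 2 ^ k * ρ ^ n := by gcongr
  refine ⟨trunc (k + 1) (taylorAtZero R), fun z => ?_⟩
  have h1 := hasExpansion_taylorAtZero hR
  have h2 : taylorAtZero R = ((trunc (k + 1) (taylorAtZero R) : Polynomial ℂ) : ℂ⟦X⟧) := by
    ext n
    rw [Polynomial.coeff_coe, coeff_trunc]
    split_ifs with h
    · rfl
    · simp [taylorAtZero, h0 n (by omega)]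
  have h3 := hasExpansion_coe (trunc (k + 1) (taylorAtZero R))
  rw [← h2] at h3
  exact (h1 z).unique (h3 z)

/-- If `P = O((1+|z|)^k Q)` for entire `P`, `Q`, then `P` is a polynomial multiple of `Q`. -/
lemma exists_polynomial_mul_eq {P Q : ℂ → ℂ} (hP : Differentiable ℂ P) (hQ : Differentiable ℂ Q)
    {z₁ : ℂ} (hQ1 : Q z₁ ≠ 0) {C : ℝ} {k : ℕ}
    (hb : ∀ z, ‖P z‖ ≤ C * (1 + ‖z‖) ^ k * ‖Q z‖) :
    ∃ r : Polynomial ℂ, ∀ z, P z = r.eval z * Q z := by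
  have hC : 0 ≤ C := by
    have h1 := (norm_nonneg _).trans (hb z₁)
    have h2 : 0 < ‖Q z₁‖ := norm_pos_iff.2 hQ1
    have h3 : 0 < (1 + ‖z₁‖) ^ k := by positivity
    exact nonneg_of_mul_nonneg_left (nonneg_of_mul_nonneg_left h1 h2) h3
  have hev : ∀ z₀, ∀ᶠ z in 𝓝[≠] z₀, Q z ≠ 0 := by
    intro z₀
    rcases (hQ.analyticAt z₀).eventually_eq_zero_or_eventually_ne_zero with h | h
    · exfalso
      have := AnalyticOnNhd.eq_of_eventuallyEq (f := Q) (g := 0) (z₀ := z₀)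
        (fun z _ => hQ.analyticAt z) (fun z _ => analyticAt_const) h
      exact hQ1 (congr_fun this z₁)
    · exact h
  have hq : ∀ z, Q z ≠ 0 → DifferentiableAt ℂ (fun w => P w / Q w) z := fun z hz =>
    (hP z).div (hQ z) hz
  let R : ℂ → ℂ := fun z => limUnder (𝓝[≠] z) fun w => P w / Q w
  have hRq : ∀ z, Q z ≠ 0 → R z = P z / Q z := fun z hz =>
    ((hq z hz).continuousAt.tendsto.mono_left nhdsWithin_le_nhds).limUnder_eq
  have hqb : ∀ z, Q z ≠ 0 → ‖P z / Q z‖ ≤ C * (1 + ‖z‖) ^ k := fun z hz => by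
    rw [norm_div, div_le_iff₀ (norm_pos_iff.2 hz)]
    exact hb z
  have hRd : Differentiable ℂ R := by
    intro z₀
    obtain ⟨ε, hε, hball⟩ := Metric.mem_nhdsWithin_iff.1 (hev z₀)
    have hs : Metric.ball z₀ (min ε 1) ∈ 𝓝 z₀ := Metric.ball_mem_nhds _ (by positivity)
    have hne : ∀ z ∈ Metric.ball z₀ (min ε 1) \ {z₀}, Q z ≠ 0 := fun z hz =>
      hball ⟨Metric.ball_subset_ball (min_le_left _ _) hz.1, hz.2⟩
    have h1 := Complex.differentiableOn_update_limUnder_of_bddAbove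
      (f := fun w => P w / Q w) hs
      (fun z hz => (hq z (hne z hz)).differentiableWithinAt)
      ⟨C * (1 + (‖z₀‖ + 1)) ^ k, by
        rintro _ ⟨z, hz, rfl⟩
        refine (hqb z (hne z hz)).trans ?_
        have h2 : ‖z‖ ≤ ‖z₀‖ + 1 := by
          have h3 : ‖z - z₀‖ < 1 := by
            rw [← dist_eq_norm]
            exact (Metric.mem_ball.1 hz.1).trans_le (min_le_right _ _)
          have h4 := norm_le_norm_add_norm_sub' z z₀
          linarith
        gcongr⟩
    refine (h1.differentiableAt hs).congr_of_eventuallyEq ?_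
    filter_upwards [hs] with z hz
    by_cases hzz : z = z₀
    · subst hzz
      simp [R]
    · rw [Function.update_of_ne hzz]
      exact hRq z (hne z ⟨hz, hzz⟩)
  have hRb : ∀ z, ‖R z‖ ≤ C * (1 + ‖z‖) ^ k := by
    intro z
    have h1 : Tendsto (fun w => ‖R w‖) (𝓝[≠] z) (𝓝 ‖R z‖) :=
      (hRd z).continuousAt.norm.tendsto.mono_left nhdsWithin_le_nhds
    have h2 : Tendsto (fun w : ℂ => C * (1 + ‖w‖) ^ k) (𝓝[≠] z) (𝓝 (C * (1 + ‖z‖) ^ k)) :=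
      (Continuous.tendsto (by fun_prop) z).mono_left nhdsWithin_le_nhds
    refine le_of_tendsto_of_tendsto h1 h2 ?_
    filter_upwards [hev z] with w hw
    rw [hRq w hw]
    exact hqb w hw
  obtain ⟨r, hr⟩ := exists_polynomial_of_growth hRd hRb
  refine ⟨r, fun z => ?_⟩
  by_cases hz : Q z = 0
  · have := hb z
    rw [hz, norm_zero, mul_zero, norm_le_zero_iff] at this
    rw [this, hz, mul_zero]
  · rw [← hr, hRq z hz, div_mul_cancel₀ _ hz]

lemma norm_eval_le (p : Polynomial ℂ) {k : ℕ} (hk : p.natDegree ≤ k) (z : ℂ) :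
    ‖p.eval z‖ ≤ (∑ i ∈ p.support, ‖p.coeff i‖) * (1 + ‖z‖) ^ k := by
  rw [Polynomial.eval_eq_sum, Polynomial.sum, Finset.sum_mul]
  refine (norm_sum_le _ _).trans (Finset.sum_le_sum fun i hi => ?_)
  rw [norm_mul, norm_pow]
  have h1 : (1 : ℝ) ≤ 1 + ‖z‖ := by linarith [norm_nonneg z]
  have h2 : ‖z‖ ^ i ≤ (1 + ‖z‖) ^ i := by gcongr; linarith
  have h3 := pow_le_pow_right₀ h1 ((Polynomial.le_natDegree_of_mem_supp i hi).trans hk)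
  gcongr
  exact h2.trans h3

lemma norm_le_of_monic_relation {n : ℕ} (c : Fin n → ℂ) (p q : ℂ)
    (h : p ^ n + ∑ i : Fin n, c i * p ^ (i : ℕ) * q ^ (n - i) = 0) :
    ‖p‖ ≤ (1 + ∑ i, ‖c i‖) * ‖q‖ := by
  have hS : 0 ≤ ∑ i, ‖c i‖ := Finset.sum_nonneg fun _ _ => norm_nonneg _
  by_contra! hlt
  have hqp : ‖q‖ < ‖p‖ := lt_of_le_of_lt (by nlinarith [norm_nonneg q]) hlt
  have hp : 0 < ‖p‖ := (norm_nonneg _).trans_lt hqp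
  rcases n with _ | n
  · simp at h
  have h1 : ‖p‖ ^ (n + 1) ≤ ∑ i, ‖c i‖ * (‖p‖ ^ n * ‖q‖) := by
    rw [← norm_pow, eq_neg_of_add_eq_zero_left h, norm_neg]
    refine (norm_sum_le _ _).trans (Finset.sum_le_sum fun i _ => ?_)
    rw [norm_mul, norm_mul, norm_pow, norm_pow, mul_assoc]
    have hi : n + 1 - (i : ℕ) = (n - i) + 1 := by omega
    have hn : ‖p‖ ^ n = ‖p‖ ^ (i : ℕ) * ‖p‖ ^ (n - i) := by rw [← pow_add]; congr 1; omega
    rw [hi, pow_succ, ← mul_assoc (‖p‖ ^ (i : ℕ)), hn]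
    gcongr
  rw [← Finset.sum_mul] at h1
  have h2 : ‖p‖ ^ n * ‖p‖ ≤ ‖p‖ ^ n * ((∑ i, ‖c i‖) * ‖q‖) := by
    rw [← pow_succ]; linarith
  have h3 := le_of_mul_le_mul_left h2 (by positivity)
  nlinarith [norm_nonneg q]

end PolynomialGrowth

section AlgebraicallyClosed
variable {K : Type*} [Field K] [Algebra K ℂ] [NumberField K]

/-- A quotient of E-functions which is integral over `K[z]` is a polynomial. -/
lemma exists_polyE_mul_eq {p q : eAlg K} (hq : q ≠ 0) {n : ℕ} (c : Fin n → Polynomial K)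
    (h : p ^ n + ∑ i : Fin n, polyE (c i) * p ^ (i : ℕ) * q ^ (n - i) = 0) :
    ∃ r : Polynomial K, p = polyE r * q := by
  let c' : Fin n → Polynomial ℂ := fun i => (c i).map (algebraMap K ℂ)
  let k : ℕ := Finset.univ.sup fun i => (c' i).natDegree
  have hk : ∀ i, (c' i).natDegree ≤ k := fun i =>
    Finset.le_sup (f := fun i => (c' i).natDegree) (Finset.mem_univ i)
  have hz : ∀ z, toFun (p : K⟦X⟧) z ^ n + ∑ i : Fin n, (c' i).eval z *
      toFun (p : K⟦X⟧) z ^ (i : ℕ) * toFun (q : K⟦X⟧) z ^ (n - i) = 0 := by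
    intro z
    have := congr_arg (fun x => constantCoeff (expand z x)) h
    simpa [c', map_sum, constantCoeff_expand, expand_polyE, constantCoeff_shift] using this
  obtain ⟨z₁, hz1⟩ : ∃ z₁, toFun (q : K⟦X⟧) z₁ ≠ 0 := by
    by_contra! hall
    refine hq (Subtype.ext (toFun_injective q.2 (zero_mem (eAlg K)) (funext fun z => ?_)))
    rw [hall]
    have := congr_fun (toFun_coe (0 : Polynomial K)) z
    simpa using this.symm
  obtain ⟨r, hr⟩ := exists_polynomial_mul_eq (p.2.hasExpansion.differentiable)
    (q.2.hasExpansion.differentiable) hz1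
    (C := 1 + ∑ i, ∑ l ∈ (c' i).support, ‖(c' i).coeff l‖) (k := k) (fun z => by
      refine (norm_le_of_monic_relation _ _ _ (hz z)).trans ?_
      have h1 : (1 : ℝ) ≤ (1 + ‖z‖) ^ k := one_le_pow₀ (by linarith [norm_nonneg z])
      gcongr
      rw [add_mul, Finset.sum_mul, one_mul]
      exact add_le_add h1 (Finset.sum_le_sum fun i _ => norm_eval_le _ (hk i) z))
  have hps : map (algebraMap K ℂ) (p : K⟦X⟧) = (r : ℂ⟦X⟧) * map (algebraMap K ℂ) (q : K⟦X⟧) := by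
    refine p.2.hasExpansion.unique ?_
    convert! (hasExpansion_coe r).mul q.2.hasExpansion using 1
    ext z
    exact hr z
  obtain ⟨π, hπ⟩ := (Algebra.linearMap K ℂ).exists_leftInverse_of_injective
    (LinearMap.ker_eq_bot.2 (algebraMap K ℂ).injective)
  have hπ' : ∀ x : K, π (algebraMap K ℂ x) = x := fun x => LinearMap.congr_fun hπ x
  obtain ⟨r', hc⟩ : ∃ r' : Polynomial K, ∀ m, r'.coeff m = π (r.coeff m) := by
    refine ⟨∑ i ∈ r.support, Polynomial.monomial i (π (r.coeff i)), fun m => ?_⟩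
    simp only [Polynomial.finsetSum_coeff, Polynomial.coeff_monomial, Finset.sum_ite_eq',
      Polynomial.mem_support_iff]
    split_ifs with hm
    · rfl
    · rw [not_not.1 hm, map_zero]
  refine ⟨r', Subtype.ext ?_⟩
  ext m
  have h1 := congr_arg π (congr_arg (coeff m) hps)
  simp only [coeff_map, PowerSeries.coeff_mul, Polynomial.coeff_coe, map_sum, hπ'] at h1
  change coeff m (p : K⟦X⟧) = coeff m ((r' : K⟦X⟧) * (q : K⟦X⟧))
  rw [h1, PowerSeries.coeff_mul]
  refine Finset.sum_congr rfl fun x _ => ?_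
  rw [Polynomial.coeff_coe, hc, mul_comm, ← Algebra.smul_def, map_smul, smul_eq_mul, mul_comm]

end AlgebraicallyClosed

end EFun

namespace EFun
open Matrix TensorProduct

section TensorDomain
variable {E F : Type*} [Field E] [Field F] [Algebra E F]

lemma natDegree_minpoly_le (hcl : ∀ x : F, IsIntegral E x → x ∈ (algebraMap E F).range)
    {Ω : Type*} [Field Ω] [Algebra F Ω] [Algebra E Ω] [IsScalarTower E F Ω] {γ : Ω}
    (hγ : IsIntegral E γ) : (minpoly E γ).natDegree ≤ (minpoly F γ).natDegree := by
  have hγF : IsIntegral F γ := hγ.tower_top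
  have h1 := integralClosure.mem_lifts_of_monic_of_dvd_map F (minpoly.monic hγ)
    (minpoly.monic hγF) (minpoly.dvd_map_of_isScalarTower E F γ)
  rw [Polynomial.lifts_iff_coeff_lifts] at h1
  have h2 : minpoly F γ ∈ Polynomial.lifts (algebraMap E F) := by
    rw [Polynomial.lifts_iff_coeff_lifts]
    intro n
    obtain ⟨y, hy⟩ := h1 n
    exact hcl _ (hy ▸ y.2)
  obtain ⟨g, hg, hgd, hgm⟩ := Polynomial.lifts_and_natDegree_eq_and_monic h2 (minpoly.monic hγF)
  rw [← hgd]
  refine Polynomial.natDegree_le_of_dvd (minpoly.dvd E γ ?_) hgm.ne_zero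
  have := minpoly.aeval F γ
  rwa [← hg, Polynomial.aeval_map_algebraMap] at this

variable [CharZero E]

lemma eq_zero_of_sum_mul_eq_zero (hcl : ∀ x : F, IsIntegral E x → x ∈ (algebraMap E F).range)
    {Ω : Type*} [Field Ω] [Algebra F Ω] [Algebra E Ω] [IsScalarTower E F Ω]
    {E' : Type*} [Field E'] [Algebra E E'] [FiniteDimensional E E'] (φ : E' →ₐ[E] Ω)
    {ι : Type*} {b : ι → F} (hb : LinearIndependent E b) (s : Finset ι) (c : ι → E')
    (h : ∑ i ∈ s, φ (c i) * algebraMap F Ω (b i) = 0) : ∀ i ∈ s, c i = 0 := by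
  let A : IntermediateField E Ω := φ.fieldRange
  have : FiniteDimensional E A :=
    (AlgEquiv.ofInjectiveField φ).toLinearEquiv.finiteDimensional
  let pb := Field.powerBasisOfFiniteOfSeparable E A
  have hγ : IsIntegral E (pb.gen : Ω) := (Algebra.IsIntegral.isIntegral pb.gen).map A.val
  have hd : A.LinearDisjoint F := by
    refine IntermediateField.LinearDisjoint.of_basis_left pb.basis ?_
    have h1 := linearIndependent_pow (K := F) (pb.gen : Ω)
    have h2 : pb.dim ≤ (minpoly F (pb.gen : Ω)).natDegree := by
      rw [← pb.natDegree_minpoly]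
      convert natDegree_minpoly_le hcl hγ using 2
      exact (minpoly.algebraMap_eq (algebraMap A Ω).injective pb.gen).symm
    convert h1.comp (Fin.castLE h2) (Fin.castLE_injective h2) using 1
    ext i
    simp
  have h3 := hd.linearIndependent_right' hb
  rw [linearIndependent_iff'] at h3
  intro i hi
  have h4 := h3 s (fun i => (⟨φ (c i), c i, rfl⟩ : A)) (by
    rw [← h]
    refine Finset.sum_congr rfl fun i _ => ?_
    rw [Algebra.smul_def]
    rfl) i hi
  have h5 : φ (c i) = 0 := congr_arg Subtype.val h4
  exact (map_eq_zero φ).1 h5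

lemma exists_isMaximal_notMem {A : Type*} [CommRing A] [IsDomain A] [IsJacobsonRing A] {c : A}
    (hc : c ≠ 0) : ∃ m : Ideal A, m.IsMaximal ∧ c ∉ m := by
  have h1 : (⊥ : Ideal A).jacobson = ⊥ :=
    IsJacobsonRing.out inferInstance (Ideal.IsPrime.isRadical Ideal.isPrime_bot)
  by_contra! h
  apply hc
  rw [← Ideal.mem_bot, ← h1, Ideal.jacobson, Ideal.mem_sInf]
  intro I hI
  exact h I hI.2

/-- If `E` is algebraically closed in `F`, then `L ⊗ F` is a domain for every extension `L`. -/
theorem isDomain_tensorProduct (hcl : ∀ x : F, IsIntegral E x → x ∈ (algebraMap E F).range)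
    (L : Type*) [Field L] [Algebra E L] : IsDomain (L ⊗[E] F) := by
  have : NoZeroDivisors (L ⊗[E] F) := by
    refine ⟨fun {x y} hxy => ?_⟩
    by_contra! hne
    obtain ⟨hx, hy⟩ := hne
    let B := Module.Basis.ofVectorSpace E F
    let BL := B.baseChange L
    obtain ⟨i₀, hi⟩ : ∃ i, BL.repr x i ≠ 0 := by
      by_contra! h
      exact hx (BL.repr.map_eq_zero_iff.1 (Finsupp.ext h))
    obtain ⟨j₀, hj⟩ : ∃ i, BL.repr y i ≠ 0 := by
      by_contra! h
      exact hy (BL.repr.map_eq_zero_iff.1 (Finsupp.ext h))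
    classical
    let S : Finset L := (BL.repr x).support.image (BL.repr x) ∪ (BL.repr y).support.image (BL.repr y)
    let A : Subalgebra E L := Algebra.adjoin E (S : Set L)
    have hft : Algebra.FiniteType E A := (Subalgebra.fg_iff_finiteType A).1 ⟨S, rfl⟩
    have hjac : IsJacobsonRing A := isJacobsonRing_of_finiteType (A := E)
    have hxA : ∀ i, BL.repr x i ∈ A := fun i => by
      by_cases h : BL.repr x i = 0
      · rw [h]; exact zero_mem _
      · exact Algebra.subset_adjoin (Finset.mem_union_left _
          (Finset.mem_image_of_mem _ (Finsupp.mem_support_iff.2 h)))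
    have hyA : ∀ i, BL.repr y i ∈ A := fun i => by
      by_cases h : BL.repr y i = 0
      · rw [h]; exact zero_mem _
      · exact Algebra.subset_adjoin (Finset.mem_union_right _
          (Finset.mem_image_of_mem _ (Finsupp.mem_support_iff.2 h)))
    obtain ⟨m, hm, hc⟩ := exists_isMaximal_notMem (A := A)
      (c := ⟨_, hxA i₀⟩ * ⟨_, hyA j₀⟩) (fun h => by
        rcases mul_eq_zero.1 (congr_arg Subtype.val h) with h | h
        · exact hi h
        · exact hj h)
    let E' := A ⧸ m
    let : Field E' := Ideal.Quotient.field m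
    have : Algebra.FiniteType E E' :=
      hft.of_surjective (Ideal.Quotient.mkₐ E m) (Ideal.Quotient.mkₐ_surjective E m)
    have : Module.Finite E E' := finite_of_finite_type_of_isJacobsonRing E E'
    let Ω := AlgebraicClosure F
    let φ : E' →ₐ[E] Ω := IsAlgClosed.lift
    let ψ : A →ₐ[E] Ω := φ.comp (Ideal.Quotient.mkₐ E m)
    let Θ : A ⊗[E] F →ₐ[E] Ω := Algebra.TensorProduct.lift ψ (IsScalarTower.toAlgHom E F Ω)
      fun _ _ => Commute.all _ _
    let Λ : A ⊗[E] F →ₐ[E] L ⊗[E] F := Algebra.TensorProduct.map A.val (AlgHom.id E F)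
    have hΛ : Function.Injective Λ :=
      Module.Flat.rTensor_preserves_injective_linearMap A.val.toLinearMap Subtype.val_injective
    have lift : ∀ z : L ⊗[E] F, ∀ hz : ∀ i, BL.repr z i ∈ A, ∃ z' : A ⊗[E] F, Λ z' = z ∧
        (Θ z' = 0 → ∀ i, (⟨_, hz i⟩ : A) ∈ m) := by
      intro z hz
      refine ⟨∑ i ∈ (BL.repr z).support, (⟨_, hz i⟩ : A) ⊗ₜ B i, ?_, fun h i => ?_⟩
      · rw [map_sum]
        conv_rhs => rw [← BL.linearCombination_repr z, Finsupp.linearCombination_apply,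
          Finsupp.sum]
        refine Finset.sum_congr rfl fun i _ => ?_
        simp [Λ, BL, Module.Basis.baseChange_apply, TensorProduct.smul_tmul']
      · by_cases h0 : BL.repr z i = 0
        · have : (⟨_, hz i⟩ : A) = 0 := Subtype.ext h0
          rw [this]; exact zero_mem _
        · rw [map_sum] at h
          have := eq_zero_of_sum_mul_eq_zero hcl φ B.linearIndependent (BL.repr z).support
            (fun i => Ideal.Quotient.mk m ⟨_, hz i⟩) (by
              rw [← h]
              refine Finset.sum_congr rfl fun i _ => ?_
              simp only [Θ, Algebra.TensorProduct.lift_tmul]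
              rfl) i (Finsupp.mem_support_iff.2 h0)
          exact Ideal.Quotient.eq_zero_iff_mem.1 this
    obtain ⟨x', hx1, hx2⟩ := lift x hxA
    obtain ⟨y', hy1, hy2⟩ := lift y hyA
    have h0 : x' * y' = 0 := hΛ (by rw [map_mul, hx1, hy1, hxy, map_zero])
    have h1 : Θ x' * Θ y' = 0 := by rw [← map_mul, h0, map_zero]
    rcases mul_eq_zero.1 h1 with h | h
    · exact hc (m.mul_mem_right _ (hx2 h i₀))
    · exact hc (m.mul_mem_left _ (hy2 h j₀))
  exact NoZeroDivisors.to_isDomain _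

end TensorDomain

end EFun

namespace EFun
open PowerSeries Matrix TensorProduct

section CommonDomain
variable {P H : Type*} [CommRing P] [CommRing H] [IsDomain P] [IsDomain H]

/-- The extension of an injective ring homomorphism to the fraction fields. -/
def fracMap (j : P →+* H) (hj : Function.Injective j) : FractionRing P →+* FractionRing H :=
  IsFractionRing.lift (g := (algebraMap H (FractionRing H)).comp j)
    ((IsFractionRing.injective H (FractionRing H)).comp hj)

lemma fracMap_algebraMap (j : P →+* H) (hj : Function.Injective j) (p : P) :
    fracMap j hj (algebraMap P (FractionRing P) p) = algebraMap H (FractionRing H) (j p) :=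
  IsFractionRing.lift_algebraMap _ _

/-- If elements of `Frac H` integral over `j P` lie in it up to denominators, then the fraction
field of `j P` is algebraically closed in the fraction field of `H`. -/
lemma mem_range_fracMap {j : P →+* H} (hj : Function.Injective j)
    (hcl : ∀ (p q : H), q ≠ 0 → ∀ (n : ℕ) (c : Fin n → P),
      p ^ n + ∑ i : Fin n, j (c i) * p ^ (i : ℕ) * q ^ (n - i) = 0 → ∃ r, p = j r * q)
    {x : FractionRing H} (hx : (fracMap j hj).IsIntegralElem x) : x ∈ (fracMap j hj).range := by
  let E := FractionRing P
  let F := FractionRing H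
  let : Algebra E F := (fracMap j hj).toAlgebra
  let : Algebra P F := ((algebraMap H F).comp j).toAlgebra
  have : IsScalarTower P E F :=
    IsScalarTower.of_algebraMap_eq fun p => (fracMap_algebraMap j hj p).symm
  have h1 : IsAlgebraic P x :=
    (IsFractionRing.isAlgebraic_iff P E F).2 (IsIntegral.isAlgebraic hx)
  obtain ⟨d, hd, g, hgm, hg⟩ := h1.exists_integral_multiple
  obtain ⟨p, q, hq, rfl⟩ := IsFractionRing.div_surjective (A := H) x
  have hq0 : q ≠ 0 := nonZeroDivisors.ne_zero hq
  have hq1 : algebraMap H F q ≠ 0 := by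
    rwa [Ne, IsFractionRing.to_map_eq_zero_iff]
  have hd1 : algebraMap H F (j d) ≠ 0 := by
    rw [Ne, IsFractionRing.to_map_eq_zero_iff]
    exact fun h => hd (hj (h.trans (map_zero _).symm))
  have hdx : d • (algebraMap H F p / algebraMap H F q)
      = algebraMap H F (j d * p) / algebraMap H F q := by
    rw [Algebra.smul_def, map_mul, mul_div_assoc]
    rfl
  rw [hdx, Polynomial.eval₂_eq_sum_range, Finset.sum_range_succ, hgm.coeff_natDegree] at hg
  obtain ⟨r, hr⟩ := hcl (j d * p) q hq0 g.natDegree (fun i => g.coeff i) (by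
    apply IsFractionRing.injective H F
    have h2 := congr_arg (· * algebraMap H F q ^ g.natDegree) hg
    rw [map_zero, map_add, map_sum]
    rw [zero_mul, map_one, one_mul, add_mul, ← mul_pow, div_mul_cancel₀ _ hq1, add_comm,
      Finset.sum_mul, Finset.sum_range] at h2
    rw [← h2, map_pow]
    congr 1
    refine Finset.sum_congr rfl fun i _ => ?_
    have hi : algebraMap H F q ^ g.natDegree
        = algebraMap H F q ^ (i : ℕ) * algebraMap H F q ^ (g.natDegree - i) := by
      rw [← pow_add]
      congr 1
      omega
    have hc : (algebraMap H F (j d * p) / algebraMap H F q) ^ (i : ℕ) * algebraMap H F q ^ (i : ℕ)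
        = algebraMap H F ((j d * p) ^ (i : ℕ)) := by
      rw [← mul_pow, div_mul_cancel₀ _ hq1, map_pow]
    rw [hi, ← mul_assoc]
    erw [mul_assoc (algebraMap P F _), hc]
    rw [map_mul, map_mul, map_pow (algebraMap H F) q]
    rfl)
  refine ⟨algebraMap P E r / algebraMap P E d, ?_⟩
  rw [map_div₀, fracMap_algebraMap, fracMap_algebraMap, div_eq_div_iff hd1 hq1, ← map_mul, ← hr,
    map_mul, mul_comm]

universe v w
/-- Two extensions of a domain `P`, one of which is algebraically closed over `P`, together in one
domain in which they are linearly disjoint. -/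
theorem exists_common_domain_of_closed {P : Type*} {H : Type v} {S : Type w} [CommRing P] [CommRing H] [CommRing S]
    [IsDomain P] [IsDomain H] [IsDomain S] [CharZero P] {j : P →+* H} (hj : Function.Injective j)
    (hcl : ∀ (p q : H), q ≠ 0 → ∀ (n : ℕ) (c : Fin n → P),
      p ^ n + ∑ i : Fin n, j (c i) * p ^ (i : ℕ) * q ^ (n - i) = 0 → ∃ r, p = j r * q)
    {τ : H →+* S} (hτ : Function.Injective τ) :
    ∃ (R : Type (max v w)) (_ : CommRing R) (_ : IsDomain R)
    (a : S →+* R) (b : H →+* R) (μ : R →+* FractionRing S),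
    (∀ p, a (τ (j p)) = b (j p)) ∧
    (∀ x, μ (a x) = algebraMap _ _ x) ∧ (∀ h, μ (b h) = algebraMap _ _ (τ h)) ∧
    ∀ (ι : Type) [Fintype ι] (y : ι → H),
      (∀ q : ι → P, ∑ i, j (q i) * y i = 0 → q = 0) →
      ∀ c : ι → S, ∑ i, a (c i) * b (y i) = 0 → c = 0 := by
  let E := FractionRing P
  let F := FractionRing H
  let L := FractionRing S
  let ρ : F →+* L := fracMap τ hτ
  have hρ : ∀ h, ρ (algebraMap _ _ h) = algebraMap _ _ (τ h) := fracMap_algebraMap τ hτ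
  let i : E →+* L := ρ.comp (fracMap j hj)
  have hi : ∀ p, i (algebraMap _ _ p) = algebraMap _ _ (τ (j p)) := fun p => by
    change ρ (fracMap j hj (algebraMap P _ p)) = _
    rw [fracMap_algebraMap]
    exact hρ _
  let : Algebra E F := (fracMap j hj).toAlgebra
  let : Algebra E L := i.toAlgebra
  have : CharZero E := charZero_of_injective_algebraMap (IsFractionRing.injective P E)
  have hdom : IsDomain (L ⊗[E] F) :=
    isDomain_tensorProduct (fun x hx => mem_range_fracMap hj hcl hx) L
  let ρ' : F →ₐ[E] L := { ρ with commutes' := fun r => rfl }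
  let μ : L ⊗[E] F →ₐ[E] L := Algebra.TensorProduct.lift (AlgHom.id E L) ρ' fun _ _ => .all _ _
  refine ⟨L ⊗[E] F, inferInstance, hdom,
    (Algebra.TensorProduct.includeLeft (R := E) (S := E) (A := L) (B := F) : L →+* L ⊗[E] F).comp
      (algebraMap S L),
    (Algebra.TensorProduct.includeRight (R := E) (A := L) (B := F) : F →+* L ⊗[E] F).comp
      (algebraMap H F), μ, fun p => ?_, fun x => ?_, fun h => ?_, ?_⟩
  · change (algebraMap S L _) ⊗ₜ[E] (1 : F) = (1 : L) ⊗ₜ[E] (algebraMap H F (j p))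
    rw [← hi, ← fracMap_algebraMap j hj]
    have h1 : i (algebraMap P E p) = (algebraMap P E p) • (1 : L) := by
      rw [Algebra.smul_def, mul_one]; rfl
    have h2 : fracMap j hj (algebraMap P E p) = (algebraMap P E p) • (1 : F) := by
      rw [Algebra.smul_def, mul_one]; rfl
    rw [h1, h2, TensorProduct.smul_tmul]
  · change μ (_ ⊗ₜ 1) = _
    simp [μ]
    rfl
  · change μ (1 ⊗ₜ _) = _
    simp only [μ, Algebra.TensorProduct.lift_tmul, map_one, one_mul]
    exact hρ h
  · intro ι _ y hy c hc
    have hlin : LinearIndependent E fun l => algebraMap H F (y l) := by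
      rw [Fintype.linearIndependent_iff]
      intro g hg
      obtain ⟨d, hd⟩ := IsLocalization.exist_integer_multiples_of_finite (nonZeroDivisors P) g
      choose q hq using hd
      have hd0 : algebraMap P E d ≠ 0 :=
        IsFractionRing.to_map_ne_zero_of_mem_nonZeroDivisors d.2
      have h1 := hy q (by
        apply IsFractionRing.injective H F
        rw [map_sum, map_zero, ← smul_zero (algebraMap P E d), ← hg, Finset.smul_sum]
        refine Finset.sum_congr rfl fun l _ => ?_
        rw [smul_smul, map_mul, ← fracMap_algebraMap j hj, hq, Algebra.smul_def, Algebra.smul_def]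
        rfl)
      intro l
      have h2 := hq l
      rw [h1, Pi.zero_apply, map_zero, Algebra.smul_def] at h2
      exact (mul_eq_zero.1 h2.symm).resolve_left hd0
    have : Module.Free E L := Module.Free.of_divisionRing E L
    have : Module.Flat E L := Module.Flat.of_free
    have h3 : LinearIndependent L fun l => (1 : L) ⊗ₜ[E] algebraMap H F (y l) :=
      Module.Flat.linearIndependent_one_tmul hlin
    rw [Fintype.linearIndependent_iff] at h3
    funext l
    have h4 := h3 (fun l => algebraMap _ _ (c l)) (by
      rw [← hc]
      refine Finset.sum_congr rfl fun l _ => ?_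
      rw [TensorProduct.smul_tmul']
      change _ = (algebraMap S L (c l)) ⊗ₜ[E] (1 : F) * (1 : L) ⊗ₜ[E] (algebraMap H F (y l))
      rw [Algebra.TensorProduct.tmul_mul_tmul, mul_one, one_mul, smul_eq_mul, mul_one]) l
    exact (IsFractionRing.to_map_eq_zero_iff (K := L)).1 h4

end CommonDomain

section EFunctions
universe u
variable {K : Type u} [Field K] [Algebra K ℂ] [NumberField K]

lemma polyE_injective : Function.Injective (polyE : Polynomial K →+* eAlg K) := fun p q h =>
  Polynomial.coe_injective K (congr_arg Subtype.val h)

/-- Power series at `α` and E-functions together in one domain. -/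
theorem exists_common_domain (α : ℂ) : ∃ (R : Type u) (_ : CommRing R) (_ : IsDomain R)
    (a : ℂ⟦X⟧ →+* R) (b : eAlg K →+* R) (μ : R →+* FractionRing ℂ⟦X⟧),
    (∀ p : Polynomial K, a (shift α (p.map (algebraMap K ℂ))) = b (polyE p)) ∧
    (∀ x, μ (a x) = algebraMap _ _ x) ∧ (∀ h, μ (b h) = algebraMap _ _ (expand α h)) ∧
    ∀ (ι : Type) [Fintype ι] (y : ι → eAlg K),
      (∀ q : ι → Polynomial K, ∑ i, polyE (q i) * y i = 0 → q = 0) →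
      ∀ c : ι → ℂ⟦X⟧, ∑ i, a (c i) * b (y i) = 0 → c = 0 := by
  obtain ⟨R, i1, i2, a, b, μ, h1, h2⟩ := exists_common_domain_of_closed (j := polyE (K := K))
    polyE_injective (fun p q hq n c h => exists_polyE_mul_eq hq c h) (expand_injective α)
  exact ⟨R, i1, i2, a, b, μ, fun p => by rw [← h1, expand_polyE], h2⟩

end EFunctions

end EFun

namespace EFun
open PowerSeries Matrix

section Growth
open Module
open scoped Pointwise

/-- A sequence of positive integers of polynomial growth does not grow geometrically. -/
lemma not_geometric_of_polynomial_growth {h v : ℕ → ℕ} {d m : ℕ} (h0 : 0 < h 0)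
    (h1 : ∀ N, h (N + 1) ≤ d * v (N + 1)) (h2 : ∀ N, v (N + 1) + h N ≤ h (N + 1))
    (h3 : ∀ N, h N ≤ (N + 1) ^ m) : False := by
  have hpos : ∀ N, 0 < h N := fun N => by
    induction N with
    | zero => exact h0
    | succ N ih => have := h2 N; omega
  have hd : 0 < d := by
    rcases Nat.eq_zero_or_pos d with rfl | hd
    · simpa using (hpos 1).trans_le (h1 0)
    · exact hd
  let ρ : ℝ := 1 - 1 / d
  have hd' : (1 : ℝ) ≤ d := by exact_mod_cast hd
  have hρ0 : 0 ≤ ρ := sub_nonneg.2 ((div_le_one (by positivity)).2 hd')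
  have hρ1 : ρ < 1 := sub_lt_self _ (by positivity)
  have hstep : ∀ N, (h N : ℝ) ≤ ρ * h (N + 1) := fun N => by
    have e1 : (h (N + 1) : ℝ) ≤ d * v (N + 1) := by exact_mod_cast h1 N
    have e2 : (v (N + 1) : ℝ) + h N ≤ h (N + 1) := by exact_mod_cast h2 N
    have e3 : (h (N + 1) : ℝ) / d ≤ v (N + 1) := by
      rw [div_le_iff₀ (by positivity), mul_comm]; exact e1
    have : ρ * h (N + 1) = h (N + 1) - (h (N + 1) : ℝ) / d := by simp only [ρ]; ring
    linarith
  have hgeo : ∀ N, (1 : ℝ) ≤ ρ ^ N * h N := fun N => by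
    induction N with
    | zero => simpa using Nat.one_le_iff_ne_zero.2 h0.ne'
    | succ N ih =>
      refine ih.trans ?_
      rw [pow_succ, mul_assoc]
      exact mul_le_mul_of_nonneg_left (hstep N) (by positivity)
  have hlim : Filter.Tendsto (fun N : ℕ => (2 : ℝ) ^ m * ((N : ℝ) ^ m * ρ ^ N)) Filter.atTop
      (nhds (2 ^ m * 0)) :=
    (tendsto_pow_const_mul_const_pow_of_abs_lt_one m (by rwa [abs_of_nonneg hρ0])).const_mul _
  rw [mul_zero] at hlim
  obtain ⟨N, hN, hN1⟩ := ((hlim.eventually_lt_const one_pos).and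
    (Filter.eventually_ge_atTop 1)).exists
  have hN1' : (1 : ℝ) ≤ N := by exact_mod_cast hN1
  have : (h N : ℝ) ≤ (2 * N) ^ m :=
    calc (h N : ℝ) ≤ (N + 1) ^ m := by exact_mod_cast h3 N
      _ ≤ (2 * N) ^ m := by gcongr; linarith
  have h5 : ρ ^ N * h N ≤ 2 ^ m * ((N : ℝ) ^ m * ρ ^ N) := by
    calc ρ ^ N * h N ≤ ρ ^ N * (2 * N) ^ m := by gcongr
      _ = _ := by rw [mul_pow]; ring
  linarith [hgeo N]

variable {K R : Type*} [Field K] [CommRing R] [Algebra K R] {I : Type*} [Fintype I]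

lemma span_range_pow_le (Z : I → R) (N : ℕ) : Submodule.span K (Set.range Z) ^ N
    ≤ Submodule.span K (Set.range fun k : I → Fin (N + 1) => ∏ i, Z i ^ (k i : ℕ)) := by
  classical
  rw [Submodule.span_pow, Submodule.span_le]
  have : ∀ x ∈ Set.range Z ^ N, ∃ k : I → ℕ, (∀ i, k i ≤ N) ∧ x = ∏ i, Z i ^ k i := by
    induction N with
    | zero =>
      intro x hx
      rw [pow_zero, Set.mem_one] at hx
      exact ⟨0, fun _ => le_rfl, by simp [hx]⟩
    | succ N ih =>
      intro x hx
      rw [pow_succ, Set.mem_mul] at hx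
      obtain ⟨y, hy, _, ⟨i, rfl⟩, rfl⟩ := hx
      obtain ⟨k, hk, rfl⟩ := ih y hy
      refine ⟨k + Pi.single i 1, fun l => ?_, ?_⟩
      · have := hk l
        rcases eq_or_ne l i with rfl | hl
        · simp; omega
        · simp [hl]; omega
      · simp only [Pi.add_apply, pow_add, Finset.prod_mul_distrib]
        congr 1
        rw [Finset.prod_eq_single i (fun l _ hl => by simp [hl]) (by simp)]
        simp
  intro x hx
  obtain ⟨k, hk, rfl⟩ := this x hx
  exact Submodule.subset_span ⟨fun i => ⟨k i, Nat.lt_succ_of_le (hk i)⟩, rfl⟩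

lemma finite_span_range_pow (Z : I → R) (N : ℕ) :
    Module.Finite K (Submodule.span K (Set.range Z) ^ N : Submodule K R) :=
  Module.Finite.iff_fg.2 ((Submodule.fg_span (Set.finite_range Z)).pow N)

lemma finrank_span_range_pow_le (Z : I → R) (N : ℕ) :
    finrank K (Submodule.span K (Set.range Z) ^ N : Submodule K R)
      ≤ (N + 1) ^ Fintype.card I := by
  classical
  have : Module.Finite K (Submodule.span K
      (Set.range fun k : I → Fin (N + 1) => ∏ i, Z i ^ (k i : ℕ))) :=
    Module.Finite.span_of_finite K (Set.finite_range _)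
  calc _ ≤ _ := Submodule.finrank_mono (span_range_pow_le Z N)
    _ ≤ Fintype.card (I → Fin (N + 1)) := finrank_range_le_card _
    _ = _ := by simp

/-- A linear relation between the images of the `Z i` which does not hold between the `Z i`
themselves makes the spaces of homogeneous polynomials in the `Z i` grow. -/
lemma finrank_pow_add_finrank_pow_le [IsDomain R] {F L : Type*} [Field F] [Algebra K F] [CommRing L]
    [Algebra K L] (μ : R →ₐ[K] L) {j : F →ₐ[K] L} (hj : Function.Injective j) {Z : I → R}
    {y : I → F} (hZ : ∀ i, μ (Z i) = j (y i)) {c : I → K} (hc : ∑ i, c i • y i = 0)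
    (hc' : ∑ i, c i • Z i ≠ 0) (N : ℕ) :
    finrank K (Submodule.span K (Set.range y) ^ (N + 1) : Submodule K F)
      + finrank K (Submodule.span K (Set.range Z) ^ N : Submodule K R)
      ≤ finrank K (Submodule.span K (Set.range Z) ^ (N + 1) : Submodule K R) := by
  have f1 := finite_span_range_pow (K := K) Z (N + 1)
  let φ := μ.toLinearMap.domRestrict (Submodule.span K (Set.range Z) ^ (N + 1))
  have hφ := φ.finrank_range_add_finrank_ker
  have hr : φ.range = (Submodule.span K (Set.range y) ^ (N + 1)).map j.toLinearMap := by
    rw [LinearMap.range_domRestrict, Submodule.map_pow, Submodule.map_pow, Submodule.map_span,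
      Submodule.map_span, ← Set.range_comp, ← Set.range_comp]
    congr 3
    funext i
    exact hZ i
  rw [hr, (Submodule.equivMapOfInjective j.toLinearMap hj _).symm.finrank_eq] at hφ
  rw [← hφ]
  refine Nat.add_le_add_left ?_ _
  have hℓ : ∑ i, c i • Z i ∈ Submodule.span K (Set.range Z) :=
    Submodule.sum_mem _ fun i _ => Submodule.smul_mem _ _ (Submodule.subset_span ⟨i, rfl⟩)
  have hμℓ : μ (∑ i, c i • Z i) = 0 := by
    rw [← map_zero j, ← hc, map_sum, map_sum]
    simp only [map_smul, hZ]
  let ψ : (Submodule.span K (Set.range Z) ^ N : Submodule K R) →ₗ[K] φ.ker :=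
    LinearMap.codRestrict _ (LinearMap.codRestrict _
      ((LinearMap.mulLeft K (∑ i, c i • Z i)).domRestrict _) fun x => by
        rw [pow_succ, mul_comm]
        exact Submodule.mul_mem_mul hℓ x.2) fun x => by
        rw [LinearMap.mem_ker]
        change μ (_ * _) = 0
        rw [map_mul, hμℓ, zero_mul]
  refine LinearMap.finrank_le_finrank_of_injective (f := ψ) fun x x' h => Subtype.ext ?_
  exact mul_left_cancel₀ hc' (congr_arg (fun t : φ.ker => ((t : _) : R)) h)

end Growth

end EFun

namespace EFun
open PowerSeries Matrix

variable {K : Type} [Field K] [Algebra K ℂ] [NumberField K]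

section Solutions

/-- The derivation on the ring of E-functions. -/
def derivE : Derivation K (eAlg K) (eAlg K) :=
  Derivation.mk' (LinearMap.codRestrict (eAlg K).toSubmodule
    ((derivative K).toLinearMap.comp (eAlg K).toSubmodule.subtype) fun f => f.2.derivative) fun f g => by
      apply Subtype.ext
      exact (derivative K).leibniz f g

lemma expand_derivE (β : ℂ) (f : eAlg K) : expand β (derivE f) = derivative ℂ (expand β f) :=
  expand_derivative β f

lemma derivE_polyE (p : Polynomial K) : derivE (polyE p) = polyE (Polynomial.derivative p) :=
  Subtype.ext (derivative_coe p)

variable (K) in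
/-- The Taylor expansion of polynomials over `K` at the point `α`. -/
def expandPoly (α : K) : Polynomial K →+* ℂ⟦X⟧ :=
  (shift (algebraMap K ℂ α)).comp (Polynomial.mapRingHom (algebraMap K ℂ))

lemma expandPoly_apply (α : K) (p : Polynomial K) :
    expandPoly K α p = shift (algebraMap K ℂ α) (p.map (algebraMap K ℂ)) := rfl

lemma expand_polyE' (α : K) (p : Polynomial K) :
    expand (algebraMap K ℂ α) (polyE p) = expandPoly K α p := expand_polyE _ p

lemma derivative_expandPoly (α : K) (p : Polynomial K) :
    derivative ℂ (expandPoly K α p) = expandPoly K α (Polynomial.derivative p) := by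
  rw [expandPoly_apply, derivative_shift, Polynomial.derivative_map, expandPoly_apply]

lemma constantCoeff_expandPoly (α : K) (p : Polynomial K) :
    constantCoeff (expandPoly K α p) = algebraMap K ℂ (p.eval α) := by
  rw [expandPoly_apply, constantCoeff_shift, Polynomial.eval_map_apply]

variable {J J' : Type*} [Fintype J] [DecidableEq J] [Fintype J'] [DecidableEq J']

/-- `Ψ` is the fundamental solution at `α`, with `Ψ(α) = 1`, of the system dual to
`T w' = B w`. -/
structure IsFundamental (α : K) (T : Polynomial K) (B : Matrix J J (Polynomial K))
    (Ψ : Matrix J J ℂ⟦X⟧) : Prop where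
  ode : expandPoly K α T • Ψ.map (derivative ℂ) = -(Ψ * B.map (expandPoly K α))
  init : Ψ.map (constantCoeff (R := ℂ)) = 1

lemma expandPoly_ne_zero {α : K} {T : Polynomial K} (hT : T.eval α ≠ 0) : expandPoly K α T ≠ 0 := by
  intro h
  apply hT
  apply (algebraMap K ℂ).injective
  rw [← constantCoeff_expandPoly, h, map_zero, map_zero]

lemma exists_unit_expandPoly {α : K} {T : Polynomial K} (hT : T.eval α ≠ 0) :
    ∃ t : ℂ⟦X⟧, t * expandPoly K α T = 1 := by
  refine ⟨(expandPoly K α T)⁻¹, PowerSeries.inv_mul_cancel _ ?_⟩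
  rw [constantCoeff_expandPoly]
  exact fun h => hT ((algebraMap K ℂ).injective (h.trans (map_zero _).symm))

lemma exists_isFundamental {α : K} {T : Polynomial K} (hT : T.eval α ≠ 0)
    (B : Matrix J J (Polynomial K)) : ∃ Ψ, IsFundamental α T B Ψ := by
  obtain ⟨t, ht⟩ := exists_unit_expandPoly hT
  obtain ⟨Ψ, h1, h2⟩ := exists_fundamental (t • B.map (expandPoly K α))
  refine ⟨Ψ, ?_, h2⟩
  rw [h1, Matrix.mul_smul, smul_neg, smul_smul, mul_comm, ht, one_smul]

lemma eq_of_smul_ode {α : K} {T : Polynomial K} (hT : T.eval α ≠ 0)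
    {M : Matrix J J ℂ⟦X⟧} {A B : Matrix J' J ℂ⟦X⟧}
    (hA : expandPoly K α T • A.map (derivative ℂ) = -(A * M))
    (hB : expandPoly K α T • B.map (derivative ℂ) = -(B * M))
    (h0 : A.map (constantCoeff (R := ℂ)) = B.map (constantCoeff (R := ℂ))) : A = B := by
  obtain ⟨t, ht⟩ := exists_unit_expandPoly hT
  refine eq_of_ode (t • M) A B ?_ ?_ h0
  · rw [Matrix.mul_smul, ← smul_neg, ← hA, smul_smul, ht, one_smul]
  · rw [Matrix.mul_smul, ← smul_neg, ← hB, smul_smul, ht, one_smul]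

/-- The family `w` of E-functions satisfies `T w' = B w`. -/
def SatisfiesODE (T : Polynomial K) (B : Matrix J J (Polynomial K)) (w : J → eAlg K) : Prop :=
  ∀ i, polyE T * derivE (w i) = ∑ l, polyE (B i l) * w l

/-- The family `w` is linearly independent over `K[z]`. -/
def PolyIndep (w : J → eAlg K) : Prop :=
  ∀ q : J → Polynomial K, ∑ i, polyE (q i) * w i = 0 → q = 0

/-- The ODE of a family expressed through an independent one. -/
lemma mul_eq_of_satisfiesODE {T : Polynomial K} {B : Matrix J J (Polynomial K)}
    {B' : Matrix J' J' (Polynomial K)} {w : J → eAlg K} {e : J' → eAlg K}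
    (hw : SatisfiesODE T B w) (he : SatisfiesODE T B' e) (hind : PolyIndep e)
    {G : Matrix J J' (Polynomial K)} (hG : ∀ i, w i = ∑ k, polyE (G i k) * e k) :
    B * G = T • G.map Polynomial.derivative + G * B' := by
  ext1 i k
  rw [← sub_eq_zero]
  refine congr_fun (hind (fun k => (B * G) i k - (T • G.map Polynomial.derivative + G * B') i k) ?_) k
  simp only [map_sub, sub_mul, Finset.sum_sub_distrib]
  rw [sub_eq_zero]
  have h1 : polyE T * derivE (w i) = ∑ k, polyE ((B * G) i k) * e k := by
    rw [hw i]
    simp only [Matrix.mul_apply, map_sum, map_mul, Finset.sum_mul]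
    rw [Finset.sum_comm]
    refine Finset.sum_congr rfl fun l _ => ?_
    rw [hG l, Finset.mul_sum]
    simp only [mul_assoc]
  rw [← h1, hG i, map_sum, Finset.mul_sum]
  simp only [Derivation.leibniz, smul_eq_mul, derivE_polyE, Matrix.add_apply, Matrix.smul_apply,
    Matrix.map_apply, map_add, map_mul, add_mul, mul_add, Finset.sum_add_distrib]
  rw [add_comm]
  congr 1
  · exact Finset.sum_congr rfl fun l _ => by ring
  · simp only [mul_left_comm (polyE T), he _, Matrix.mul_apply, map_sum, map_mul, Finset.sum_mul,
      Finset.mul_sum]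
    rw [Finset.sum_comm]
    simp only [mul_assoc]

lemma IsFundamental.mul_expandPoly {α : K} {T : Polynomial K} (hT : T.eval α ≠ 0)
    {B : Matrix J J (Polynomial K)}
    {B' : Matrix J' J' (Polynomial K)} {Ψ : Matrix J J ℂ⟦X⟧} {Ψ' : Matrix J' J' ℂ⟦X⟧}
    (h : IsFundamental α T B Ψ) (h' : IsFundamental α T B' Ψ') {G : Matrix J J' (Polynomial K)}
    (hG : B * G = T • G.map Polynomial.derivative + G * B') :
    Ψ * G.map (expandPoly K α)
      = G.map (fun p => C (algebraMap K ℂ (p.eval α))) * Ψ' := by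
  refine eq_of_smul_ode hT (M := B'.map (expandPoly K α)) ?_ ?_ ?_
  · rw [map_derivative_mul, smul_add, ← Matrix.smul_mul, h.ode, ← Matrix.mul_smul, Matrix.neg_mul,
      Matrix.mul_assoc, Matrix.mul_assoc, ← Matrix.map_mul, ← Matrix.map_mul, ← Matrix.mul_neg, ← Matrix.mul_neg, ← Matrix.mul_add]
    congr 1
    rw [hG]
    ext1 i k
    simp only [Matrix.add_apply, Matrix.neg_apply, Matrix.map_apply, Matrix.smul_apply, map_add,
      smul_eq_mul, map_mul, derivative_expandPoly]
    ring
  · rw [map_derivative_mul, smul_add, ← Matrix.smul_mul, ← Matrix.mul_smul, h'.ode, Matrix.mul_neg,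
      ← Matrix.mul_assoc]
    have : (G.map fun p => (C (algebraMap K ℂ (p.eval α)) : ℂ⟦X⟧)).map (derivative ℂ) = 0 := by
      ext1 i k
      simp [PowerSeries.derivative_C]
    simp [this]
  · rw [Matrix.map_mul, Matrix.map_mul, h.init, h'.init, Matrix.one_mul, Matrix.mul_one]
    ext1 i k
    simp [constantCoeff_expandPoly]

end Solutions

section Deformation

/-- A domain containing both the power series at `α` and the E-functions. -/
structure Glue (α : K) (R : Type) [CommRing R] where
  series : ℂ⟦X⟧ →+* R
  fns : eAlg K →+* R
  toSeries : R →+* FractionRing ℂ⟦X⟧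
  comm : ∀ p, series (expandPoly K α p) = fns (polyE p)
  toSeries_series : ∀ x, toSeries (series x) = algebraMap _ _ x
  toSeries_fns : ∀ h, toSeries (fns h) = algebraMap _ _ (expand (algebraMap K ℂ α) h)
  indep : ∀ (ι : Type) [Fintype ι] (y : ι → eAlg K), PolyIndep y →
      ∀ c : ι → ℂ⟦X⟧, ∑ i, series (c i) * fns (y i) = 0 → c = 0

lemma exists_glue (α : K) : ∃ (R : Type) (_ : CommRing R) (_ : IsDomain R), Nonempty (Glue α R) := by
  obtain ⟨R, i1, i2, a, b, μ, h1, h2, h3, h4⟩ := exists_common_domain (K := K) (algebraMap K ℂ α)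
  exact ⟨R, i1, i2, ⟨a, b, μ, h1, h2, h3, h4⟩⟩

variable {α : K} {R : Type} [CommRing R] (g : Glue α R)
  {J J' : Type} [Fintype J] [DecidableEq J] [Fintype J'] [DecidableEq J']

namespace Glue

/-- Constants as elements of the glued ring. -/
def const : K →+* R := g.series.comp ((C : ℂ →+* ℂ⟦X⟧).comp (algebraMap K ℂ))

/-- The element `Ψ w`, whose image under `toSeries` is the value of `w` at `α`. -/
def deform (Ψ : Matrix J J ℂ⟦X⟧) (w : J → eAlg K) (i : J) : R :=
  ∑ j, g.series (Ψ i j) * g.fns (w j)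

lemma deform_eq_sum {T : Polynomial K} (hT : T.eval α ≠ 0) {B : Matrix J J (Polynomial K)}
    {B' : Matrix J' J' (Polynomial K)} {Ψ : Matrix J J ℂ⟦X⟧} {Ψ' : Matrix J' J' ℂ⟦X⟧}
    (h : IsFundamental α T B Ψ) (h' : IsFundamental α T B' Ψ') {w : J → eAlg K} {e : J' → eAlg K}
    (hw : SatisfiesODE T B w) (he : SatisfiesODE T B' e) (hind : PolyIndep e)
    {G : Matrix J J' (Polynomial K)} (hG : ∀ i, w i = ∑ k, polyE (G i k) * e k) (i : J) :
    g.deform Ψ w i = ∑ k, g.const ((G i k).eval α) * g.deform Ψ' e k := by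
  have key := h.mul_expandPoly hT h' (mul_eq_of_satisfiesODE hw he hind hG)
  have hk : ∀ k, ∑ j, Ψ i j * expandPoly K α (G j k)
      = ∑ j, C (algebraMap K ℂ ((G i j).eval α)) * Ψ' j k := fun k => by
    simpa [Matrix.mul_apply] using congr_fun (congr_fun key i) k
  calc g.deform Ψ w i = ∑ k, g.series (∑ j, Ψ i j * expandPoly K α (G j k)) * g.fns (e k) := by
        simp only [deform, hG, map_sum, map_mul, ← g.comm, Finset.mul_sum, Finset.sum_mul]
        rw [Finset.sum_comm]
        simp only [mul_assoc]
    _ = _ := by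
        simp only [hk, deform, map_sum, map_mul, Finset.mul_sum, Finset.sum_mul]
        rw [Finset.sum_comm]
        simp only [mul_assoc]
        rfl

lemma toSeries_deform {T : Polynomial K} (hT : T.eval α ≠ 0) {B : Matrix J J (Polynomial K)}
    {Ψ : Matrix J J ℂ⟦X⟧} (h : IsFundamental α T B Ψ) {w : J → eAlg K} (hw : SatisfiesODE T B w)
    (i : J) : g.toSeries (g.deform Ψ w i)
      = algebraMap _ _ (C (toFun (w i : K⟦X⟧) (algebraMap K ℂ α)) : ℂ⟦X⟧) := by
  simp only [deform, map_sum, map_mul, g.toSeries_series, g.toSeries_fns]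
  simp only [← map_mul, ← map_sum]
  congr 1
  have hw' : ∀ j, expandPoly K α T * derivative ℂ (expand (algebraMap K ℂ α) (w j))
      = ∑ l, expandPoly K α (B j l) * expand (algebraMap K ℂ α) (w l) := fun j => by
    rw [← expand_derivE, ← expand_polyE', ← map_mul, hw j]
    simp only [map_sum, map_mul, expand_polyE']
  have hΨ : ∀ j, expandPoly K α T * derivative ℂ (Ψ i j)
      = -∑ l, Ψ i l * expandPoly K α (B l j) := fun j => by
    simpa [Matrix.mul_apply] using congr_fun (congr_fun h.ode i) j
  have h0 : derivative ℂ (∑ j, Ψ i j * expand (algebraMap K ℂ α) (w j)) = 0 := by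
    refine (mul_eq_zero.1 ?_).resolve_left (expandPoly_ne_zero hT)
    simp only [map_sum, Derivation.leibniz, smul_eq_mul, Finset.mul_sum, mul_add,
      Finset.sum_add_distrib]
    simp only [mul_left_comm (expandPoly K α T), hw', hΨ, mul_neg, Finset.sum_neg_distrib]
    rw [add_neg_eq_zero]
    simp only [Finset.mul_sum]
    rw [Finset.sum_comm]
    refine Finset.sum_congr rfl fun j _ => Finset.sum_congr rfl fun l _ => by ring
  refine PowerSeries.derivative.ext (R := ℂ) ?_ ?_
  · rw [h0, PowerSeries.derivative_C]
  · rw [map_sum, PowerSeries.constantCoeff_C]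
    have hi : ∀ j, constantCoeff (Ψ i j) = (1 : Matrix J J ℂ) i j := fun j =>
      congr_fun (congr_fun h.init i) j
    simp [hi, Matrix.one_apply, constantCoeff_expand]

lemma eq_zero_of_sum_const_mul_deform {T : Polynomial K} {B : Matrix J J (Polynomial K)}
    {Ψ : Matrix J J ℂ⟦X⟧} (h : IsFundamental α T B Ψ) {w : J → eAlg K} (hind : PolyIndep w)
    {c : J → K} (hc : ∑ i, g.const (c i) * g.deform Ψ w i = 0) : c = 0 := by
  have h1 := g.indep J w hind (fun j => ∑ i, C (algebraMap K ℂ (c i)) * Ψ i j) (by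
    rw [← hc]
    simp only [deform, map_sum, map_mul, Finset.mul_sum, Finset.sum_mul]
    rw [Finset.sum_comm]
    simp only [mul_assoc]
    rfl)
  funext j
  have h2 := congr_arg (constantCoeff (R := ℂ)) (congr_fun h1 j)
  have hi : ∀ i, constantCoeff (Ψ i j) = (1 : Matrix J J ℂ) i j := fun i =>
      congr_fun (congr_fun h.init i) j
  simpa [hi, Matrix.one_apply] using h2

end Glue

/-- The ODE of the products of two families. -/
def prodODE (B : Matrix J J (Polynomial K)) (B' : Matrix J' J' (Polynomial K)) :
    Matrix (J × J') (J × J') (Polynomial K) :=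
  kroneckerMap (· * ·) B 1 + kroneckerMap (· * ·) 1 B'

lemma SatisfiesODE.prod {T : Polynomial K} {B : Matrix J J (Polynomial K)}
    {B' : Matrix J' J' (Polynomial K)} {w : J → eAlg K} {w' : J' → eAlg K}
    (hw : SatisfiesODE T B w) (hw' : SatisfiesODE T B' w') :
    SatisfiesODE T (prodODE B B') fun p : J × J' => w p.1 * w' p.2 := fun ⟨i, k⟩ => by
  simp only [prodODE, Matrix.add_apply, kroneckerMap_apply, Matrix.one_apply, map_add, add_mul,
    Finset.sum_add_distrib, Fintype.sum_prod_type, Derivation.leibniz, smul_eq_mul, mul_add]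
  rw [mul_left_comm, hw' k, mul_left_comm, hw i, add_comm, Finset.mul_sum, Finset.mul_sum]
  congr 1
  · refine Finset.sum_congr rfl fun l _ => ?_
    rw [Finset.sum_eq_single k (fun m _ hm => by simp [hm.symm]) (by simp)]
    simp; ring
  · rw [Finset.sum_eq_single i (fun m _ hm => by simp [hm.symm]) (by simp)]
    refine Finset.sum_congr rfl fun l _ => ?_
    simp; ring

lemma IsFundamental.prod {T : Polynomial K} {B : Matrix J J (Polynomial K)}
    {B' : Matrix J' J' (Polynomial K)} {Ψ : Matrix J J ℂ⟦X⟧} {Ψ' : Matrix J' J' ℂ⟦X⟧}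
    (h : IsFundamental α T B Ψ) (h' : IsFundamental α T B' Ψ') :
    IsFundamental α T (prodODE B B') (kroneckerMap (· * ·) Ψ Ψ') where
  ode := by
    have e1 : ∀ i j, expandPoly K α T * derivative ℂ (Ψ i j)
        = -∑ l, Ψ i l * expandPoly K α (B l j) := fun i j => by
      simpa [Matrix.mul_apply] using congr_fun (congr_fun h.ode i) j
    have e2 : ∀ i j, expandPoly K α T * derivative ℂ (Ψ' i j)
        = -∑ l, Ψ' i l * expandPoly K α (B' l j) := fun i j => by
      simpa [Matrix.mul_apply] using congr_fun (congr_fun h'.ode i) j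
    ext1 ⟨i, k⟩ ⟨j, m⟩
    simp only [prodODE, Matrix.smul_apply, Matrix.neg_apply, Matrix.mul_apply, Matrix.map_apply,
      Matrix.add_apply, kroneckerMap_apply, Matrix.one_apply, map_add, mul_add,
      Finset.sum_add_distrib, Fintype.sum_prod_type, Derivation.leibniz, smul_eq_mul]
    rw [mul_left_comm, e2, mul_left_comm, e1, add_comm, mul_neg, mul_neg, neg_add, Finset.mul_sum,
      Finset.mul_sum]
    congr 2
    · refine Finset.sum_congr rfl fun l _ => ?_
      rw [Finset.sum_eq_single m (fun n _ hn => by simp [hn]) (by simp)]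
      simp; ring
    · rw [Finset.sum_eq_single j (fun n _ hn => by simp [hn]) (by simp)]
      refine Finset.sum_congr rfl fun l _ => ?_
      simp; ring
  init := by
    ext1 ⟨i, k⟩ ⟨j, m⟩
    have e1 : constantCoeff (Ψ i j) = (1 : Matrix J J ℂ) i j := congr_fun (congr_fun h.init i) j
    have e2 : constantCoeff (Ψ' k m) = (1 : Matrix J' J' ℂ) k m :=
      congr_fun (congr_fun h'.init k) m
    simp only [Matrix.map_apply, kroneckerMap_apply, map_mul, e1, e2, Matrix.one_apply,
      Prod.mk.injEq]
    split_ifs <;> simp_all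

lemma Glue.deform_prod (Ψ : Matrix J J ℂ⟦X⟧) (Ψ' : Matrix J' J' ℂ⟦X⟧) (w : J → eAlg K)
    (w' : J' → eAlg K) (i : J) (k : J') :
    g.deform (kroneckerMap (· * ·) Ψ Ψ') (fun p : J × J' => w p.1 * w' p.2) (i, k)
      = g.deform Ψ w i * g.deform Ψ' w' k := by
  simp only [deform, kroneckerMap_apply, Fintype.sum_prod_type, map_mul, Finset.sum_mul_sum]
  exact Finset.sum_congr rfl fun l _ => Finset.sum_congr rfl fun m _ => by ring

end Deformation

section FreeModules

lemma exists_linearIndependent_span_eq {P H : Type*} [CommRing P] [IsDomain P]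
    [IsPrincipalIdealRing P] [CommRing H] [IsDomain H] [Algebra P H]
    (hinj : Function.Injective (algebraMap P H)) {N : Submodule P H} (hN : N.FG) :
    ∃ (r : ℕ) (e : Fin r → H), LinearIndependent P e ∧ Submodule.span P (Set.range e) = N := by
  have : Module.IsTorsionFree P H := Module.isTorsionFree_iff_algebraMap_injective.2 hinj
  have : Module.Finite P N := Module.Finite.iff_fg.2 hN
  have : Module.Free P N := inferInstance
  let b := Module.finBasis P N
  refine ⟨_, N.subtype ∘ b, b.linearIndependent.map' N.subtype N.ker_subtype, ?_⟩
  rw [Set.range_comp, ← Submodule.map_span, b.span_eq, Submodule.map_top, Submodule.range_subtype]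

end FreeModules


section PowerModules

/-- E-functions over `K` as an algebra over the polynomials. -/
instance polyAlgebra : Algebra (Polynomial K) (eAlg K) := polyE.toAlgebra

lemma poly_smul_def (p : Polynomial K) (f : eAlg K) : p • f = polyE p * f := Algebra.smul_def _ _

variable {I : Type} [Fintype I] [DecidableEq I]

lemma polyIndep_iff {w : I → eAlg K} : PolyIndep w ↔ LinearIndependent (Polynomial K) w := by
  rw [Fintype.linearIndependent_iff]
  simp only [PolyIndep, poly_smul_def, funext_iff, Pi.zero_apply]

lemma polyE_mul_derivE_mem {T : Polynomial K} {A : Matrix I I (Polynomial K)} {Y : I → eAlg K}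
    (hY : SatisfiesODE T A Y) (N : ℕ) {f : eAlg K}
    (hf : f ∈ Submodule.span (Polynomial K) (Set.range Y) ^ N) :
    polyE T * derivE f ∈ Submodule.span (Polynomial K) (Set.range Y) ^ N := by
  induction N generalizing f with
  | zero =>
    rw [pow_zero, Submodule.mem_one] at hf ⊢
    obtain ⟨p, rfl⟩ := hf
    refine ⟨T * Polynomial.derivative p, ?_⟩
    change polyE _ = _ * derivE (polyE p)
    rw [map_mul, derivE_polyE]
  | succ N ih =>
    have h1 : ∀ y ∈ Submodule.span (Polynomial K) (Set.range Y),
        polyE T * derivE y ∈ Submodule.span (Polynomial K) (Set.range Y) := by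
      intro y hy
      induction hy using Submodule.span_induction with
      | mem x hx =>
        obtain ⟨i, rfl⟩ := hx
        rw [hY i]
        refine Submodule.sum_mem _ fun l _ => ?_
        rw [← poly_smul_def]
        exact Submodule.smul_mem _ _ (Submodule.subset_span ⟨l, rfl⟩)
      | zero => rw [map_zero, mul_zero]; exact zero_mem _
      | add x y _ _ hx hy => rw [map_add, mul_add]; exact add_mem hx hy
      | smul p x hx hx' =>
        have : polyE T * derivE (p • x)
            = p • (polyE T * derivE x) + (T * Polynomial.derivative p) • x := by
          simp only [poly_smul_def, Derivation.leibniz, smul_eq_mul, derivE_polyE, map_mul]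
          ring
        rw [this]
        exact add_mem (Submodule.smul_mem _ _ hx') (Submodule.smul_mem _ _ hx)
    rw [pow_succ] at hf ⊢
    induction hf using Submodule.mul_induction_on' with
    | mem_mul_mem m hm n hn =>
      have : polyE T * derivE (m * n)
          = m * (polyE T * derivE n) + (polyE T * derivE m) * n := by
        simp only [Derivation.leibniz, smul_eq_mul]
        ring
      rw [this]
      exact add_mem (Submodule.mul_mem_mul hm (h1 n hn)) (Submodule.mul_mem_mul (ih hm) hn)
    | add x _ y _ hx hy => rw [map_add, mul_add]; exact add_mem hx hy

lemma exists_basis_pow {T : Polynomial K} {A : Matrix I I (Polynomial K)} {Y : I → eAlg K}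
    (hY : SatisfiesODE T A Y) (N : ℕ) : ∃ (r : ℕ) (e : Fin r → eAlg K)
      (B : Matrix (Fin r) (Fin r) (Polynomial K)), PolyIndep e ∧ SatisfiesODE T B e ∧
      Submodule.span (Polynomial K) (Set.range e)
        = Submodule.span (Polynomial K) (Set.range Y) ^ N := by
  obtain ⟨r, e, he, hspan⟩ := exists_linearIndependent_span_eq (P := Polynomial K) (H := eAlg K)
    polyE_injective ((Submodule.fg_span (Set.finite_range Y)).pow N)
  have h1 : ∀ i, ∃ c : Fin r → Polynomial K, ∑ l, c l • e l = polyE T * derivE (e i) := fun i => by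
    rw [← Submodule.mem_span_range_iff_exists_fun, hspan]
    refine polyE_mul_derivE_mem hY N ?_
    rw [← hspan]
    exact Submodule.subset_span ⟨i, rfl⟩
  choose B hB using h1
  exact ⟨r, e, B, polyIndep_iff.2 he, fun i => by simp only [← hB i, poly_smul_def], hspan⟩

/-- The value of an E-function at a point. -/
def evalE (z : ℂ) : eAlg K →+* ℂ := (constantCoeff (R := ℂ)).comp (expand z)

lemma evalE_apply (z : ℂ) (f : eAlg K) : evalE z f = toFun (f : K⟦X⟧) z := constantCoeff_expand _ _

lemma evalE_smul (α : K) (p : Polynomial K) (f : eAlg K) :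
    evalE (algebraMap K ℂ α) (p • f) = p.eval α • evalE (algebraMap K ℂ α) f := by
  rw [poly_smul_def, map_mul, Algebra.smul_def]
  congr 1
  change constantCoeff (expand _ (polyE p)) = _
  rw [expand_polyE', constantCoeff_expandPoly]

lemma evalE_mem_pow (α : K) {Y : I → eAlg K} (N : ℕ) {f : eAlg K}
    (hf : f ∈ Submodule.span (Polynomial K) (Set.range Y) ^ N) : evalE (algebraMap K ℂ α) f
      ∈ Submodule.span K (Set.range fun i => evalE (algebraMap K ℂ α) (Y i)) ^ N := by
  induction N generalizing f with
  | zero =>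
    rw [pow_zero, Submodule.mem_one] at hf ⊢
    obtain ⟨p, rfl⟩ := hf
    refine ⟨p.eval α, ?_⟩
    rw [Algebra.algebraMap_eq_smul_one, Algebra.algebraMap_eq_smul_one p, evalE_smul, map_one]
  | succ N ih =>
    have h1 : ∀ y ∈ Submodule.span (Polynomial K) (Set.range Y), evalE (algebraMap K ℂ α) y
        ∈ Submodule.span K (Set.range fun i => evalE (algebraMap K ℂ α) (Y i)) := by
      intro y hy
      induction hy using Submodule.span_induction with
      | mem x hx =>
        obtain ⟨i, rfl⟩ := hx
        exact Submodule.subset_span ⟨i, rfl⟩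
      | zero => rw [map_zero]; exact zero_mem _
      | add x y _ _ hx hy => rw [map_add]; exact add_mem hx hy
      | smul p x _ hx' => rw [evalE_smul]; exact Submodule.smul_mem _ _ hx'
    rw [pow_succ] at hf ⊢
    induction hf using Submodule.mul_induction_on' with
    | mem_mul_mem m hm n hn =>
      rw [map_mul]
      exact Submodule.mul_mem_mul (ih hm) (h1 n hn)
    | add x _ y _ hx hy => rw [map_add]; exact add_mem hx hy

end PowerModules

section Values
open Module

variable {I : Type} [Fintype I] [DecidableEq I]

lemma card_le_finrank_mul_finrank_span {e : I → eAlg K} {T : Polynomial K}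
    {B : Matrix I I (Polynomial K)} (he : SatisfiesODE T B e) (hind : PolyIndep e) {α : K}
    (hα : α ≠ 0) (hT : T.eval α ≠ 0)
    (h1 : (1 : eAlg K) ∈ Submodule.span (Polynomial K) (Set.range e)) :
    Fintype.card I ≤ finrank ℚ K * finrank K
      (Submodule.span K (Set.range fun i => evalE (algebraMap K ℂ α) (e i))) := by
  refine card_le_finrank_span_values (v := fun i => (e i : K⟦X⟧)) (T := T) (B := B)
    (fun i => (e i).2) (fun i => ?_) (fun q hq => ?_) hα hT (fun i => ?_) ?_
  · have := congr_arg (eAlg K).val (he i)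
    simpa only [map_mul, map_sum] using! this
  · refine hind q (Subtype.ext ?_)
    have : (eAlg K).val (∑ i, polyE (q i) * e i) = 0 := by
      rw [← hq, map_sum]
      exact Finset.sum_congr rfl fun i _ => map_mul _ _ _
    exact this
  · rw [evalE_apply]
    simpa only [PowerSeries.coeff_map] using EBound.hasExpansion (e i).2 (algebraMap K ℂ α)
  · intro h0
    obtain ⟨c, hc⟩ := (Submodule.mem_span_range_iff_exists_fun _).1 h1
    have := congr_arg (evalE (algebraMap K ℂ α)) hc
    rw [map_sum, map_one] at this
    simp only [evalE_smul] at this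
    simp [congr_fun h0 _] at this

lemma Glue.deform_mem_span {α : K} {R : Type} [CommRing R] [Algebra K R] (g : Glue α R)
    (hg : algebraMap K R = g.const) {J J' : Type} [Fintype J] [DecidableEq J] [Fintype J']
    [DecidableEq J'] {T : Polynomial K} (hT : T.eval α ≠ 0) {B : Matrix J J (Polynomial K)}
    {B' : Matrix J' J' (Polynomial K)} {Ψ : Matrix J J ℂ⟦X⟧} {Ψ' : Matrix J' J' ℂ⟦X⟧}
    (h : IsFundamental α T B Ψ) (h' : IsFundamental α T B' Ψ') {w : J → eAlg K} {e : J' → eAlg K}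
    (hw : SatisfiesODE T B w) (he : SatisfiesODE T B' e) (hind : PolyIndep e)
    (hmem : ∀ i, w i ∈ Submodule.span (Polynomial K) (Set.range e)) (i : J) :
    g.deform Ψ w i ∈ Submodule.span K (Set.range (g.deform Ψ' e)) := by
  choose G hG using fun i => (Submodule.mem_span_range_iff_exists_fun _).1 (hmem i)
  rw [g.deform_eq_sum hT h h' hw he hind (G := G) fun i => by simp only [← hG i, poly_smul_def]]
  refine Submodule.sum_mem _ fun k _ => ?_
  rw [← hg, ← Algebra.smul_def]
  exact Submodule.smul_mem _ _ (Submodule.subset_span ⟨k, rfl⟩)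

/-- The values at a nonsingular point of linearly independent E-functions satisfying a system of
first order are linearly independent. -/
theorem linearIndependent_values {Y : I → eAlg K} {T : Polynomial K} {A : Matrix I I (Polynomial K)}
    (hY : SatisfiesODE T A Y) (hind : PolyIndep Y) {i₀ : I} (hi₀ : Y i₀ = 1) {α : K}
    (hα : α ≠ 0) (hT : T.eval α ≠ 0) :
    LinearIndependent K fun i => evalE (algebraMap K ℂ α) (Y i) := by
  rw [Fintype.linearIndependent_iff]
  by_contra! hcon
  obtain ⟨c, hc, i₁, hi₁⟩ := hcon
  obtain ⟨R, _, _, ⟨g⟩⟩ := exists_glue α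
  let : Algebra K R := g.const.toAlgebra
  have hg : algebraMap K R = g.const := rfl
  obtain ⟨Ψ, hΨ⟩ := exists_isFundamental hT A
  have hc' : ∑ i, c i • g.deform Ψ Y i ≠ 0 := fun h => by
    simp only [Algebra.smul_def, hg] at h
    exact hi₁ (congr_fun (g.eq_zero_of_sum_const_mul_deform hΨ hind h) i₁)
  choose r e B he1 he2 he3 using exists_basis_pow hY
  choose Φ hΦ using fun N => exists_isFundamental hT (B N)
  let Z := g.deform Ψ Y
  have hle : ∀ N, Submodule.span K (Set.range Z) ^ N
      ≤ Submodule.span K (Set.range (g.deform (Φ N) (e N))) := fun N => by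
    induction N with
    | zero =>
      rw [pow_zero, Submodule.one_le]
      have hf : IsFundamental α T (0 : Matrix Unit Unit (Polynomial K)) 1 :=
        ⟨by ext1; simp, by ext1; simp⟩
      have := g.deform_mem_span hg hT hf (hΦ 0) (w := fun _ => 1)
        (fun i => by simp) (he2 0) (he1 0) (fun _ => by
          rw [he3 0, pow_zero]; exact Submodule.one_le.1 le_rfl) ()
      simpa [Glue.deform] using this
    | succ N ih =>
      rw [pow_succ']
      refine (mul_le_mul' le_rfl ih).trans ?_
      rw [Submodule.span_mul_span, Submodule.span_le]
      rintro _ ⟨_, ⟨i, rfl⟩, _, ⟨k, rfl⟩, rfl⟩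
      have := g.deform_mem_span hg hT (hΨ.prod (hΦ N)) (hΦ (N + 1)) (hY.prod (he2 N))
        (he2 (N + 1)) (he1 (N + 1)) (fun p => by
          rw [he3, pow_succ']
          refine Submodule.mul_mem_mul (Submodule.subset_span ⟨p.1, rfl⟩) ?_
          rw [← he3]
          exact Submodule.subset_span ⟨p.2, rfl⟩) (i, k)
      rwa [g.deform_prod] at this
  let L := FractionRing ℂ⟦X⟧
  let : Algebra K L := ((algebraMap ℂ⟦X⟧ L).comp ((C : ℂ →+* ℂ⟦X⟧).comp (algebraMap K ℂ))).toAlgebra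
  let μ : R →ₐ[K] L := { g.toSeries with
    commutes' := fun x => g.toSeries_series _ }
  let j : ℂ →ₐ[K] L := { (algebraMap ℂ⟦X⟧ L).comp (C : ℂ →+* ℂ⟦X⟧) with
    commutes' := fun x => rfl }
  refine not_geometric_of_polynomial_growth
    (h := fun N => finrank K (Submodule.span K (Set.range Z) ^ N : Submodule K R))
    (v := fun N => finrank K (Submodule.span K
      (Set.range fun i => evalE (algebraMap K ℂ α) (Y i)) ^ N : Submodule K ℂ))
    (d := finrank ℚ K) (m := Fintype.card I) ?_ (fun N => ?_) (fun N => ?_) (fun N => ?_)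
  · have := finite_span_range_pow (K := K) Z 0
    have : Nontrivial (Submodule.span K (Set.range Z) ^ 0 : Submodule K R) :=
      ⟨⟨⟨1, by rw [pow_zero]; exact Submodule.one_le.1 le_rfl⟩, 0, fun h =>
        one_ne_zero (congr_arg Subtype.val h)⟩⟩
    exact finrank_pos
  · have h1 : (1 : eAlg K) ∈ Submodule.span (Polynomial K) (Set.range (e (N + 1))) := by
      have h1 : (1 : eAlg K) ∈ Submodule.span (Polynomial K) (Set.range Y) :=
        Submodule.subset_span ⟨i₀, hi₀⟩
      rw [he3]
      simpa only [one_pow] using Submodule.pow_mem_pow _ h1 (N + 1)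
    have f1 : Module.Finite K (Submodule.span K (Set.range (g.deform (Φ (N + 1)) (e (N + 1))))) :=
      Module.Finite.span_of_finite K (Set.finite_range _)
    have f2 := finite_span_range_pow (K := K)
      (fun i => evalE (algebraMap K ℂ α) (Y i)) (N + 1)
    calc _ ≤ _ := Submodule.finrank_mono (hle (N + 1))
      _ ≤ Fintype.card (Fin (r (N + 1))) := finrank_range_le_card _
      _ ≤ _ := card_le_finrank_mul_finrank_span (he2 _) (he1 _) hα hT h1
      _ ≤ _ := by
        refine Nat.mul_le_mul_left _ (Submodule.finrank_mono ?_)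
        rw [Submodule.span_le]
        rintro _ ⟨k, rfl⟩
        refine evalE_mem_pow α _ ?_
        rw [← he3]
        exact Submodule.subset_span ⟨k, rfl⟩
  · exact finrank_pow_add_finrank_pow_le μ (j := j) j.toRingHom.injective
      (fun i => by rw [evalE_apply]; exact g.toSeries_deform hT hΨ hY i) hc hc' N
  · exact finrank_span_range_pow_le Z N

end Values

end EFun

namespace EFun
open PowerSeries Matrix

section Recurrence

lemma coeff_X_pow_mul_iterate_derivative (F : ℂ⟦X⟧) (j m : ℕ) :
    coeff m (X ^ j * (derivative ℂ)^[j] F) = (m.descFactorial j : ℂ) * coeff m F := by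
  rw [PowerSeries.coeff_X_pow_mul']
  split_ifs with h
  · obtain ⟨k, rfl⟩ := Nat.exists_eq_add_of_le h
    rw [Nat.add_sub_cancel_left, coeff_iterate_derivative, add_comm j k,
      Nat.add_descFactorial_eq_ascFactorial]
  · rw [Nat.descFactorial_eq_zero_iff_lt.2 (by omega), Nat.cast_zero, zero_mul]

lemma linearIndependent_descPochhammer :
    LinearIndependent ℂ fun j : ℕ => descPochhammer ℂ j := by
  let S : Polynomial.Sequence ℂ := ⟨fun j => descPochhammer ℂ j, fun j => by
    rw [Polynomial.degree_eq_natDegree (monic_descPochhammer ℂ j).ne_zero, descPochhammer_natDegree]⟩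
  exact S.linearIndependent

/-- The coefficients of a power series solution of a linear differential equation are determined
over the field of coefficients of the equation by finitely many of them. -/
lemma exists_bound_coeff_mem {F : ℂ⟦X⟧} {r : ℕ} {p : Fin (r + 1) → Polynomial ℂ}
    (hp : ∃ j, p j ≠ 0) (h : ∑ j, (p j : ℂ⟦X⟧) * (derivative ℂ)^[j] F = 0) :
    ∃ M, ∀ k : IntermediateField ℚ ℂ, (∀ j i, (p j).coeff i ∈ k) → (∀ m < M, coeff m F ∈ k) →
      ∀ m, coeff m F ∈ k := by
  let Q : Fin (r + 1) → Polynomial ℂ := fun j => Polynomial.X ^ (r - j) * p j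
  let q : ℕ → Polynomial ℂ := fun l =>
    ∑ j, Polynomial.C ((Q j).coeff l) * descPochhammer ℂ (j : ℕ)
  have hq : ∀ l m : ℕ, (q l).eval (m : ℂ)
      = ∑ j : Fin (r + 1), (Q j).coeff l * (m.descFactorial j : ℂ) := fun l m => by
    simp only [q, Polynomial.eval_finsetSum, Polynomial.eval_mul, Polynomial.eval_C,
      descPochhammer_eval_eq_descFactorial]
  have hrec : ∀ n, ∑ lm ∈ Finset.HasAntidiagonal.antidiagonal n,
      (q lm.1).eval (lm.2 : ℂ) * coeff lm.2 F = 0 := fun n => by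
    have h1 : ∑ j, (Q j : ℂ⟦X⟧) * (X ^ (j : ℕ) * (derivative ℂ)^[j] F) = 0 := by
      rw [← mul_zero (X ^ r : ℂ⟦X⟧), ← h, Finset.mul_sum]
      refine Finset.sum_congr rfl fun j _ => ?_
      have hX : (X ^ r : ℂ⟦X⟧) = X ^ (r - j : ℕ) * X ^ (j : ℕ) := by
        rw [← pow_add]
        congr 1
        omega
      rw [hX]
      simp only [Q, Polynomial.coe_mul, Polynomial.coe_pow, Polynomial.coe_X]
      ring
    have hc : ∀ j : Fin (r + 1), coeff n ((Q j : ℂ⟦X⟧) * (X ^ (j : ℕ) * (derivative ℂ)^[j] F))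
        = ∑ lm ∈ Finset.HasAntidiagonal.antidiagonal n,
          (Q j).coeff lm.1 * ((lm.2.descFactorial j : ℂ) * coeff lm.2 F) := fun j => by
      rw [PowerSeries.coeff_mul]
      simp only [coeff_X_pow_mul_iterate_derivative, Polynomial.coeff_coe]
    have h2 := congr_arg (coeff n) h1
    rw [map_sum, map_zero, Finset.sum_congr rfl fun j _ => hc j, Finset.sum_comm] at h2
    rw [← h2]
    refine Finset.sum_congr rfl fun lm _ => ?_
    rw [hq, Finset.sum_mul]
    exact Finset.sum_congr rfl fun j _ => by ring
  have hq0 : ∃ l, q l ≠ 0 := by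
    by_contra! hcon
    obtain ⟨j, hj⟩ := hp
    have hli := (linearIndependent_descPochhammer.comp (fun j : Fin (r + 1) => (j : ℕ))
      Fin.val_injective)
    rw [Fintype.linearIndependent_iff] at hli
    apply hj
    have hQ : Q j = 0 := by
      ext l
      have := hli (fun j => (Q j).coeff l) (by
        rw [← hcon l]
        exact Finset.sum_congr rfl fun j _ => by rw [Polynomial.smul_eq_C_mul]; rfl) j
      simpa using this
    exact (mul_eq_zero.1 hQ).resolve_left (pow_ne_zero _ Polynomial.X_ne_zero)
  classical
  let l₀ := Nat.find hq0
  have hl₀ : q l₀ ≠ 0 := Nat.find_spec hq0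
  have hl : ∀ l < l₀, q l = 0 := fun l hl => by simpa using Nat.find_min hq0 hl
  obtain ⟨M, hM⟩ : ∃ M : ℕ, ∀ m : ℕ, M ≤ m → (q l₀).eval (m : ℂ) ≠ 0 := by
    have hfin : {m : ℕ | (q l₀).IsRoot (m : ℂ)}.Finite :=
      (Polynomial.finite_setOfPred_isRoot hl₀).preimage Nat.cast_injective.injOn
    obtain ⟨M, hM⟩ := hfin.bddAbove
    exact ⟨M + 1, fun m hm h0 => by have := hM (a := m) h0; omega⟩
  refine ⟨M, fun k hpk hk m => ?_⟩
  induction m using Nat.strong_induction_on with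
  | _ m ih =>
    rcases lt_or_ge m M with hm | hm
    · exact hk m hm
    have hqk : ∀ l n : ℕ, (q l).eval (n : ℂ) ∈ k := fun l n => by
      rw [hq]
      refine sum_mem fun j _ => mul_mem ?_ (natCast_mem k _)
      simp only [Q, Polynomial.coeff_X_pow_mul']
      split_ifs
      · exact hpk _ _
      · exact zero_mem k
    have h1 := hrec (l₀ + m)
    rw [← Finset.add_sum_erase _ _ (Finset.HasAntidiagonal.mem_antidiagonal.2 rfl :
      (l₀, m) ∈ Finset.HasAntidiagonal.antidiagonal (l₀ + m))] at h1
    have h2 : (q l₀).eval (m : ℂ) * coeff m F ∈ k := by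
      rw [eq_neg_of_add_eq_zero_left h1]
      refine neg_mem (sum_mem fun lm hlm => ?_)
      rw [Finset.mem_erase, Finset.HasAntidiagonal.mem_antidiagonal] at hlm
      rcases lt_trichotomy lm.1 l₀ with hlt | heq | hgt
      · rw [hl _ hlt, Polynomial.eval_zero, zero_mul]
        exact zero_mem k
      · exact absurd (Prod.ext heq (by dsimp only; omega)) hlm.1
      · exact mul_mem (hqk _ _) (ih _ (by omega))
    have := mul_mem (inv_mem (hqk l₀ m)) h2
    rwa [← mul_assoc, inv_mul_cancel₀ (hM m hm), one_mul] at this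

end Recurrence

section Derivatives
variable {K : Type} [Field K] [Algebra K ℂ] [NumberField K]

lemma evalE_ext {f g : eAlg K} (h : ∀ z, evalE z f = evalE z g) : f = g :=
  Subtype.ext <| toFun_injective f.2 g.2 <| funext fun z => by
    rw [← evalE_apply, ← evalE_apply, h]

lemma toFun_iterate_derivE (f : eAlg K) (j : ℕ) :
    toFun ((derivE^[j] f : eAlg K) : K⟦X⟧) = iteratedDeriv j (toFun (f : K⟦X⟧)) := by
  induction j with
  | zero => rw [iteratedDeriv_zero]; rfl
  | succ j ih =>
    rw [Function.iterate_succ_apply', iteratedDeriv_succ, ← ih]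
    exact toFun_derivative (derivE^[j] f).2

lemma evalE_polyE (z : ℂ) (p : Polynomial K) :
    evalE z (polyE p) = (p.map (algebraMap K ℂ)).eval z := by
  rw [evalE_apply, coe_polyE, toFun_coe]

/-- `1` together with the first `s` derivatives of `f`. -/
def derivativeTuple (f : eAlg K) (s : ℕ) : Fin (s + 1) → eAlg K :=
  Fin.cons 1 fun j : Fin s => derivE^[j] f

lemma evalE_sum_derivativeTuple (f : eAlg K) (s : ℕ) (q : Fin (s + 1) → Polynomial K) (z : ℂ) :
    evalE z (∑ i, polyE (q i) * derivativeTuple f s i) = ((q 0).map (algebraMap K ℂ)).eval z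
      + ∑ j : Fin s, ((q j.succ).map (algebraMap K ℂ)).eval z
        * iteratedDeriv (j : ℕ) (toFun (f : K⟦X⟧)) z := by
  rw [Fin.sum_univ_succ, map_add, map_sum]
  congr 1
  · rw [derivativeTuple, Fin.cons_zero, mul_one, evalE_polyE]
  · refine Finset.sum_congr rfl fun j _ => ?_
    rw [derivativeTuple, Fin.cons_succ, map_mul, evalE_polyE, evalE_apply, toFun_iterate_derivE]

lemma exists_satisfiesODE_derivativeTuple {f : eAlg K} {s : ℕ} {u : Fin (s + 2) → Polynomial K}
    (hu : ∀ z : ℂ, ((u 0).map (algebraMap K ℂ)).eval z * iteratedDeriv s (toFun (f : K⟦X⟧)) z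
      = ((u 1).map (algebraMap K ℂ)).eval z
        + ∑ j : Fin s, ((u j.succ.succ).map (algebraMap K ℂ)).eval z
          * iteratedDeriv (j : ℕ) (toFun (f : K⟦X⟧)) z) :
    ∃ A, SatisfiesODE (u 0) A (derivativeTuple f s) := by
  have hrow : ∀ i, ∃ b : Fin (s + 1) → Polynomial K,
      polyE (u 0) * derivE (derivativeTuple f s i) = ∑ l, polyE (b l) * derivativeTuple f s l := by
    refine Fin.cases ⟨0, ?_⟩ fun j => ?_
    · rw [derivativeTuple, Fin.cons_zero, Derivation.map_one_eq_zero, mul_zero]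
      simp
    · have hj : derivE (derivativeTuple f s j.succ) = derivE^[j + 1] f := by
        rw [derivativeTuple, Fin.cons_succ, Function.iterate_succ_apply']
      rw [hj]
      rcases Nat.lt_or_ge (j + 1) s with h | h
      · refine ⟨Pi.single (Fin.succ ⟨j + 1, h⟩) (u 0), ?_⟩
        rw [Finset.sum_eq_single (Fin.succ ⟨j + 1, h⟩), Pi.single_eq_same, derivativeTuple,
          Fin.cons_succ]
        · intro l _ hl
          rw [Pi.single_eq_of_ne hl, map_zero, zero_mul]
        · simp
      · have hjs : (j : ℕ) + 1 = s := by omega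
        refine ⟨fun i => u i.succ, evalE_ext fun z => ?_⟩
        rw [evalE_sum_derivativeTuple, map_mul, evalE_polyE, evalE_apply, toFun_iterate_derivE, hjs,
          hu]
        rfl
  choose A hA using hrow
  exact ⟨Matrix.of A, hA⟩

theorem linearIndependent_derivatives (f : eAlg K) (s : ℕ)
    (hind : ∀ q : Fin (s + 1) → Polynomial K,
      (∀ z : ℂ, ((q 0).map (algebraMap K ℂ)).eval z
          + ∑ j : Fin s, ((q j.succ).map (algebraMap K ℂ)).eval z
            * iteratedDeriv (j : ℕ) (toFun (f : K⟦X⟧)) z = 0) → q = 0)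
    (u : Fin (s + 2) → Polynomial K)
    (hu : ∀ z : ℂ, ((u 0).map (algebraMap K ℂ)).eval z * iteratedDeriv s (toFun (f : K⟦X⟧)) z
      = ((u 1).map (algebraMap K ℂ)).eval z
        + ∑ j : Fin s, ((u j.succ.succ).map (algebraMap K ℂ)).eval z
          * iteratedDeriv (j : ℕ) (toFun (f : K⟦X⟧)) z)
    {α : K} (hα : α ≠ 0) (hαu : (u 0).eval α ≠ 0) :
    LinearIndependent K (Fin.cons (1 : ℂ) fun j : Fin s =>
      iteratedDeriv (j : ℕ) (toFun (f : K⟦X⟧)) (algebraMap K ℂ α)) := by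
  obtain ⟨A, hA⟩ := exists_satisfiesODE_derivativeTuple hu
  have hY : PolyIndep (derivativeTuple f s) := fun q hq => hind q fun z => by
    rw [← evalE_sum_derivativeTuple, hq, map_zero]
  convert! linearIndependent_values hA hY (i₀ := 0) rfl hα hαu using 1
  funext i
  refine Fin.cases ?_ (fun j => ?_) i
  · rw [derivativeTuple, Fin.cons_zero, Fin.cons_zero, map_one]
  · rw [derivativeTuple, Fin.cons_succ, Fin.cons_succ, evalE_apply, toFun_iterate_derivE]

end Derivatives

section Descent

lemma HasExpansion.iteratedDeriv {F : ℂ⟦X⟧} {f : ℂ → ℂ} (hf : HasExpansion F f) (j : ℕ) :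
    HasExpansion ((PowerSeries.derivative ℂ)^[j] F) (_root_.iteratedDeriv j f) := by
  induction j with
  | zero => rwa [iteratedDeriv_zero]
  | succ j ih =>
    rw [Function.iterate_succ_apply', iteratedDeriv_succ]
    exact ih.derivative

lemma HasExpansion.sum {J : Type*} (t : Finset J) {g : J → ℂ⟦X⟧} {G : J → ℂ → ℂ}
    (h : ∀ j, HasExpansion (g j) (G j)) :
    HasExpansion (∑ j ∈ t, g j) fun z => ∑ j ∈ t, G j z := fun z => by
  simp only [map_sum, Finset.sum_mul]
  exact hasSum_sum fun j _ => h j z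

lemma exists_lift_polynomial {k : IntermediateField ℚ ℂ} {p : Polynomial ℂ}
    (hp : ∀ i, p.coeff i ∈ k) : ∃ q : Polynomial k, q.map (algebraMap k ℂ) = p := by
  have : p ∈ Polynomial.lifts (algebraMap k ℂ) :=
    (Polynomial.lifts_iff_coeff_lifts p).2 fun i => ⟨⟨_, hp i⟩, rfl⟩
  exact (Polynomial.mem_lifts p).1 this

end Descent

section Descent

lemma exists_ringHom_extension {A B : Type*} [Field A] [Field B] [Algebra A B]
    [Algebra.IsAlgebraic A B] (σ : A →+* ℂ) : ∃ τ : B →+* ℂ, ∀ x, τ (algebraMap A B x) = σ x := by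
  let := σ.toAlgebra
  let τ : B →ₐ[A] ℂ := IsAlgClosed.lift
  exact ⟨τ.toRingHom, τ.commutes⟩

lemma le_Qbar (k : IntermediateField ℚ ℂ) [FiniteDimensional ℚ k] : k ≤ Qbar := fun x hx => by
  have h := Algebra.IsAlgebraic.isAlgebraic (R := ℚ) (⟨x, hx⟩ : k)
  exact (mem_algebraicClosure_iff).2 (h.algebraMap (A := ℂ))

lemma exists_embedding_extension (k : IntermediateField ℚ ℂ) [FiniteDimensional ℚ k] (σ : k →+* ℂ) :
    ∃ τ : Qbar →+* ℂ, ∀ (x : k) (y : Qbar), (x : ℂ) = y → τ y = σ x := by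
  let := (IntermediateField.inclusion (le_Qbar k)).toRingHom.toAlgebra
  have : IsScalarTower ℚ k Qbar := IsScalarTower.of_algebraMap_eq fun x => rfl
  have : Algebra.IsAlgebraic ℚ Qbar := algebraicClosure.isAlgebraic ℚ ℂ
  have : Algebra.IsAlgebraic k Qbar := Algebra.IsAlgebraic.tower_top (K := ℚ) k
  obtain ⟨τ, hτ⟩ := exists_ringHom_extension (B := Qbar) σ
  refine ⟨τ, fun x y h => ?_⟩
  rw [← hτ x]
  congr 1
  exact Subtype.ext h.symm

lemma eBound_of_isEFunctionWith {a : ℕ → Qbar} {f : ℂ → ℂ} (h : IsEFunctionWith a f)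
    {k : IntermediateField ℚ ℂ} [FiniteDimensional ℚ k] {g : k⟦X⟧}
    (hg : map (algebraMap k ℂ) g = mk fun n => (a n : ℂ) / n.factorial) : EBound g := by
  obtain ⟨-, ⟨C, hC, hσ⟩, ⟨D, hD, d, hd, hint⟩, -⟩ := h
  have hc : ∀ n, ((n.factorial * coeff n g : k) : ℂ) = a n := fun n => by
    have h1 : algebraMap k ℂ (coeff n g) = (a n : ℂ) / n.factorial := by
      rw [← coeff_map, hg, coeff_mk]
    have h2 : algebraMap k ℂ (n.factorial * coeff n g) = a n := by
      rw [map_mul, map_natCast, h1, mul_div_cancel₀]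
      exact_mod_cast n.factorial_ne_zero
    exact h2
  refine ⟨⟨max C 1, le_max_right _ _, fun σ n => ?_⟩, ⌈D⌉₊, d, fun n => ⟨(hd n).1, ?_, fun m hm => ?_⟩⟩
  · obtain ⟨τ, hτ⟩ := exists_embedding_extension k σ
    rw [← hτ _ _ (hc n)]
    exact (hσ τ n).trans (pow_le_pow_left₀ hC.le (le_max_left _ _) _)
  · have : (d n : ℝ) ≤ (⌈D⌉₊ : ℝ) ^ (n + 1) :=
      (hd n).2.trans (pow_le_pow_left₀ hD.le (Nat.le_ceil D) _)
    exact_mod_cast this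
  · refine (isIntegral_algebraMap_iff (B := ℂ) (algebraMap k ℂ).injective).1 ?_
    rw [map_mul, map_natCast]
    have h3 : algebraMap k ℂ (m.factorial * coeff m g) = a m := hc m
    rw [h3]
    exact hint n m hm

lemma exists_finite_generators_polynomial {J : Type*} [Finite J] {p : J → Polynomial ℂ}
    (hp : ∀ j i, IsAlgebraic ℚ ((p j).coeff i)) :
    ∃ S : Set ℂ, S.Finite ∧ (∀ x ∈ S, IsAlgebraic ℚ x) ∧ ∀ k : IntermediateField ℚ ℂ, S ⊆ k →
      ∀ j i, (p j).coeff i ∈ k := by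
  refine ⟨⋃ j, ((p j).coeffs : Set ℂ), Set.finite_iUnion fun j => (p j).coeffs.finite_toSet,
    fun x hx => ?_, fun k hk j i => ?_⟩
  · obtain ⟨j, hj⟩ := Set.mem_iUnion.1 hx
    obtain ⟨i, -, rfl⟩ := Polynomial.mem_coeffs_iff.1 hj
    exact hp j i
  · by_cases h0 : (p j).coeff i = 0
    · rw [h0]
      exact zero_mem k
    · exact hk (Set.mem_iUnion.2 ⟨j, Polynomial.coeff_mem_coeffs h0⟩)

/-- The Taylor coefficients of an E-function generate a number field. -/
lemma exists_finite_generators {a : ℕ → Qbar} {f : ℂ → ℂ} (h : IsEFunctionWith a f) :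
    ∃ S : Set ℂ, S.Finite ∧ (∀ x ∈ S, IsAlgebraic ℚ x) ∧ ∀ k : IntermediateField ℚ ℂ, S ⊆ k →
      ∀ n, (a n : ℂ) / n.factorial ∈ k := by
  have hF : HasExpansion (mk fun n => (a n : ℂ) / n.factorial) f := fun z => by
    simpa only [coeff_mk] using h.1 z
  obtain ⟨-, -, -, r, p, hp, hp0, hode⟩ := h
  have hrel : ∑ j, (p j : ℂ⟦X⟧) * (PowerSeries.derivative ℂ)^[j]
      (mk fun n => (a n : ℂ) / n.factorial) = 0 := by
    refine (HasExpansion.sum Finset.univ fun j : Fin (r + 1) =>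
      (hasExpansion_coe (p j)).mul (hF.iteratedDeriv j)).unique (?_ : HasExpansion 0 _)
    simp only [Pi.mul_apply, hode]
    simpa using! hasExpansion_C 0
  obtain ⟨M, hM⟩ := exists_bound_coeff_mem hp0 hrel
  obtain ⟨S, hS, hSalg, hSk⟩ := exists_finite_generators_polynomial hp
  refine ⟨S ∪ (fun n => (a n : ℂ) / n.factorial) '' Set.Iio M,
    hS.union ((Set.finite_Iio M).image _), ?_, fun k hk n => ?_⟩
  · rintro x (hx | ⟨n, -, rfl⟩)
    · exact hSalg x hx
    · have h1 : IsAlgebraic ℚ (a n : ℂ) := mem_algebraicClosure_iff.1 (a n).2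
      exact h1.mul (isAlgebraic_natCast n.factorial).inv
  · have := hM k (hSk k (Set.subset_union_left.trans hk)) (fun m hm => ?_) n
    · rwa [coeff_mk] at this
    · rw [coeff_mk]
      exact hk (Or.inr ⟨m, hm, rfl⟩)

end Descent

end EFun

open EFun in
/-- If `f` is an E-function such that `1, f, f', …, f^(s-1)` are linearly independent
over `ℚ̄(z)` (expressed here by the nonexistence of a nontrivial relation with
coefficients in `ℚ̄[z]`) and `u₀ f^(s) = u₁ + u₂ f + u₃ f' + ⋯ + u_{s+1} f^(s-1)`
for polynomials `uⱼ ∈ ℚ̄[z]` with `u₀ ≠ 0`, then for every nonzero algebraic `α` with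
`u₀(α) ≠ 0` the numbers `1, f(α), f'(α), …, f^(s-1)(α)` are linearly independent
over `ℚ̄`; in particular `f(α)` is transcendental. -/
theorem values_linearly_independent_at_nonsingular_points
    (f : ℂ → ℂ) (hf : IsEFunction f) (s : ℕ) (hs : 1 ≤ s)
    (hindep : ∀ q : Fin (s + 1) → Polynomial ℂ,
      (∀ j k, IsAlgebraic ℚ ((q j).coeff k)) →
      (∀ z : ℂ, (q 0).eval z
          + ∑ j : Fin s, (q j.succ).eval z * iteratedDeriv (j : ℕ) f z = 0) →
      ∀ j, q j = 0)
    (u : Fin (s + 2) → Polynomial ℂ)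
    (hualg : ∀ j k, IsAlgebraic ℚ ((u j).coeff k)) (hu0 : u 0 ≠ 0)
    (hueq : ∀ z : ℂ, (u 0).eval z * iteratedDeriv s f z
      = (u 1).eval z + ∑ j : Fin s, (u j.succ.succ).eval z * iteratedDeriv (j : ℕ) f z)
    (α : ℂ) (hα : IsAlgebraic ℚ α) (hα0 : α ≠ 0) (hαu : (u 0).eval α ≠ 0) :
    LinearIndependent Qbar
      (Fin.cons (1 : ℂ) (fun j : Fin s => iteratedDeriv (j : ℕ) f α)) ∧
    Transcendental ℚ (f α) := by
  have key : LinearIndependent Qbar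
      (Fin.cons (1 : ℂ) (fun j : Fin s => iteratedDeriv (j : ℕ) f α)) := by
    rw [Fintype.linearIndependent_iff]
    intro g hg
    obtain ⟨a, ha⟩ := hf
    obtain ⟨S, hS, hSalg, hSk⟩ := exists_finite_generators ha
    obtain ⟨U, hU, hUalg, hUk⟩ := exists_finite_generators_polynomial hualg
    let V : Set ℂ := S ∪ U ∪ (Set.range fun i => (g i : ℂ)) ∪ {α}
    have hV : V.Finite := ((hS.union hU).union (Set.finite_range _)).union (Set.finite_singleton α)
    have hValg : ∀ x ∈ V, IsAlgebraic ℚ x := by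
      rintro x (((hx | hx) | ⟨i, rfl⟩) | rfl)
      · exact hSalg x hx
      · exact hUalg x hx
      · exact mem_algebraicClosure_iff.1 (g i).2
      · exact hα
    let k : IntermediateField ℚ ℂ := IntermediateField.adjoin ℚ V
    have hVk : V ⊆ k := IntermediateField.subset_adjoin ℚ V
    have : Finite V := hV
    have : FiniteDimensional ℚ k :=
      IntermediateField.finiteDimensional_adjoin fun x hx => (hValg x hx).isIntegral
    have : NumberField k := ⟨⟩
    let F : PowerSeries k := PowerSeries.mk fun n =>
      ⟨(a n : ℂ) / n.factorial, hSk k (fun x hx => hVk (Or.inl (Or.inl (Or.inl hx)))) n⟩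
    have hF : PowerSeries.map (algebraMap k ℂ) F = PowerSeries.mk fun n => (a n : ℂ) / n.factorial := by
      ext n
      rw [PowerSeries.coeff_map, PowerSeries.coeff_mk, PowerSeries.coeff_mk]
      rfl
    let E : eAlg k := ⟨F, eBound_of_isEFunctionWith ha hF⟩
    have hEf : toFun (E : PowerSeries k) = f := HasExpansion.toFun_eq <| by
      rw [hF]
      intro z
      simpa only [PowerSeries.coeff_mk] using ha.1 z
    choose u' hu' using fun j => exists_lift_polynomial
      (hUk k (fun x hx => hVk (Or.inl (Or.inl (Or.inr hx)))) j)
    have hαk : α ∈ k := hVk (Or.inr rfl)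
    have hli := linearIndependent_derivatives E s (fun q hq => ?_) u' (fun z => ?_)
      (α := ⟨α, hαk⟩) (fun h => hα0 (congr_arg Subtype.val h)) (fun h => hαu ?_)
    · rw [Fintype.linearIndependent_iff] at hli
      intro i
      have := hli (fun i => ⟨g i, hVk (Or.inl (Or.inr ⟨i, rfl⟩))⟩) (by rw [hEf]; exact hg) i
      exact Subtype.ext (congr_arg (Subtype.val : k → ℂ) this)
    · rw [hEf] at hq
      have h0 := hindep (fun j => (q j).map (algebraMap k ℂ)) (fun j i => ?_) hq
      · exact funext fun j =>
          (Polynomial.map_eq_zero_iff (algebraMap k ℂ).injective).1 (h0 j)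
      · rw [Polynomial.coeff_map]
        exact (Algebra.IsAlgebraic.isAlgebraic (R := ℚ) ((q j).coeff i)).algebraMap
    · simp only [hu', hEf]
      exact hueq z
    · have h1 := Polynomial.eval_map_apply (algebraMap k ℂ) (p := u' 0) (⟨α, hαk⟩ : k)
      rw [hu', h, map_zero] at h1
      exact h1
  refine ⟨key, fun hfα => ?_⟩
  obtain ⟨t, rfl⟩ : ∃ t, s = t + 1 := ⟨s - 1, by omega⟩
  rw [Fintype.linearIndependent_iff] at key
  have h := key (Fin.cons ⟨f α, mem_algebraicClosure_iff.2 hfα⟩ (Fin.cons (-1) 0)) ?_ 1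
  · rw [← Fin.succ_zero_eq_one, Fin.cons_succ, Fin.cons_zero] at h
    exact one_ne_zero (neg_eq_zero.1 h)
  · simp [Fin.sum_univ_succ, IntermediateField.smul_def]
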